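/- arXiv:2504.19582 — 5 statements merged into one kernel-verified Lean document; each statement's English description precedes it below -/
import Mathlib

section
/- For every integer n ≥ 3 there exists a finite simple graph U_n of treewidth at most 3 (in particular, K_5-minor-free) with at most n^{20·log₂ n} vertices that contains every n-vertex graph of treewidth at most 2 (equivalently, every n-vertex K_4-minor-free graph) as a subgraph. -/
open SimpleGraph

/-- `H` is a minor of `G`: there are pairwise disjoint, connected (hence nonempty) branch
sets, one for each vertex of `H`, with an edge of `G` between the branch sets of any two
adjacent vertices of `H`. -/
def SimpleGraph.HasMinor {α : Type*} {β : Type*} (G : SimpleGraph α) (H : SimpleGraph β) : Prop :=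
  ∃ B : β → Set α,
    (∀ b, (SimpleGraph.induce (B b) G).Connected) ∧
    (Pairwise fun b b' => Disjoint (B b) (B b')) ∧
    (∀ b b', H.Adj b b' → ∃ u ∈ B b, ∃ v ∈ B b', G.Adj u v)
/-- `G` has a tree-decomposition of width at most `k`. -/
def HasTreewidthAtMost {V : Type*} (G : SimpleGraph V) (k : ℕ) : Prop :=
  ∃ (ι : Type) (_ : Fintype ι) (T : SimpleGraph ι) (B : ι → Set V),
    T.IsTree ∧
    (∀ v, ∃ t, v ∈ B t) ∧
    (∀ u v, G.Adj u v → ∃ t, u ∈ B t ∧ v ∈ B t) ∧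
    (∀ v, (SimpleGraph.induce {t | v ∈ B t} T).Connected) ∧
    (∀ t, (B t).ncard ≤ k + 1)
/-- `U` contains `H` as a subgraph. -/
def ContainsSub {α β : Type*} (U : SimpleGraph β) (H : SimpleGraph α) : Prop :=
  ∃ f : α → β, Function.Injective f ∧ ∀ a b, H.Adj a b → U.Adj (f a) (f b)

namespace UniversalGraph

section Connectivity

variable {V W : Type*}

/-- Steps along edges of `G` that stay inside `X`. -/
def StepIn (G : SimpleGraph V) (X : Set V) (a b : V) : Prop := G.Adj a b ∧ a ∈ X ∧ b ∈ X

lemma connected_induce_iff {G : SimpleGraph V} {X : Set V} :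
    (G.induce X).Connected ↔
      X.Nonempty ∧ ∀ a ∈ X, ∀ b ∈ X, Relation.ReflTransGen (StepIn G X) a b := by
  constructor
  · intro h
    refine ⟨Set.nonempty_coe_sort.1 h.nonempty, fun a ha b hb => ?_⟩
    have := (reachable_iff_reflTransGen _ _).1 (h.preconnected ⟨a, ha⟩ ⟨b, hb⟩)
    exact this.lift Subtype.val fun x y hxy => ⟨hxy, x.2, y.2⟩
  · rintro ⟨⟨x, hx⟩, h⟩
    have : Nonempty X := ⟨⟨x, hx⟩⟩
    refine ⟨fun a b => (reachable_iff_reflTransGen _ _).2 ?_⟩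
    have key : ∀ c, Relation.ReflTransGen (StepIn G X) a c → ∀ hc : c ∈ X,
        Relation.ReflTransGen (G.induce X).Adj a ⟨c, hc⟩ := by
      intro c hac
      induction hac with
      | refl => exact fun _ => .refl
      | tail _ hbc ih => exact fun hc => (ih hbc.2.1).tail hbc.1
    exact key b (h a a.2 b b.2) b.2

lemma reflTransGen_stepIn_symm {G : SimpleGraph V} {X : Set V} {a b : V}
    (h : Relation.ReflTransGen (StepIn G X) a b) : Relation.ReflTransGen (StepIn G X) b a := by
  induction h with
  | refl => exact .refl
  | tail _ h ih => exact .head ⟨h.1.symm, h.2.2, h.2.1⟩ ih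

lemma StepIn.mono {G : SimpleGraph V} {X Y : Set V} (hXY : X ⊆ Y) {a b : V}
    (h : Relation.ReflTransGen (StepIn G X) a b) : Relation.ReflTransGen (StepIn G Y) a b :=
  Relation.ReflTransGen.mono (fun _ _ h => ⟨h.1, hXY h.2.1, hXY h.2.2⟩) _ _ h

lemma connected_induce_singleton (G : SimpleGraph V) (a : V) :
    (G.induce {a}).Connected := by
  refine connected_induce_iff.2 ⟨⟨a, rfl⟩, ?_⟩
  rintro _ rfl _ rfl
  exact .refl

lemma connected_induce_pair {G : SimpleGraph V} {a b : V} (h : G.Adj a b) :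
    (G.induce {a, b}).Connected := by
  refine connected_induce_iff.2 ⟨⟨a, by simp⟩, ?_⟩
  have h1 : StepIn G {a, b} a b := ⟨h, by simp, by simp⟩
  have h2 : StepIn G {a, b} b a := ⟨h.symm, by simp, by simp⟩
  rintro x (rfl | rfl) y (rfl | rfl)
  exacts [.refl, .single h1, .single h2, .refl]

lemma connected_induce_insert {G : SimpleGraph V} {X : Set V} {a b : V}
    (hX : (G.induce X).Connected) (hb : b ∈ X) (h : G.Adj a b) :
    (G.induce (insert a X)).Connected := by
  rw [connected_induce_iff] at hX ⊢
  refine ⟨⟨a, by simp⟩, ?_⟩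
  have key : ∀ x ∈ insert a X, Relation.ReflTransGen (StepIn G (insert a X)) x b := by
    rintro x (rfl | hx)
    · exact .single ⟨h, by simp, by simp [hb]⟩
    · exact StepIn.mono (Set.subset_insert _ _) (hX.2 x hx b hb)
  exact fun x hx y hy => (key x hx).trans (reflTransGen_stepIn_symm (key y hy))

/-- If connected sets `F i`, indexed by the elements of a connected set `Y`, have edges
(or common vertices) along the edges of `Y`, then their union is connected. -/
lemma connected_induce_biUnion {G : SimpleGraph V} {H : SimpleGraph W} {Y : Set W}
    (F : W → Set V) (hY : (H.induce Y).Connected) (hF : ∀ i ∈ Y, (G.induce (F i)).Connected)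
    (hFF : ∀ i j, H.Adj i j → ∃ u ∈ F i, ∃ v ∈ F j, u = v ∨ G.Adj u v) :
    (G.induce (⋃ i ∈ Y, F i)).Connected := by
  rw [connected_induce_iff] at hY ⊢
  obtain ⟨⟨i, hi⟩, hY⟩ := hY
  obtain ⟨x, hx⟩ := (connected_induce_iff.1 (hF i hi)).1
  refine ⟨⟨x, Set.mem_biUnion hi hx⟩, fun a ha b hb => ?_⟩
  simp only [Set.mem_iUnion] at ha hb
  obtain ⟨k, hk, ha⟩ := ha
  obtain ⟨l, hl, hb⟩ := hb
  have sub : ∀ {j}, j ∈ Y → F j ⊆ ⋃ i ∈ Y, F i := fun hj => Set.subset_biUnion_of_mem hj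
  have key : ∀ j, Relation.ReflTransGen (StepIn H Y) k j → j ∈ Y →
      ∀ b ∈ F j, Relation.ReflTransGen (StepIn G (⋃ i ∈ Y, F i)) a b := by
    intro j hj
    induction hj with
    | refl =>
      exact fun _ b hb => StepIn.mono (sub hk) ((connected_induce_iff.1 (hF k hk)).2 a ha b hb)
    | tail _ hij ih =>
      intro hj b hb
      obtain ⟨u, hu, v, hv, huv⟩ := hFF _ _ hij.1
      have hau := ih hij.2.1 u hu
      have hvb := StepIn.mono (sub hj) ((connected_induce_iff.1 (hF _ hj)).2 v hv b hb)
      rcases huv with rfl | huv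
      · exact hau.trans hvb
      · exact (hau.tail ⟨huv, sub hij.2.1 hu, sub hj hv⟩).trans hvb
  exact key l (hY k hk l hl) hl b hb

end Connectivity

section Minors

variable {U V W : Type*}

lemma hasMinor_trans {G : SimpleGraph U} {H : SimpleGraph V} {K : SimpleGraph W}
    (h₁ : G.HasMinor H) (h₂ : H.HasMinor K) : G.HasMinor K := by
  obtain ⟨B, hB, hBd, hBa⟩ := h₁
  obtain ⟨C, hC, hCd, hCa⟩ := h₂
  refine ⟨fun c => ⋃ i ∈ C c, B i, fun c => ?_, fun c c' hcc => ?_, fun c c' hcc => ?_⟩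
  · refine connected_induce_biUnion B (hC c) (fun i _ => hB i) fun i j hij => ?_
    obtain ⟨u, hu, v, hv, huv⟩ := hBa i j hij
    exact ⟨u, hu, v, hv, Or.inr huv⟩
  · simp only [Set.disjoint_iUnion_left, Set.disjoint_iUnion_right]
    intro i hi j hj
    refine hBd ?_
    rintro rfl
    exact Set.disjoint_left.1 (hCd hcc) hj hi
  · obtain ⟨i, hi, j, hj, hij⟩ := hCa c c' hcc
    obtain ⟨u, hu, v, hv, huv⟩ := hBa i j hij
    exact ⟨u, Set.mem_biUnion hi hu, v, Set.mem_biUnion hj hv, huv⟩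

end Minors

section Treewidth

/-- Subtrees of a finite tree have the Helly property. -/
lemma exists_mem_of_pairwise_inter {κ : Type*} [Nonempty κ] (m : ℕ) :
    ∀ (ι : Type) [Fintype ι] (T : SimpleGraph ι) (X : κ → Set ι), Fintype.card ι = m →
      T.IsTree → (∀ i, (T.induce (X i)).Connected) → (∀ i j, (X i ∩ X j).Nonempty) →
      ∃ t, ∀ i, t ∈ X i := by
  classical
  induction m with
  | zero =>
    intro ι _ T X hm hT
    have := hT.1.nonempty
    exact absurd hm Fintype.card_ne_zero
  | succ m ih =>
    intro ι _ T X hm hT hX hXX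
    rcases subsingleton_or_nontrivial ι with hι | hι
    · obtain ⟨t⟩ := hT.1.nonempty
      refine ⟨t, fun i => ?_⟩
      obtain ⟨s, hs, -⟩ := hXX i i
      rwa [Subsingleton.elim t s]
    obtain ⟨t, ht⟩ := hT.exists_vert_degree_one_of_nontrivial
    obtain ⟨s, hts, hs⟩ := degree_eq_one_iff_existsUnique_adj.1 ht
    by_cases hall : ∀ i, t ∈ X i
    · exact ⟨t, hall⟩
    push Not at hall
    obtain ⟨i₀, hi₀⟩ := hall
    have hsX : ∀ i, t ∈ X i → s ∈ X i := by
      intro i hi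
      obtain ⟨r, hri, hr⟩ := hXX i i₀
      have h := (connected_induce_iff.1 (hX i)).2 t hi r hri
      rcases Relation.ReflTransGen.cases_head h with h | ⟨c, h, -⟩
      · exact absurd (h ▸ hr) hi₀
      · rw [← hs c h.1]; exact h.2.2
    have hst : s ≠ t := hts.ne'
    let T' := T.induce ({t}ᶜ : Set ι)
    have hT' : T'.IsTree := ⟨hT.1.induce_compl_singleton_of_degree_eq_one ht, hT.2.induce _⟩
    let ρ : ι → ({t}ᶜ : Set ι) := fun x => if h : x = t then ⟨s, hst⟩ else ⟨x, h⟩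
    have hρ : ∀ i x, x ∈ X i → (ρ x : ι) ∈ X i := by
      intro i x hx
      by_cases h : x = t
      · subst h; simpa [ρ] using hsX i hx
      · simpa [ρ, h] using hx
    suffices h : ∃ r : ({t}ᶜ : Set ι), ∀ i, r ∈ {x : ({t}ᶜ : Set ι) | (x : ι) ∈ X i} from
      ⟨h.choose, h.choose_spec⟩
    refine ih ({t}ᶜ : Set ι) T' (fun i => {x | (x : ι) ∈ X i})
      (by rw [Fintype.card_compl_set]; simp [hm]) hT' ?_ ?_
    · intro i
      have himg : {x : ({t}ᶜ : Set ι) | (x : ι) ∈ X i} = ⋃ x ∈ X i, {ρ x} := by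
        ext x
        simp only [Set.mem_ofPred_eq, Set.mem_iUnion, Set.mem_singleton_iff, exists_prop]
        constructor
        · intro hx
          have : (x : ι) ≠ t := x.2
          exact ⟨x, hx, by simp [ρ, this]⟩
        · rintro ⟨y, hy, rfl⟩
          exact hρ i y hy
      rw [himg]
      refine connected_induce_biUnion (fun x => {ρ x}) (hX i)
        (fun x _ => connected_induce_singleton _ _) fun x y hxy => ⟨_, rfl, _, rfl, ?_⟩
      by_cases hx : x = t
      · subst hx
        left
        have := hs y hxy
        subst this
        simp [ρ, hst]
      by_cases hy : y = t
      · subst hy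
        left
        have := hs x hxy.symm
        subst this
        simp [ρ, hst]
      right
      simpa [ρ, hx, hy, T'] using hxy
    · intro i j
      obtain ⟨x, hxi, hxj⟩ := hXX i j
      exact ⟨ρ x, hρ i x hxi, hρ j x hxj⟩

/-- A graph of treewidth at most `k` has no `K_{k+2}` minor. -/
lemma not_hasMinor_of_hasTreewidthAtMost {V : Type*} [Finite V] {G : SimpleGraph V} {k : ℕ}
    (h : HasTreewidthAtMost G k) : ¬ G.HasMinor (⊤ : SimpleGraph (Fin (k + 2))) := by
  rintro ⟨C, hC, hCd, hCa⟩
  obtain ⟨ι, _, T, B, hT, hcov, hedge, hconn, hcard⟩ := h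
  obtain ⟨t, ht⟩ := exists_mem_of_pairwise_inter (Fintype.card ι) ι T
    (fun i => ⋃ v ∈ C i, {t | v ∈ B t}) rfl hT
    (fun i => connected_induce_biUnion _ (hC i) (fun v _ => hconn v) fun u v huv => by
      obtain ⟨t, hu, hv⟩ := hedge u v huv
      exact ⟨t, hu, t, hv, Or.inl rfl⟩)
    (fun i j => by
      by_cases hij : i = j
      · subst hij
        obtain ⟨v, hv⟩ := (connected_induce_iff.1 (hC i)).1
        obtain ⟨t, ht⟩ := hcov v
        exact ⟨t, by simpa using ⟨v, hv, ht⟩⟩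
      · obtain ⟨u, hu, v, hv, huv⟩ := hCa i j hij
        obtain ⟨t, htu, htv⟩ := hedge u v huv
        exact ⟨t, by simpa using ⟨⟨u, hu, htu⟩, ⟨v, hv, htv⟩⟩⟩)
  simp only [Set.mem_iUnion, Set.mem_ofPred_eq, exists_prop] at ht
  choose v hvC hvB using ht
  have hinj : Function.Injective v := by
    intro i j hij
    by_contra hne
    exact Set.disjoint_left.1 (hCd hne) (hvC i) (hij ▸ hvC j)
  have : (Set.range v).ncard ≤ (B t).ncard :=
    Set.ncard_le_ncard (Set.range_subset_iff.2 hvB) (Set.toFinite _)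
  have h2 : (Set.range v).ncard = k + 2 := by
    rw [← Set.image_univ, Set.ncard_image_of_injective _ hinj, Set.ncard_univ]
    simp
  have := hcard t
  omega

end Treewidth

section LowDegree

variable {V : Type}

/-- The vertex `u` has at most two neighbours. -/
def Low (G : SimpleGraph V) (u : V) : Prop := ∃ a b, ∀ w, G.Adj u w → w = a ∨ w = b

/-- `G` has no `K₄` minor. -/
abbrev NoK4 (G : SimpleGraph V) : Prop := ¬ G.HasMinor (⊤ : SimpleGraph (Fin 4))

lemma NoK4.of_branch_sets {W : Type} {G : SimpleGraph V} {H : SimpleGraph W} (hG : NoK4 G)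
    (B : W → Set V) (hB : ∀ b, (G.induce (B b)).Connected)
    (hd : Pairwise fun b b' => Disjoint (B b) (B b'))
    (ha : ∀ b b', H.Adj b b' → ∃ u ∈ B b, ∃ v ∈ B b', G.Adj u v) : NoK4 H :=
  fun h => hG (hasMinor_trans ⟨B, hB, hd, ha⟩ h)

lemma NoK4.induce {G : SimpleGraph V} (hG : NoK4 G) (X : Set V) : NoK4 (G.induce X) :=
  hG.of_branch_sets (fun x => {(x : V)}) (fun _ => connected_induce_singleton _ _)
    (fun x y hxy => by simpa [Subtype.ext_iff] using fun h => hxy (Subtype.ext h))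
    fun x y hxy => ⟨x, rfl, y, rfl, hxy⟩

lemma NoK4.not_adj_set {G : SimpleGraph V} (hG : NoK4 G) {a b c : V} {R : Set V}
    (hR : (G.induce R).Connected) (haR : a ∉ R) (hbR : b ∉ R) (hcR : c ∉ R)
    (hab : G.Adj a b) (hac : G.Adj a c) (hbc : G.Adj b c)
    (ha : ∃ r ∈ R, G.Adj a r) (hb : ∃ r ∈ R, G.Adj b r) (hc : ∃ r ∈ R, G.Adj c r) : False := by
  obtain ⟨ra, hra, ha⟩ := ha
  obtain ⟨rb, hrb, hb⟩ := hb
  obtain ⟨rc, hrc, hc⟩ := hc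
  have hab' := hab.ne
  have hac' := hac.ne
  have hbc' := hbc.ne
  refine hG ⟨![{a}, {b}, {c}, R], ?_, ?_, ?_⟩
  · intro i
    fin_cases i
    exacts [connected_induce_singleton _ _, connected_induce_singleton _ _,
      connected_induce_singleton _ _, hR]
  · intro i j hij
    fin_cases i <;> fin_cases j <;>
      simp_all [Set.disjoint_singleton_left, Set.disjoint_singleton_right, eq_comm]
  · intro i j hij
    fin_cases i <;> fin_cases j <;> simp at hij
    exacts [⟨a, rfl, b, rfl, hab⟩, ⟨a, rfl, c, rfl, hac⟩, ⟨a, rfl, ra, hra, ha⟩,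
      ⟨b, rfl, a, rfl, hab.symm⟩, ⟨b, rfl, c, rfl, hbc⟩, ⟨b, rfl, rb, hrb, hb⟩,
      ⟨c, rfl, a, rfl, hac.symm⟩, ⟨c, rfl, b, rfl, hbc.symm⟩, ⟨c, rfl, rc, hrc, hc⟩,
      ⟨ra, hra, a, rfl, ha.symm⟩, ⟨rb, hrb, b, rfl, hb.symm⟩, ⟨rc, hrc, c, rfl, hc.symm⟩]

/-- Every vertex of a `K₄`-minor-free graph on fewer than `m` vertices, unless it is the only one,
is accompanied by another vertex that has at most two neighbours. -/
def LowBelow (m : ℕ) : Prop := ∀ (W : Type) [Fintype W] (H : SimpleGraph W) (r : W),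
  Fintype.card W < m → NoK4 H → (∃ x, x ≠ r) → ∃ u, u ≠ r ∧ Low H u

/-- Applying the induction hypothesis to the graph obtained by contracting `C` to `c`. -/
lemma exists_low_of_contract [Fintype V] {G : SimpleGraph V} (hG : NoK4 G)
    (ih : LowBelow (Fintype.card V)) {C : Set V} {c c' : V} (hC : (G.induce C).Connected)
    (hc : c ∈ C) (hc' : c' ∈ C) (hcc : c' ≠ c) {r x : V} (hr : r ∈ C → r = c)
    (hx : x ∈ C → x = c) (hxr : x ≠ r) :
    ∃ u, u ≠ r ∧ (Low G u ∨ (u ∉ C ∧ ∃ b, ∀ w, G.Adj u w → w ∈ C ∨ w = b) ∨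
      (u = c ∧ ∃ a b, ∀ w, w ∉ C → ∀ d ∈ C, G.Adj d w → w = a ∨ w = b)) := by
  classical
  let W := {y : V // y ∈ C → y = c}
  let F : W → Set V := fun y => if y = ⟨c, fun _ => rfl⟩ then C else {(y : V)}
  let H : SimpleGraph W :=
    { Adj := fun y z => y ≠ z ∧ ∃ u ∈ F y, ∃ v ∈ F z, G.Adj u v
      symm := ⟨fun y z ⟨h, u, hu, v, hv, huv⟩ => ⟨h.symm, v, hv, u, hu, huv.symm⟩⟩
      loopless := ⟨fun y h => h.1 rfl⟩ }
  have hFc : ∀ y : W, (y : V) = c → F y = C := by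
    intro y hy
    have : y = ⟨c, fun _ => rfl⟩ := Subtype.ext hy
    simp [F, this]
  have hFn : ∀ y : W, (y : V) ≠ c → F y = {(y : V)} := by
    intro y hy
    have : y ≠ ⟨c, fun _ => rfl⟩ := fun h => hy (congrArg Subtype.val h)
    simp [F, this]
  have hH : NoK4 H := by
    refine hG.of_branch_sets F ?_ ?_ fun y z h => h.2
    · intro y
      by_cases hy : (y : V) = c
      · rwa [hFc y hy]
      · rw [hFn y hy]; exact connected_induce_singleton _ _
    · intro y z hyz
      have hne : (y : V) ≠ z := fun h => hyz (Subtype.ext h)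
      by_cases hy : (y : V) = c <;> by_cases hz : (z : V) = c
      · exact absurd (hy.trans hz.symm) hne
      · show Disjoint (F y) (F z)
        rw [hFc y hy, hFn z hz, Set.disjoint_singleton_right]
        exact fun h => hz (z.2 h)
      · show Disjoint (F y) (F z)
        rw [hFc z hz, hFn y hy, Set.disjoint_singleton_left]
        exact fun h => hy (y.2 h)
      · show Disjoint (F y) (F z)
        rw [hFn z hz, hFn y hy]
        simpa using hne
  have hcard : Fintype.card W < Fintype.card V :=
    Fintype.card_subtype_lt (x := c') fun h => hcc (h hc')
  obtain ⟨u, hur, a, b, hab⟩ := ih W H ⟨r, hr⟩ hcard hH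
    ⟨⟨x, hx⟩, by simpa [Subtype.ext_iff] using fun h => hxr (congrArg Subtype.val h)⟩
  refine ⟨u, fun h => hur (Subtype.ext h), ?_⟩
  have hout : ∀ w ∉ C, ∀ d ∈ F u, G.Adj d w → w ≠ u → w = a ∨ w = b := by
    intro w hw d hd hdw hwu
    have hwc : w ≠ c := fun h => hw (h ▸ hc)
    have := hab ⟨w, fun h => absurd h hw⟩ ⟨fun h => hwu (congrArg Subtype.val h).symm,
      d, hd, w, by rw [hFn _ hwc]; rfl, hdw⟩
    rcases this with h | h
    · exact Or.inl (congrArg Subtype.val h)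
    · exact Or.inr (congrArg Subtype.val h)
  by_cases huc : (u : V) = c
  · right; right
    refine ⟨huc, a, b, fun w hw d hd hdw => hout w hw d (by rwa [hFc u huc]) hdw ?_⟩
    rintro rfl
    exact hw (by rw [huc]; exact hc)
  have huC : (u : V) ∉ C := fun h => huc (u.2 h)
  by_cases hadj : ∃ d ∈ C, G.Adj u d
  · right; left
    refine ⟨huC, ?_⟩
    obtain ⟨d, hd, hud⟩ := hadj
    have hcab := hab ⟨c, fun _ => rfl⟩ ⟨fun h => huc (congrArg Subtype.val h), u,
      by rw [hFn u huc]; rfl, d, by rwa [hFc _ rfl], hud⟩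
    have hw : ∀ w, G.Adj u w → w ∉ C → w = a ∨ w = b := fun w huw hwC =>
      hout w hwC u (by rw [hFn u huc]; rfl) huw huw.ne'
    rcases hcab with h | h
    · refine ⟨b, fun w huw => or_iff_not_imp_left.2 fun hwC => (hw w huw hwC).resolve_left ?_⟩
      rintro rfl
      exact hwC (by rw [← h]; exact hc)
    · refine ⟨a, fun w huw => or_iff_not_imp_left.2 fun hwC => (hw w huw hwC).resolve_right ?_⟩
      rintro rfl
      exact hwC (by rw [← h]; exact hc)
  · left
    push Not at hadj
    exact ⟨a, b, fun w huw => hout w (fun hw => hadj w hw huw) u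
      (by rw [hFn u huc]; rfl) huw huw.ne'⟩

lemma exists_low_aux [Fintype V] {G : SimpleGraph V} (hG : NoK4 G)
    (ih : LowBelow (Fintype.card V)) (r : V) (hx : ∃ x, x ≠ r) : ∃ u, u ≠ r ∧ Low G u := by
  classical
  by_contra! hlow
  -- the root has a neighbour
  by_cases hr : ∃ r', G.Adj r r'
  swap
  · push Not at hr
    obtain ⟨x, hxr⟩ := hx
    by_cases hy : ∃ y, y ≠ r ∧ y ≠ x
    · obtain ⟨y, hyr, hyx⟩ := hy
      obtain ⟨u, -, a, b, hu⟩ := ih {z : V // z ∈ ({r}ᶜ : Set V)} (G.induce {r}ᶜ) ⟨x, hxr⟩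
        (Fintype.card_subtype_lt (x := r) (by simp)) (hG.induce _)
        ⟨⟨y, hyr⟩, fun h => hyx (congrArg Subtype.val h)⟩
      refine hlow u u.2 ⟨a, b, fun w huw => ?_⟩
      have hwr : w ≠ r := by rintro rfl; exact hr _ huw.symm
      rcases hu ⟨w, hwr⟩ huw with h | h
      · exact Or.inl (congrArg Subtype.val h)
      · exact Or.inr (congrArg Subtype.val h)
    · push Not at hy
      refine hlow x hxr ⟨r, r, fun w hw => Or.inl ?_⟩
      by_contra hwr
      exact hw.ne' (hy w hwr)
  -- every neighbour of the root shares with it a neighbour of degree three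
  have step : ∀ r', G.Adj r r' → ∃ z b, z ≠ r ∧ z ≠ r' ∧ G.Adj z r ∧ G.Adj z r' ∧ G.Adj z b ∧
      b ≠ r ∧ b ≠ r' ∧ ∀ w, G.Adj z w → w = r ∨ w = r' ∨ w = b := by
    intro r' hrr
    have hx : ∃ x, x ≠ r ∧ x ≠ r' := by
      by_contra! hx
      refine hlow r' hrr.ne' ⟨r, r, fun w hw => Or.inl ?_⟩
      by_contra hwr
      exact hw.ne' (hx w hwr)
    obtain ⟨x, hxr, hxr'⟩ := hx
    obtain ⟨u, hur, h | ⟨huC, b, hb⟩ | ⟨h, -⟩⟩ := exists_low_of_contract hG ih (C := {r, r'})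
      (connected_induce_pair hrr) (c := r) (c' := r') (by simp) (by simp) hrr.ne' (r := r) (x := x)
      (by simp) (by simp [hxr, hxr']) hxr
    · exact absurd h (hlow u hur)
    · simp only [Set.mem_insert_iff, Set.mem_singleton_iff, not_or] at huC hb
      have hu := hlow u hur
      simp only [Low] at hu
      push Not at hu
      refine ⟨u, b, hur, huC.2, ?_, ?_, ?_, ?_, ?_, ?_⟩
      · obtain ⟨w, hw⟩ := hu r' b
        grind
      · obtain ⟨w, hw⟩ := hu r b
        grind
      · obtain ⟨w, hw⟩ := hu r r'
        grind
      · obtain ⟨w, hw⟩ := hu r r'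
        grind
      · obtain ⟨w, hw⟩ := hu r r'
        grind
      · grind
    · exact absurd h hur
  obtain ⟨r', hrr⟩ := hr
  obtain ⟨z, q₀, hzr, hzr', hadj, hadj', hzq₀, hq₀r, hq₀r', hNz⟩ := step r' hrr
  obtain ⟨z', q', hz'r, hz'z, hz'adj, hz'z', hz'q', hq'r, hq'z, hNz'⟩ := step z hadj.symm
  -- the third neighbour of `z`
  obtain ⟨q, hzq, hqr, hqz', hNz⟩ : ∃ q, G.Adj z q ∧ q ≠ r ∧ q ≠ z' ∧
      ∀ w, G.Adj z w → w = r ∨ w = z' ∨ w = q := by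
    rcases hNz z' hz'z'.symm with h | h | h
    · exact absurd h hz'r
    · exact ⟨q₀, hzq₀, hq₀r, by rwa [h], by rwa [h]⟩
    · exact ⟨r', hadj', hrr.ne', by rw [h]; exact hq₀r'.symm, by rw [h]; grind⟩
  have hqz : q ≠ z := hzq.ne'
  have hq'z' : q' ≠ z' := hz'q'.ne'
  by_cases hqq : q = q'
  · subst hqq
    by_cases hqr' : G.Adj q r
    · exact hG.not_adj_set (connected_induce_singleton G r) (a := z) (b := z') (c := q) hzr hz'r hqr
        hz'z'.symm hzq hz'q' ⟨r, rfl, hadj⟩ ⟨r, rfl, hz'adj⟩ ⟨r, rfl, hqr'⟩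
    obtain ⟨x, hqx, hx⟩ : ∃ x, G.Adj q x ∧ x ∉ ({z, z', q, r} : Set V) := by
      have hu := hlow q hqr
      simp only [Low] at hu
      push Not at hu
      obtain ⟨w, hw⟩ := hu z z'
      refine ⟨w, hw.1, ?_⟩
      simp only [Set.mem_insert_iff, Set.mem_singleton_iff, not_or]
      refine ⟨hw.2.1, hw.2.2, hw.1.ne', ?_⟩
      rintro rfl
      exact hqr' hw.1
    have hC : (G.induce ({z, z', q, r} : Set V)).Connected := by
      have h1 := connected_induce_insert (connected_induce_pair (G := G) (a := z) (b := r) hadj)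
        (a := q) (b := z) (by simp) hzq.symm
      have h2 := connected_induce_insert h1 (a := z') (b := z) (by simp) hz'z'
      have hs : ({z, z', q, r} : Set V) = {z', q, z, r} := by ext; simp; tauto
      rwa [hs]
    obtain ⟨u, hur, h | ⟨huC, b, hb⟩ | ⟨h, -⟩⟩ := exists_low_of_contract hG ih hC
      (c := r) (c' := z) (by simp) (by simp) hzr (r := r) (x := x)
      (by simp) (fun h => absurd h hx) (by rintro rfl; simp at hx)
    · exact absurd h (hlow u hur)
    · simp only [Set.mem_insert_iff, Set.mem_singleton_iff, not_or] at huC hb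
      have hu := hlow u hur
      simp only [Low] at hu
      push Not at hu
      have huz : ¬ G.Adj u z := fun h => by have := hNz u h.symm; grind
      have huz' : ¬ G.Adj u z' := fun h => by have := hNz' u h.symm; grind
      have huq : G.Adj u q := by
        obtain ⟨w, hw⟩ := hu r b
        grind
      have hur' : G.Adj u r := by
        obtain ⟨w, hw⟩ := hu q b
        grind
      exact hG.not_adj_set (connected_induce_pair hur') (a := z) (b := z') (c := q)
        (by simp; tauto) (by simp; tauto) (by simp; tauto)
        hz'z'.symm hzq hz'q' ⟨r, by simp, hadj⟩ ⟨r, by simp, hz'adj⟩ ⟨u, by simp, huq.symm⟩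
    · exact absurd h hur
  · obtain ⟨u, hur, h | ⟨huC, b, hb⟩ | ⟨h, a, b, hab⟩⟩ := exists_low_of_contract hG ih
      (connected_induce_pair hz'z'.symm)
      (c := z) (c' := z') (by simp) (by simp) hz'z (r := r) (x := z)
      (by simp; tauto) (by simp) hzr
    · exact absurd h (hlow u hur)
    · simp only [Set.mem_insert_iff, Set.mem_singleton_iff, not_or] at huC hb
      have hu := hlow u hur
      simp only [Low] at hu
      push Not at hu
      have huz : G.Adj u z := by
        obtain ⟨w, hw⟩ := hu z' b
        grind
      have huz' : G.Adj u z' := by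
        obtain ⟨w, hw⟩ := hu z b
        grind
      have h1 := hNz u huz.symm
      have h2 := hNz' u huz'.symm
      grind
    · simp only [Set.mem_insert_iff, Set.mem_singleton_iff, not_or] at hab
      have h1 := hab r ⟨hzr.symm, hz'r.symm⟩ z (by simp) hadj
      have h2 := hab q ⟨hqz, hqz'⟩ z (by simp) hzq
      have h3 := hab q' ⟨hq'z, hq'z'⟩ z' (by simp) hz'q'
      grind

lemma lowBelow (m : ℕ) : LowBelow m := by
  induction m with
  | zero => exact fun W _ H r h => absurd h (Nat.not_lt_zero _)
  | succ m ih =>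
    intro W _ H r hm hH hx
    exact exists_low_aux hH (fun W' _ H' r' h => ih W' H' r' (by omega)) r hx

/-- A `K₄`-minor-free graph with at least two vertices has a vertex of degree at most two. -/
lemma exists_low [Fintype V] [Nontrivial V] {G : SimpleGraph V} (hG : NoK4 G) : ∃ u, Low G u := by
  obtain ⟨x, y, hxy⟩ := exists_pair_ne V
  obtain ⟨u, -, hu⟩ := lowBelow _ V G y (Nat.lt_succ_self _) hG ⟨x, hxy⟩
  exact ⟨u, hu⟩

end LowDegree

section TwoTrees

/-- The construction trees of 2-trees with a root edge: `nil` is the root edge alone, and in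
`node w L R S`, with root edge `uv`, the vertex `w` is joined to `u` and `v`, and the 2-trees
`L`, `R`, `S` are glued to the edges `uw`, `wv`, `uv`. -/
inductive TwoTree (V : Type) : Type
  | nil : TwoTree V
  | node (w : V) (L R S : TwoTree V) : TwoTree V

namespace TwoTree

variable {V W : Type}

/-- The vertices other than the two roots. -/
def verts : TwoTree V → Multiset V
  | nil => 0
  | node w L R S => w ::ₘ (L.verts + R.verts + S.verts)

/-- The number of vertices other than the two roots. -/
def size : TwoTree V → ℕ
  | nil => 0
  | node _ L R S => L.size + R.size + S.size + 1

/-- The (oriented) edges of the 2-tree with root edge `uv`. -/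
def Edge : TwoTree V → V → V → V → V → Prop
  | nil, u, v, a, b => a = u ∧ b = v
  | node w L R S, u, v, a, b => L.Edge u w a b ∨ R.Edge w v a b ∨ S.Edge u v a b

/-- Relabelling the vertices. -/
def map (f : V → W) : TwoTree V → TwoTree W
  | nil => nil
  | node w L R S => node (f w) (L.map f) (R.map f) (S.map f)

lemma card_verts (t : TwoTree V) : t.verts.card = t.size := by
  induction t with
  | nil => rfl
  | node w L R S hL hR hS => simp [verts, size, hL, hR, hS]

lemma verts_map (f : V → W) (t : TwoTree V) : (t.map f).verts = t.verts.map f := by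
  induction t with
  | nil => rfl
  | node w L R S hL hR hS => simp [verts, map, hL, hR, hS]

lemma Edge.map {f : V → W} {t : TwoTree V} {u v a b : V} (h : t.Edge u v a b) :
    (t.map f).Edge (f u) (f v) (f a) (f b) := by
  induction t generalizing u v with
  | nil => exact ⟨congrArg f h.1, congrArg f h.2⟩
  | node w L R S hL hR hS => exact h.imp hL (Or.imp hR hS)

lemma edge_root (t : TwoTree V) (u v : V) : t.Edge u v u v := by
  induction t generalizing u v with
  | nil => exact ⟨rfl, rfl⟩
  | node w L R S hL hR hS => exact Or.inr (Or.inr (hS u v))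

lemma Edge.mem {t : TwoTree V} {u v a b : V} (h : t.Edge u v a b) :
    (a = u ∨ a = v ∨ a ∈ t.verts) ∧ (b = u ∨ b = v ∨ b ∈ t.verts) := by
  induction t generalizing u v with
  | nil => exact ⟨Or.inl h.1, Or.inr (Or.inl h.2)⟩
  | node w L R S hL hR hS =>
    simp only [verts, Multiset.mem_cons, Multiset.mem_add]
    rcases h with h | h | h
    · have := hL h; tauto
    · have := hR h; tauto
    · have := hS h; tauto

lemma exists_edge {t : TwoTree V} {u v a : V} (h : a = u ∨ a = v ∨ a ∈ t.verts) :
    ∃ b, t.Edge u v a b ∨ t.Edge u v b a := by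
  induction t generalizing u v with
  | nil =>
    simp only [verts, Multiset.notMem_zero, or_false] at h
    rcases h with rfl | rfl
    · exact ⟨v, Or.inl ⟨rfl, rfl⟩⟩
    · exact ⟨u, Or.inr ⟨rfl, rfl⟩⟩
  | node w L R S hL hR hS =>
    simp only [verts, Multiset.mem_cons, Multiset.mem_add] at h
    have key : (a = u ∨ a = w ∨ a ∈ L.verts) ∨ (a = w ∨ a = v ∨ a ∈ R.verts) ∨
      (a = u ∨ a = v ∨ a ∈ S.verts) := by tauto
    rcases key with h | h | h
    · obtain ⟨b, hb⟩ := hL h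
      exact ⟨b, hb.imp Or.inl Or.inl⟩
    · obtain ⟨b, hb⟩ := hR h
      exact ⟨b, hb.imp (Or.inr ∘ Or.inl) (Or.inr ∘ Or.inl)⟩
    · obtain ⟨b, hb⟩ := hS h
      exact ⟨b, hb.imp (Or.inr ∘ Or.inr) (Or.inr ∘ Or.inr)⟩

/-- Joining a new vertex to both ends of an edge. -/
lemma exists_insert (x : V) {t : TwoTree V} {u v a b : V} (h : t.Edge u v a b) :
    ∃ t' : TwoTree V, t'.verts = x ::ₘ t.verts ∧ (∀ c d, t.Edge u v c d → t'.Edge u v c d) ∧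
      t'.Edge u v a x ∧ t'.Edge u v x b := by
  induction t generalizing u v with
  | nil =>
    obtain ⟨rfl, rfl⟩ := h
    exact ⟨node x nil nil nil, rfl, fun c d h => Or.inr (Or.inr h), Or.inl ⟨rfl, rfl⟩,
      Or.inr (Or.inl ⟨rfl, rfl⟩)⟩
  | node w L R S hL hR hS =>
    rcases h with h | h | h
    · obtain ⟨L', hv, he, ha, hb⟩ := hL h
      refine ⟨node w L' R S, ?_, fun c d h => h.imp_left (he c d), Or.inl ha, Or.inl hb⟩
      simp only [verts, hv, Multiset.cons_add]
      exact Multiset.cons_swap _ _ _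
    · obtain ⟨R', hv, he, ha, hb⟩ := hR h
      refine ⟨node w L R' S, ?_, fun c d h => h.imp_right (Or.imp_left (he c d)),
        Or.inr (Or.inl ha), Or.inr (Or.inl hb)⟩
      simp only [verts, hv, Multiset.cons_add, Multiset.add_cons]
      exact Multiset.cons_swap _ _ _
    · obtain ⟨S', hv, he, ha, hb⟩ := hS h
      refine ⟨node w L R S', ?_, fun c d h => h.imp_right (Or.imp_right (he c d)),
        Or.inr (Or.inr ha), Or.inr (Or.inr hb)⟩
      simp only [verts, hv, Multiset.add_cons]
      exact Multiset.cons_swap _ _ _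

end TwoTree

/-- Every `K₄`-minor-free graph on at least two vertices is a spanning subgraph of a 2-tree. -/
lemma exists_twoTree (m : ℕ) : ∀ (V : Type) [Fintype V] (G : SimpleGraph V),
    Fintype.card V = m + 2 → NoK4 G → ∃ (t : TwoTree V) (u v : V),
      (u ::ₘ v ::ₘ t.verts).Nodup ∧ (∀ x, x = u ∨ x = v ∨ x ∈ t.verts) ∧
      ∀ a b, G.Adj a b → t.Edge u v a b ∨ t.Edge u v b a := by
  classical
  induction m with
  | zero =>
    intro V _ G hV _
    obtain ⟨u, v, huv, h⟩ := Nat.card_eq_two_iff.1 (Nat.card_eq_fintype_card.trans hV)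
    have hcov : ∀ x, x = u ∨ x = v := fun x => by
      simpa using (h ▸ Set.mem_univ x : x ∈ ({u, v} : Set V))
    refine ⟨.nil, u, v, by simpa [TwoTree.verts] using huv, fun x => ?_, fun a b hab => ?_⟩
    · exact (hcov x).imp_right Or.inl
    · rcases hcov a with rfl | rfl <;> rcases hcov b with rfl | rfl
      exacts [absurd rfl hab.ne, Or.inl ⟨rfl, rfl⟩, Or.inr ⟨rfl, rfl⟩, absurd rfl hab.ne]
  | succ m ih =>
    intro V _ G hV hG
    have : Nontrivial V := Fintype.one_lt_card_iff_nontrivial.1 (by omega)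
    obtain ⟨x, p, q, hpq⟩ := exists_low hG
    let W := {y : V // y ≠ x}
    let H : SimpleGraph W :=
      { Adj := fun y z => y ≠ z ∧ (G.Adj y z ∨ (G.Adj x y ∧ G.Adj x z))
        symm := ⟨fun y z h => ⟨h.1.symm, h.2.imp (fun h => h.symm) And.symm⟩⟩
        loopless := ⟨fun y h => h.1 rfl⟩ }
    have hH : NoK4 H := by
      by_cases hx : ∃ a, G.Adj x a
      · obtain ⟨a, ha⟩ := hx
        let F : W → Set V := fun y => if (y : V) = a then {x, a} else {(y : V)}
        have hFy : ∀ y : W, (y : V) ∈ F y := by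
          intro y
          by_cases hy : (y : V) = a <;> simp [F, hy]
        have hFx : ∀ y : W, (y : V) = a → x ∈ F y := by
          intro y hy
          simp [F, hy]
        refine hG.of_branch_sets F ?_ ?_ ?_
        · intro y
          by_cases hy : (y : V) = a
          · rw [show F y = {x, a} from if_pos hy]
            exact connected_induce_pair ha
          · rw [show F y = {(y : V)} from if_neg hy]
            exact connected_induce_singleton _ _
        · intro y z hyz
          have hne : (y : V) ≠ z := fun h => hyz (Subtype.ext h)
          have hy := y.2
          have hz := z.2
          rw [Set.disjoint_left]
          intro w hw hw'
          simp only [F] at hw hw'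
          split_ifs at hw hw' <;> simp at hw hw' <;> grind
        · rintro y z ⟨hyz, h | ⟨hy, hz⟩⟩
          · exact ⟨y, hFy y, z, hFy z, h⟩
          · have hne : (y : V) ≠ z := fun h => hyz (Subtype.ext h)
            have h1 := hpq _ hy
            have h2 := hpq _ hz
            have h3 := hpq _ ha
            have : (y : V) = a ∨ (z : V) = a := by grind
            rcases this with h | h
            · exact ⟨x, hFx y h, z, hFy z, hz⟩
            · exact ⟨y, hFy y, x, hFx z h, hy.symm⟩
      · push Not at hx
        refine hG.of_branch_sets (fun y : W => {(y : V)})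
          (fun _ => connected_induce_singleton _ _) ?_ ?_
        · intro y z hyz
          simpa using fun h => hyz (Subtype.ext h)
        · rintro y z ⟨-, h | h⟩
          · exact ⟨y, rfl, z, rfl, h⟩
          · exact absurd h.1 (hx _)
    have hW : Fintype.card W = m + 2 := by
      simp [W, Fintype.card_subtype_compl, hV]
    obtain ⟨t, u, v, hnd, hcov, hE⟩ := ih W H hW hH
    let s := t.map (Subtype.val : W → V)
    have hE' : ∀ a b (ha : a ≠ x) (hb : b ≠ x), H.Adj ⟨a, ha⟩ ⟨b, hb⟩ →
        s.Edge u v a b ∨ s.Edge u v b a := fun a b ha hb h =>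
      (hE _ _ h).imp TwoTree.Edge.map TwoTree.Edge.map
    have hcov' : ∀ a, a ≠ x → a = u ∨ a = v ∨ a ∈ s.verts := by
      intro a ha
      rw [TwoTree.verts_map, Multiset.mem_map]
      rcases hcov ⟨a, ha⟩ with h | h | h
      · exact Or.inl (congrArg Subtype.val h)
      · exact Or.inr (Or.inl (congrArg Subtype.val h))
      · exact Or.inr (Or.inr ⟨_, h, rfl⟩)
    -- an edge of the 2-tree containing all neighbours of `x`
    obtain ⟨a, b, hab, hx⟩ : ∃ a b, s.Edge u v a b ∧ ∀ w, G.Adj x w → w = a ∨ w = b := by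
      by_cases hpx : G.Adj x p
      · by_cases hqx : G.Adj x q ∧ p ≠ q
        · rcases hE' p q hpx.ne' hqx.1.ne' ⟨fun h => hqx.2 (congrArg Subtype.val h),
            Or.inr ⟨hpx, hqx.1⟩⟩ with h | h
          · exact ⟨p, q, h, hpq⟩
          · exact ⟨q, p, h, fun w hw => (hpq w hw).symm⟩
        · have hp : ∀ w, G.Adj x w → w = p := by grind
          obtain ⟨b, hb | hb⟩ := TwoTree.exists_edge (hcov' p hpx.ne')
          · exact ⟨p, b, hb, fun w hw => Or.inl (hp w hw)⟩
          · exact ⟨b, p, hb, fun w hw => Or.inr (hp w hw)⟩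
      · have hq : ∀ w, G.Adj x w → w = q := by grind
        by_cases hqx : G.Adj x q
        · obtain ⟨b, hb | hb⟩ := TwoTree.exists_edge (hcov' q hqx.ne')
          · exact ⟨q, b, hb, fun w hw => Or.inl (hq w hw)⟩
          · exact ⟨b, q, hb, fun w hw => Or.inr (hq w hw)⟩
        · exact ⟨u, v, TwoTree.edge_root _ _ _, fun w hw => absurd (hq w hw ▸ hw) hqx⟩
    obtain ⟨t', hv, he, hax, hxb⟩ := TwoTree.exists_insert x hab
    refine ⟨t', u, v, ?_, ?_, ?_⟩
    · have h1 : u.1 ::ₘ v.1 ::ₘ t'.verts = x ::ₘ (u ::ₘ v ::ₘ t.verts).map Subtype.val := by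
        rw [hv, TwoTree.verts_map, Multiset.map_cons, Multiset.map_cons, Multiset.cons_swap v.1,
          Multiset.cons_swap u.1]
      rw [h1, Multiset.nodup_cons]
      exact ⟨by simp only [Multiset.mem_map, not_exists, not_and]; exact fun y _ h => y.2 h,
        hnd.map Subtype.val_injective⟩
    · intro y
      rw [hv, Multiset.mem_cons]
      by_cases hy : y = x
      · exact Or.inr (Or.inr (Or.inl hy))
      · have := hcov' y hy
        tauto
    · have hxw : ∀ w, G.Adj x w → t'.Edge u v x w ∨ t'.Edge u v w x := by
        intro w hw
        rcases hx w hw with rfl | rfl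
        · exact Or.inr hax
        · exact Or.inl hxb
      intro c d hcd
      by_cases hc : c = x
      · subst hc; exact hxw d hcd
      by_cases hd : d = x
      · subst hd; exact (hxw c hcd.symm).symm
      · exact (hE' c d hc hd ⟨fun h => hcd.ne (congrArg Subtype.val h), Or.inl hcd⟩).imp
          (he _ _) (he _ _)

end TwoTrees

section Hosts

/-- Add the vertex `N` to `G`, joined to the vertices in `S`. -/
def attach (G : SimpleGraph ℕ) (N : ℕ) (S : Finset ℕ) : SimpleGraph ℕ where
  Adj a b := G.Adj a b ∨ (a ≠ b ∧ (a = N ∧ b ∈ S ∨ b = N ∧ a ∈ S))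
  symm := ⟨fun _ _ h => h.imp (fun h => h.symm) fun h => ⟨h.1.symm, h.2.symm⟩⟩
  loopless := ⟨fun _ h => h.elim (fun h => h.ne rfl) fun h => h.1 rfl⟩

/-- The graphs on the vertices `0, …, N - 1` built by repeatedly joining a new vertex to a clique
with at most three vertices. -/
inductive Host : ℕ → SimpleGraph ℕ → Prop
  | empty : Host 0 ⊥
  | attach {N : ℕ} {G : SimpleGraph ℕ} (h : Host N G) (S : Finset ℕ) (hS : S.card ≤ 3)
      (hSN : ∀ a ∈ S, a < N) (hSG : G.IsClique S) : Host (N + 1) (attach G N S)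

lemma le_attach (G : SimpleGraph ℕ) (N : ℕ) (S : Finset ℕ) : G ≤ UniversalGraph.attach G N S :=
  fun _ _ h => Or.inl h

lemma Host.lt {N : ℕ} {G : SimpleGraph ℕ} (h : Host N G) {a b : ℕ} (hab : G.Adj a b) : a < N := by
  induction h generalizing a b with
  | empty => exact absurd hab (by simp)
  | attach h S hS hSN hSG ih =>
    rcases hab with hab | ⟨-, ⟨rfl, -⟩ | ⟨-, ha⟩⟩
    · exact (ih hab).trans (Nat.lt_succ_self _)
    · exact Nat.lt_succ_self _
    · exact (hSN a ha).trans (Nat.lt_succ_self _)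

/-- Adding a leaf to a tree. -/
lemma isTree_option {ι : Type} [Finite ι] {T : SimpleGraph ι} (hT : T.IsTree) (t : ι) :
    (T.map Function.Embedding.some ⊔ edge none (some t)).IsTree := by
  set T' := T.map (Function.Embedding.some (α := ι)) ⊔ edge none (some t)
  rw [isTree_iff_connected_and_card] at hT ⊢
  constructor
  · have h1 : (T'.induce (⋃ i ∈ (Set.univ : Set ι), {some i})).Connected :=
      connected_induce_biUnion _ ((induceUnivIso T).connected_iff.2 hT.1)
        (fun i _ => connected_induce_singleton _ _)
        fun i j hij => ⟨_, rfl, _, rfl, Or.inr (Or.inl ((map_adj_apply (f := .some)).2 hij))⟩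
    have h2 := connected_induce_insert (a := none) (b := some t) h1 (by simp)
      (Or.inr (by simp [edge_adj]))
    have h3 : insert none (⋃ i ∈ (Set.univ : Set ι), {some i}) = (Set.univ : Set (Option ι)) := by
      ext i; cases i <;> simp
    rw [h3] at h2
    exact (induceUnivIso T').connected_iff.1 h2
  · have he : T'.edgeSet = insert s(none, some t) (Sym2.map some '' T.edgeSet) := by
      rw [edgeSet_sup, edgeSet_map, edgeSet_edge_of_ne (by simp), Set.union_singleton]
      rfl
    have hn : s(none, some t) ∉ Sym2.map some '' T.edgeSet := by
      rintro ⟨e, -, he⟩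
      induction e with
      | _ a b => simp at he
    rw [Nat.card_coe_set_eq, he, Set.ncard_insert_of_notMem hn,
      Set.ncard_image_of_injective _ (Sym2.map.injective (Option.some_injective ι)),
      ← Nat.card_coe_set_eq, hT.2]
    simp

lemma Host.exists_treeDecomposition {N : ℕ} {G : SimpleGraph ℕ} (h : Host N G) :
    ∃ (ι : Type) (_ : Fintype ι) (T : SimpleGraph ι) (B : ι → Set ℕ), T.IsTree ∧
      (∀ t, ∀ v ∈ B t, v < N) ∧ (∀ t, (B t).ncard ≤ 4) ∧
      (∀ v < N, (T.induce {t | v ∈ B t}).Connected) ∧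
      ∀ K : Set ℕ, (∀ v ∈ K, v < N) → G.IsClique K → ∃ t, K ⊆ B t := by
  induction h with
  | empty =>
    refine ⟨Unit, inferInstance, ⊥, fun _ => ∅, IsTree.of_subsingleton, by simp, by simp, by simp,
      fun K hK _ => ⟨(), fun v hv => absurd (hK v hv) (by simp)⟩⟩
  | @attach N G _ S hS hSN hSG ih =>
    obtain ⟨ι, _, T, B, hT, hlt, hcard, hconn, hcl⟩ := ih
    obtain ⟨t₀, ht₀⟩ := hcl S hSN hSG
    let T' := T.map (Function.Embedding.some (α := ι)) ⊔ edge none (some t₀)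
    let B' : Option ι → Set ℕ := fun o => o.elim (insert N (S : Set ℕ)) B
    refine ⟨Option ι, inferInstance, T', B', isTree_option hT t₀, ?_, ?_, ?_, ?_⟩
    · rintro (_ | t) v hv
      · rcases hv with rfl | hv
        · exact Nat.lt_succ_self _
        · exact (hSN v hv).trans (Nat.lt_succ_self _)
      · exact (hlt t v hv).trans (Nat.lt_succ_self _)
    · rintro (_ | t)
      · refine (Set.ncard_insert_le _ _).trans ?_
        rw [Set.ncard_coe_finset]
        omega
      · exact hcard t
    · intro v hv
      rcases Nat.lt_succ_iff_lt_or_eq.1 hv with hv | rfl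
      · have h1 : (T'.induce (⋃ i ∈ {t | v ∈ B t}, {some i})).Connected :=
          connected_induce_biUnion _ (hconn v hv) (fun i _ => connected_induce_singleton _ _)
            fun i j hij => ⟨_, rfl, _, rfl, Or.inr (Or.inl ((map_adj_apply (f := .some)).2 hij))⟩
        by_cases hvS : v ∈ S
        · have h2 := connected_induce_insert (a := none) (b := some t₀) h1
            (by simpa using ht₀ hvS) (Or.inr (by simp [edge_adj]))
          have hs : {t | v ∈ B' t} = insert none (⋃ i ∈ {t | v ∈ B t}, {some i}) := by
            ext (_ | t) <;> simp [B', hvS]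
          rwa [hs]
        · have hs : {t | v ∈ B' t} = ⋃ i ∈ {t | v ∈ B t}, {some i} := by
            ext (_ | t) <;> simp [B', hvS, hv.ne]
          rwa [hs]
      · have hs : {t | v ∈ B' t} = {none} := by
          ext (_ | t)
          · simp [B']
          · simpa [B'] using fun h => (hlt t _ h).ne rfl
        rw [hs]
        exact connected_induce_singleton T' none
    · intro K hK hKG
      by_cases hN : N ∈ K
      · refine ⟨none, fun v hv => ?_⟩
        by_cases hvN : v = N
        · exact Or.inl hvN
        · rcases hKG hN hv (Ne.symm hvN) with h | ⟨-, ⟨-, h⟩ | ⟨h, -⟩⟩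
          · exact absurd (Host.lt ‹_› h) (lt_irrefl _)
          · exact Or.inr h
          · exact absurd h hvN
      · have hK' : ∀ v ∈ K, v < N := fun v hv =>
          (Nat.lt_succ_iff_lt_or_eq.1 (hK v hv)).resolve_right fun h => hN (h ▸ hv)
        obtain ⟨t, ht⟩ := hcl K hK' fun a ha b hb hab =>
          (hKG ha hb hab).resolve_right fun h => h.2.elim
            (fun h => (hK' a ha).ne h.1) fun h => (hK' b hb).ne h.1
        exact ⟨some t, ht⟩

lemma Host.hasTreewidthAtMost {N : ℕ} {G : SimpleGraph ℕ} (h : Host N G) :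
    HasTreewidthAtMost (G.comap (Fin.val : Fin N → ℕ)) 3 := by
  obtain ⟨ι, _, T, B, hT, hlt, hcard, hconn, hcl⟩ := h.exists_treeDecomposition
  refine ⟨ι, inferInstance, T, fun t => {v | (v : ℕ) ∈ B t}, hT, fun v => ?_, fun u v huv => ?_,
    fun v => hconn v v.2, fun t => ?_⟩
  · exact (connected_induce_iff.1 (hconn v v.2)).1
  · obtain ⟨t, ht⟩ := hcl {(u : ℕ), (v : ℕ)} (by simp)
      (isClique_pair.2 fun _ => huv)
    exact ⟨t, ht (by simp), ht (by simp)⟩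
  · rw [← Set.ncard_image_of_injective _ Fin.val_injective]
    refine (Set.ncard_le_ncard ?_ ((Set.finite_lt_nat N).subset (hlt t))).trans (hcard t)
    rintro _ ⟨v, hv, rfl⟩
    exact hv

end Hosts

section Embedding

namespace TwoTree

variable {V : Type}

/-- The 2-tree `t` embeds into `G`, its root edge going to `xy` and its other vertices
into `F`. -/
def Emb (G : SimpleGraph ℕ) : TwoTree V → ℕ → ℕ → Set ℕ → Prop
  | nil, _, _, _ => True
  | node _ L R S, x, y, F => ∃ w ∈ F, G.Adj x w ∧ G.Adj w y ∧
      ∃ FL ⊆ F, ∃ FR ⊆ F, ∃ FS ⊆ F, w ∉ FL ∧ w ∉ FR ∧ w ∉ FS ∧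
        Disjoint FL FR ∧ Disjoint FL FS ∧ Disjoint FR FS ∧
        Emb G L x w FL ∧ Emb G R w y FR ∧ Emb G S x y FS

lemma Emb.mono_set {G : SimpleGraph ℕ} {t : TwoTree V} {x y : ℕ} {F F' : Set ℕ}
    (h : t.Emb G x y F) (hF : F ⊆ F') : t.Emb G x y F' := by
  cases t with
  | nil => trivial
  | node w L R S =>
    obtain ⟨w, hw, hxw, hwy, FL, hL, FR, hR, FS, hS, h⟩ := h
    exact ⟨w, hF hw, hxw, hwy, FL, hL.trans hF, FR, hR.trans hF, FS, hS.trans hF, h⟩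

lemma Emb.mono_graph {G G' : SimpleGraph ℕ} (hG : G ≤ G') {t : TwoTree V} {x y : ℕ} {F : Set ℕ}
    (h : t.Emb G x y F) : t.Emb G' x y F := by
  induction t generalizing x y F with
  | nil => trivial
  | node w L R S ihL ihR ihS =>
    obtain ⟨w, hw, hxw, hwy, FL, hL, FR, hR, FS, hS, h1, h2, h3, h4, h5, h6, eL, eR, eS⟩ := h
    exact ⟨w, hw, hG hxw, hG hwy, FL, hL, FR, hR, FS, hS, h1, h2, h3, h4, h5, h6,
      ihL eL, ihR eR, ihS eS⟩

/-- Exchanging the two roots. -/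
def flip : TwoTree V → TwoTree V
  | nil => nil
  | node w L R S => node w R.flip L.flip S.flip

lemma size_flip (t : TwoTree V) : t.flip.size = t.size := by
  induction t with
  | nil => rfl
  | node w L R S hL hR hS => simp [flip, size, hL, hR, hS, add_comm]

lemma Emb.flip {G : SimpleGraph ℕ} {t : TwoTree V} {x y : ℕ} {F : Set ℕ}
    (h : t.Emb G x y F) : t.flip.Emb G y x F := by
  induction t generalizing x y F with
  | nil => trivial
  | node w L R S ihL ihR ihS =>
    obtain ⟨w, hw, hxw, hwy, FL, hL, FR, hR, FS, hS, h1, h2, h3, h4, h5, h6, eL, eR, eS⟩ := h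
    exact ⟨w, hw, hwy.symm, hxw.symm, FR, hR, FL, hL, FS, hS, h2, h1, h3, h4.symm, h6, h5,
      ihR eR, ihL eL, ihS eS⟩

lemma flip_flip (t : TwoTree V) : t.flip.flip = t := by
  induction t with
  | nil => rfl
  | node w L R S hL hR hS => simp [TwoTree.flip, hL, hR, hS]

lemma Emb.of_flip {G : SimpleGraph ℕ} {t : TwoTree V} {x y : ℕ} {F : Set ℕ}
    (h : t.flip.Emb G y x F) : t.Emb G x y F := t.flip_flip ▸ h.flip

/-- All the pieces hanging from the vertices adjacent to both roots have size at most `h`. -/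
def Light (h : ℕ) : TwoTree V → Prop
  | nil => True
  | node _ L R S => L.size ≤ h ∧ R.size ≤ h ∧ S.Light h

lemma light_of_size_le {h : ℕ} {t : TwoTree V} (ht : t.size ≤ h) : t.Light h := by
  induction t with
  | nil => trivial
  | node w L R S _ _ ih =>
    simp only [size] at ht
    exact ⟨by omega, by omega, ih (by omega)⟩

lemma Light.flip {h : ℕ} {t : TwoTree V} (ht : t.Light h) : t.flip.Light h := by
  induction t with
  | nil => trivial
  | node w L R S _ _ ih =>
    exact ⟨by rw [size_flip]; exact ht.2.1, by rw [size_flip]; exact ht.1, ih ht.2.2⟩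

/-- `t'` has the same size as `t`, and is at least as hard to embed. -/
def Reshape (t t' : TwoTree V) : Prop :=
  t'.size = t.size ∧ ∀ G x y F, t'.Emb G x y F → t.Emb G x y F

lemma Reshape.flip {t t' : TwoTree V} (h : Reshape t t') : Reshape t.flip t'.flip :=
  ⟨by rw [size_flip, size_flip, h.1], fun G x y F e => (h.2 G y x F e.of_flip).flip⟩

/-- The triangles on the root edge can be listed with any of them first. -/
lemma Reshape.swap {w w' : V} {L R S L' R' S' : TwoTree V} (h : Reshape S (node w' L' R' S')) :
    Reshape (node w L R S) (node w' L' R' (node w L R S')) := by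
  refine ⟨?_, fun G x y F e => ?_⟩
  · have := h.1
    simp only [size] at this ⊢
    omega
  obtain ⟨a, ha, hxa, hay, FL', hL', FR', hR', F₁, hF₁, haL', haR', haF₁, d1, d2, d3, eL', eR',
    b, hb, hxb, hby, FL, hL, FR, hR, FS, hS, hbL, hbR, hbS, d4, d5, d6, eL, eR, eS⟩ := e
  refine ⟨b, hF₁ hb, hxb, hby, FL, hL.trans hF₁, FR, hR.trans hF₁, insert a (FL' ∪ FR' ∪ FS), ?_,
    hbL, hbR, ?_, d4, ?_, ?_, eL, eR, ?_⟩
  · exact Set.insert_subset ha (Set.union_subset (Set.union_subset hL' hR') (hS.trans hF₁))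
  · have hba : b ≠ a := fun h => haF₁ (h ▸ hb)
    have h1 := Set.disjoint_right.1 d2 hb
    have h2 := Set.disjoint_right.1 d3 hb
    simp [hba, h1, h2, hbS]
  · rw [Set.disjoint_insert_right]
    exact ⟨fun h => haF₁ (hL h),
      ((d2.symm.mono_left hL).union_right (d3.symm.mono_left hL)).union_right d5⟩
  · rw [Set.disjoint_insert_right]
    exact ⟨fun h => haF₁ (hR h),
      ((d2.symm.mono_left hR).union_right (d3.symm.mono_left hR)).union_right d6⟩
  · exact h.2 G x y _ ⟨a, Set.mem_insert _ _, hxa, hay, FL',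
      fun i hi => Or.inr (Or.inl (Or.inl hi)), FR', fun i hi => Or.inr (Or.inl (Or.inr hi)), FS,
      fun i hi => Or.inr (Or.inr hi), haL', haR', fun h => haF₁ (hS h), d1, d2.mono_right hS,
      d3.mono_right hS, eL', eR', eS⟩

/-- `t` is the root edge alone, or one of the triangles on its root edge `uv` can be chosen such
that the piece on `uw`, where `w` is the third vertex, has size at most `h`, and all other
triangles on `uv` only carry pieces of size at most `h`. -/
def RightHeavy (h : ℕ) (t : TwoTree V) : Prop :=
  t.size = 0 ∨ ∃ w L R S, Reshape t (node w L R S) ∧ S.Light h ∧ L.size ≤ h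

lemma rightHeavy_or_flip {h : ℕ} {t : TwoTree V} (ht : t.size ≤ 2 * h + 1) :
    t.RightHeavy h ∨ t.flip.RightHeavy h := by
  have key : t.size = 0 ∨ ∃ w L R S, Reshape t (node w L R S) ∧ S.Light h ∧
      (L.size ≤ h ∨ R.size ≤ h) := by
    induction t with
    | nil => exact Or.inl rfl
    | node w L R S _ _ ih =>
      right
      simp only [size] at ht
      by_cases hLR : L.size ≤ h ∧ R.size ≤ h
      · rcases ih (by omega) with hS | ⟨w', L', R', S', hS, hl, hLR'⟩
        · exact ⟨w, L, R, S, ⟨rfl, fun _ _ _ _ e => e⟩, light_of_size_le (by omega), Or.inl hLR.1⟩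
        · exact ⟨w', L', R', node w L R S', hS.swap, ⟨hLR.1, hLR.2, hl⟩, hLR'⟩
      · exact ⟨w, L, R, S, ⟨rfl, fun _ _ _ _ e => e⟩, light_of_size_le (by omega), by omega⟩
  rcases key with h0 | ⟨w, L, R, S, hS, hl, hL | hR⟩
  · exact Or.inl (Or.inl h0)
  · exact Or.inl (Or.inr ⟨w, L, R, S, hS, hl, hL⟩)
  · exact Or.inr (Or.inr ⟨w, R.flip, L.flip, S.flip, hS.flip, hl.flip, by rwa [size_flip]⟩)

lemma emb_of_size_eq_zero {t : TwoTree V} (ht : t.size = 0) (G : SimpleGraph ℕ) (x y : ℕ)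
    (F : Set ℕ) : t.Emb G x y F := by
  cases t with
  | nil => trivial
  | node w L R S => simp [size] at ht

/-- An embedding gives a map on the vertices, if these are distinct. -/
lemma Emb.exists_map {G : SimpleGraph ℕ} {t : TwoTree V} {x y : ℕ} {F : Set ℕ}
    (h : t.Emb G x y F) (hxy : G.Adj x y) {u v : V} (hnd : (u ::ₘ v ::ₘ t.verts).Nodup) :
    ∃ φ : V → ℕ, φ u = x ∧ φ v = y ∧ (∀ a ∈ t.verts, φ a ∈ F) ∧ Set.InjOn φ {a | a ∈ t.verts} ∧
      ∀ a b, t.Edge u v a b → G.Adj (φ a) (φ b) := by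
  classical
  induction t generalizing x y F u v with
  | nil =>
    have huv : u ≠ v := by simpa [verts] using hnd
    refine ⟨fun a => if a = u then x else y, by simp, by simp [huv.symm], by simp [verts],
      by simp [verts], ?_⟩
    rintro _ _ ⟨rfl, rfl⟩
    simpa [huv.symm] using hxy
  | node w L R S ihL ihR ihS =>
    obtain ⟨z, hz, hxz, hzy, FL, hL, FR, hR, FS, hS, hzL, hzR, hzS, dLR, dLS, dRS, eL, eR, eS⟩ := h
    simp only [verts, Multiset.nodup_cons, Multiset.mem_cons, Multiset.mem_add, not_or,
      Multiset.nodup_add, Multiset.disjoint_left] at hnd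
    obtain ⟨⟨huv, huw, ⟨huL, huR⟩, huS⟩, ⟨hvw, ⟨hvL, hvR⟩, hvS⟩, ⟨⟨hwL, hwR⟩, hwS⟩,
      ⟨hndL, hndR, nLR⟩, hndS, nLRS⟩ := hnd
    obtain ⟨f, fu, fw, fF, finj, fE⟩ := ihL eL hxz (u := u) (v := w)
      (by simp [huw, huL, hwL, hndL])
    obtain ⟨g, gw, gv, gF, ginj, gE⟩ := ihR eR hzy (u := w) (v := v)
      (by simp [Ne.symm hvw, hvR, hwR, hndR])
    obtain ⟨k, ku, kv, kF, kinj, kE⟩ := ihS eS hxy (u := u) (v := v)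
      (by simp [huv, huS, hvS, hndS])
    let φ : V → ℕ := fun a => if a ∈ L.verts then f a else if a ∈ R.verts then g a else
      if a ∈ S.verts then k a else if a = w then z else if a = u then x else y
    have φL : ∀ a ∈ L.verts, φ a = f a := fun a ha => by simp [φ, ha]
    have φR : ∀ a ∈ R.verts, φ a = g a := fun a ha => by
      have : a ∉ L.verts := fun h => nLR h ha
      simp [φ, ha, this]
    have φS : ∀ a ∈ S.verts, φ a = k a := fun a ha => by
      have h1 : a ∉ L.verts := fun h => nLRS (Or.inl h) ha
      have h2 : a ∉ R.verts := fun h => nLRS (Or.inr h) ha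
      simp [φ, ha, h1, h2]
    have φu : φ u = x := by simp [φ, huL, huR, huS, huw]
    have φv : φ v = y := by simp [φ, hvL, hvR, hvS, hvw, Ne.symm huv]
    have φw : φ w = z := by simp [φ, hwL, hwR, hwS]
    refine ⟨φ, φu, φv, ?_, ?_, ?_⟩
    · intro a ha
      simp only [verts, Multiset.mem_cons, Multiset.mem_add] at ha
      rcases ha with rfl | (ha | ha) | ha
      · rwa [φw]
      · rw [φL a ha]; exact hL (fF a ha)
      · rw [φR a ha]; exact hR (gF a ha)
      · rw [φS a ha]; exact hS (kF a ha)
    · intro a ha b hb hab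
      simp only [verts, Multiset.mem_cons, Multiset.mem_add, Set.mem_ofPred_eq] at ha hb
      rw [Set.disjoint_left] at dLR dLS dRS
      rcases ha with rfl | (ha | ha) | ha <;> rcases hb with rfl | (hb | hb) | hb
      · rfl
      · rw [φw, φL b hb] at hab; exact absurd (hab ▸ fF b hb) hzL
      · rw [φw, φR b hb] at hab; exact absurd (hab ▸ gF b hb) hzR
      · rw [φw, φS b hb] at hab; exact absurd (hab ▸ kF b hb) hzS
      · rw [φw, φL a ha] at hab; exact absurd (hab ▸ fF a ha) hzL
      · rw [φL a ha, φL b hb] at hab; exact finj ha hb hab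
      · rw [φL a ha, φR b hb] at hab; exact absurd (gF b hb) (dLR (hab ▸ fF a ha))
      · rw [φL a ha, φS b hb] at hab; exact absurd (kF b hb) (dLS (hab ▸ fF a ha))
      · rw [φw, φR a ha] at hab; exact absurd (hab ▸ gF a ha) hzR
      · rw [φR a ha, φL b hb] at hab; exact absurd (hab ▸ gF a ha) (dLR (fF b hb))
      · rw [φR a ha, φR b hb] at hab; exact ginj ha hb hab
      · rw [φR a ha, φS b hb] at hab; exact absurd (kF b hb) (dRS (hab ▸ gF a ha))
      · rw [φw, φS a ha] at hab; exact absurd (hab ▸ kF a ha) hzS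
      · rw [φS a ha, φL b hb] at hab; exact absurd (hab ▸ kF a ha) (dLS (fF b hb))
      · rw [φS a ha, φR b hb] at hab; exact absurd (hab ▸ kF a ha) (dRS (gF b hb))
      · rw [φS a ha, φS b hb] at hab; exact kinj ha hb hab
    · have eqL : ∀ a, a = u ∨ a = w ∨ a ∈ L.verts → φ a = f a := by
        rintro a (rfl | rfl | ha)
        exacts [φu.trans fu.symm, φw.trans fw.symm, φL a ha]
      have eqR : ∀ a, a = w ∨ a = v ∨ a ∈ R.verts → φ a = g a := by
        rintro a (rfl | rfl | ha)
        exacts [φw.trans gw.symm, φv.trans gv.symm, φR a ha]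
      have eqS : ∀ a, a = u ∨ a = v ∨ a ∈ S.verts → φ a = k a := by
        rintro a (rfl | rfl | ha)
        exacts [φu.trans ku.symm, φv.trans kv.symm, φS a ha]
      rintro a b (h | h | h)
      · rw [eqL a h.mem.1, eqL b h.mem.2]; exact fE a b h
      · rw [eqR a h.mem.1, eqR b h.mem.2]; exact gE a b h
      · rw [eqS a h.mem.1, eqS b h.mem.2]; exact kE a b h

end TwoTree

end Embedding

section Construction

variable {V : Type}

lemma Host.exists_attach_edge {N : ℕ} {G : SimpleGraph ℕ} (h : Host N G) {x y : ℕ}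
    (hxy : G.Adj x y) :
    ∃ G', Host (N + 1) G' ∧ G ≤ G' ∧ G'.Adj x N ∧ G'.Adj N y := by
  have hx := h.lt hxy
  have hy := h.lt hxy.symm
  refine ⟨_, h.attach {x, y} (Finset.card_le_two.trans (by norm_num)) (by simp [hx, hy])
    (by simpa [isClique_pair] using fun _ => hxy), le_attach G N _, ?_, ?_⟩
  · exact Or.inr ⟨hx.ne, Or.inr ⟨rfl, by simp⟩⟩
  · exact Or.inr ⟨hy.ne', Or.inl ⟨rfl, by simp⟩⟩

lemma Host.exists_attach_triangle {N : ℕ} {G : SimpleGraph ℕ} (h : Host N G) {p y c : ℕ}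
    (hpy : G.Adj p y) (hpc : G.Adj p c) (hyc : G.Adj y c) :
    ∃ G', Host (N + 1) G' ∧ G ≤ G' ∧ G'.Adj p N ∧ G'.Adj N y ∧ G'.Adj N c := by
  have hp := h.lt hpy
  have hy := h.lt hyc
  have hc := h.lt hyc.symm
  refine ⟨_, h.attach {p, y, c} Finset.card_le_three (by simp [hp, hy, hc]) ?_,
    le_attach G N _, ?_, ?_, ?_⟩
  · simp [isClique_insert, hpy, hpc, hyc]
  · exact Or.inr ⟨hp.ne, Or.inr ⟨rfl, by simp⟩⟩
  · exact Or.inr ⟨hy.ne', Or.inl ⟨rfl, by simp⟩⟩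
  · exact Or.inr ⟨hc.ne', Or.inl ⟨rfl, by simp⟩⟩

/-- Adding at most `s` vertices to a host is enough to embed all 2-trees satisfying `P` onto a
given edge. -/
def Gen (P : TwoTree V → Prop) (s : ℕ) : Prop :=
  ∀ ⦃N : ℕ⦄ ⦃G : SimpleGraph ℕ⦄, Host N G → ∀ ⦃x y : ℕ⦄, G.Adj x y →
    ∃ N' G', Host N' G' ∧ G ≤ G' ∧ N ≤ N' ∧ N' ≤ N + s ∧
      ∀ t, P t → t.Emb G' x y (Set.Ico N N')

lemma gen_zero : Gen (fun t : TwoTree V => t.size ≤ 0) 0 :=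
  fun N G hG _ _ _ => ⟨N, G, hG, le_rfl, le_rfl, le_rfl, fun _ ht =>
    TwoTree.emb_of_size_eq_zero (Nat.le_zero.1 ht) _ _ _ _⟩

lemma Gen.light {h s : ℕ} (hs : Gen (fun t : TwoTree V => t.size ≤ h) s) (m : ℕ) :
    Gen (fun t : TwoTree V => t.size ≤ m ∧ t.Light h) (m * (1 + 2 * s)) := by
  induction m with
  | zero =>
    exact fun N G hG _ _ _ => ⟨N, G, hG, le_rfl, le_rfl, by simp, fun _ ht =>
      TwoTree.emb_of_size_eq_zero (Nat.le_zero.1 ht.1) _ _ _ _⟩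
  | succ m ih =>
    intro N G hG x y hxy
    obtain ⟨G₁, hG₁, le₁, hxN, hNy⟩ := hG.exists_attach_edge hxy
    obtain ⟨N₂, G₂, hG₂, le₂, hN₂, hs₂, e₂⟩ := hs hG₁ hxN
    obtain ⟨N₃, G₃, hG₃, le₃, hN₃, hs₃, e₃⟩ := hs hG₂ (le₂ hNy)
    obtain ⟨N₄, G₄, hG₄, le₄, hN₄, hs₄, e₄⟩ := ih hG₃ (le₃ (le₂ (le₁ hxy)))
    refine ⟨N₄, G₄, hG₄, le₁.trans (le₂.trans (le₃.trans le₄)), by omega, ?_, ?_⟩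
    · rw [add_mul]
      omega
    · rintro (_ | ⟨w, L, R, S⟩) ⟨ht, hl⟩
      · trivial
      simp only [TwoTree.size] at ht
      refine ⟨N, ?_, le₄ (le₃ (le₂ hxN)), le₄ (le₃ (le₂ hNy)),
        Set.Ico (N + 1) N₂, ?_, Set.Ico N₂ N₃, ?_, Set.Ico N₃ N₄, ?_, ?_, ?_, ?_, ?_, ?_, ?_,
        (e₂ L hl.1).mono_graph (le₃.trans le₄), (e₃ R hl.2.1).mono_graph le₄,
        e₄ S ⟨by omega, hl.2.2⟩⟩
      all_goals first
        | (rw [Set.mem_Ico]; omega)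
        | (intro a ha; rw [Set.mem_Ico] at ha ⊢; omega)
        | (refine Set.disjoint_left.2 fun a ha hb => ?_; rw [Set.mem_Ico] at ha hb; omega)

/-- Extending a host at a triangle `pyc`: 2-trees on the edge `py` can be embedded if smaller
2-trees on the edge `yc` can. -/
lemma Gen.triangle {h n s q : ℕ} (hs : Gen (fun t : TwoTree V => t.size ≤ h) s)
    (hq : Gen (fun t : TwoTree V => t.size ≤ n ∧ t.Light h) q) (hn : n ≤ 2 * h + 1) (m : ℕ) :
    ∀ ⦃N : ℕ⦄ ⦃G : SimpleGraph ℕ⦄, Host N G → ∀ ⦃p y c : ℕ⦄, G.Adj p y → G.Adj p c → G.Adj y c →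
      ∃ N' G', Host N' G' ∧ G ≤ G' ∧ N ≤ N' ∧ N' ≤ N + m * (1 + 2 * s + q) ∧
        ∀ (F : Set ℕ) (k : ℕ),
          (∀ t : TwoTree V, t.size ≤ k → t.size ≤ n → t.RightHeavy h → t.Emb G' y c F) →
          c ∉ F → Disjoint F (Set.Ico N N') →
          ∀ t : TwoTree V, t.size ≤ m → t.size ≤ n → t.size ≤ k + 1 → t.RightHeavy h →
            t.Emb G' p y (insert c (F ∪ Set.Ico N N')) := by
  induction m with
  | zero =>
    exact fun N G hG _ _ _ _ _ _ => ⟨N, G, hG, le_rfl, le_rfl, by simp,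
      fun _ _ _ _ _ _ ht _ _ _ => TwoTree.emb_of_size_eq_zero (Nat.le_zero.1 ht) _ _ _ _⟩
  | succ m ih =>
    intro N G hG p y c hpy hpc hyc
    have hcN := hG.lt hpc.symm
    obtain ⟨G₀, hG₀, le₀, hpN, hNy, hNc⟩ := hG.exists_attach_triangle hpy hpc hyc
    obtain ⟨N₁, G₁, hG₁, le₁, hN₁, hs₁, e₁⟩ := hs hG₀ hpN
    obtain ⟨N₂, G₂, hG₂, le₂, hN₂, hs₂, e₂⟩ := hs hG₁ (le₁ (le₀ hpc))
    obtain ⟨N₃, G₃, hG₃, le₃, hN₃, hs₃, e₃⟩ := hq hG₂ (le₂ (le₁ (le₀ hpy)))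
    have le₀₃ : G₀ ≤ G₃ := le₁.trans (le₂.trans le₃)
    obtain ⟨N₄, G₄, hG₄, le₄, hN₄, hs₄, e₄⟩ :=
      ih hG₃ (le₀₃ hNy) (le₀₃ hNc) (le₀₃ (le₀ hyc))
    have le₀₄ : G₀ ≤ G₄ := le₀₃.trans le₄
    refine ⟨N₄, G₄, hG₄, le₀.trans le₀₄, by omega, ?_, ?_⟩
    · rw [add_mul]
      omega
    intro F k hF hcF hdisj t htm htn htk hr
    rcases hr with h0 | ⟨w, L, R, S, hre, hS, hL⟩
    · exact TwoTree.emb_of_size_eq_zero h0 _ _ _ _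
    refine hre.2 _ _ _ _ ?_
    have hsize := hre.1
    simp only [TwoTree.size] at hsize
    have hF' : ∀ a ∈ F, ¬ (N ≤ a ∧ a < N₄) := fun a ha hb => Set.disjoint_left.1 hdisj ha hb
    have hS' : S.Emb G₄ p y (Set.Ico N₂ N₃) := (e₃ S ⟨by omega, hS⟩).mono_graph le₄
    rcases TwoTree.rightHeavy_or_flip (h := h) (t := R) (by omega) with hR | hR
    · refine ⟨N, ?_, le₀₄ hpN, le₀₄ hNy, Set.Ico (N + 1) N₁, ?_,
        insert c (F ∪ Set.Ico N₃ N₄), ?_, Set.Ico N₂ N₃, ?_, ?_, ?_, ?_, ?_, ?_, ?_,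
        (e₁ L hL).mono_graph (le₂.trans (le₃.trans le₄)),
        e₄ F k hF hcF (hdisj.mono_right (Set.Ico_subset_Ico_left (by omega))) R (by omega)
          (by omega) (by omega) hR, hS'⟩
      all_goals simp only [Set.subset_def, Set.disjoint_left, Set.mem_insert_iff, Set.mem_union,
        Set.mem_Ico]
      all_goals first
        | omega
        | grind
    · refine ⟨c, ?_, le₀₄ (le₀ hpc), le₀₄ (le₀ hyc.symm), Set.Ico N₁ N₂, ?_, F, ?_,
        Set.Ico N₂ N₃, ?_, ?_, hcF, ?_, ?_, ?_, ?_,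
        (e₂ L hL).mono_graph (le₃.trans le₄),
        (hF R.flip (by rw [TwoTree.size_flip]; omega) (by rw [TwoTree.size_flip]; omega)
          hR).of_flip, hS'⟩
      all_goals simp only [Set.subset_def, Set.disjoint_left, Set.mem_insert_iff, Set.mem_union,
        Set.mem_Ico]
      all_goals first
        | omega
        | grind

lemma Gen.rightHeavy {h n s q : ℕ} (hs : Gen (fun t : TwoTree V => t.size ≤ h) s)
    (hq : Gen (fun t : TwoTree V => t.size ≤ n ∧ t.Light h) q) (hn : n ≤ 2 * h + 1) (k : ℕ) :
    Gen (fun t : TwoTree V => t.size ≤ k ∧ t.size ≤ n ∧ t.RightHeavy h)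
      (k * (1 + n * (1 + 2 * s + q))) := by
  induction k with
  | zero =>
    exact fun N G hG _ _ _ => ⟨N, G, hG, le_rfl, le_rfl, by simp, fun _ ht =>
      TwoTree.emb_of_size_eq_zero (Nat.le_zero.1 ht.1) _ _ _ _⟩
  | succ k ih =>
    intro N G hG x y hxy
    obtain ⟨G₀, hG₀, le₀, hxN, hNy⟩ := hG.exists_attach_edge hxy
    obtain ⟨N₁, G₁, hG₁, le₁, hN₁, hs₁, e₁⟩ := ih hG₀ hNy.symm
    obtain ⟨N₂, G₂, hG₂, le₂, hN₂, hs₂, e₂⟩ :=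
      hs.triangle hq hn n hG₁ (le₁ (le₀ hxy)) (le₁ hxN) (le₁ hNy.symm)
    refine ⟨N₂, G₂, hG₂, le₀.trans (le₁.trans le₂), by omega, ?_, fun t ⟨htk, htn, ht⟩ => ?_⟩
    · rw [add_mul]
      omega
    · refine (e₂ (Set.Ico (N + 1) N₁) k (fun t htk htn ht => (e₁ t ⟨htk, htn, ht⟩).mono_graph le₂)
        (by simp) ?_ t htn htn htk ht).mono_set ?_
      · exact Set.disjoint_left.2 fun a ha hb => by rw [Set.mem_Ico] at ha hb; omega
      · rintro a (rfl | ha | ha)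
        · rw [Set.mem_Ico]; omega
        · rw [Set.mem_Ico] at ha ⊢; omega
        · rw [Set.mem_Ico] at ha ⊢; omega

lemma Gen.double {h n s : ℕ} (hs : Gen (fun t : TwoTree V => t.size ≤ h) s)
    (hn : n ≤ 2 * h + 1) :
    Gen (fun t : TwoTree V => t.size ≤ n)
      (2 * (n * (1 + n * (1 + 2 * s + n * (1 + 2 * s))))) := by
  have key := hs.rightHeavy (hs.light n) hn n
  intro N G hG x y hxy
  obtain ⟨N₁, G₁, hG₁, le₁, hN₁, hs₁, e₁⟩ := key hG hxy
  obtain ⟨N₂, G₂, hG₂, le₂, hN₂, hs₂, e₂⟩ := key hG₁ (le₁ hxy).symm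
  refine ⟨N₂, G₂, hG₂, le₁.trans le₂, by omega, by omega, fun t ht => ?_⟩
  rcases TwoTree.rightHeavy_or_flip (h := h) (t := t) (by omega) with h | h
  · exact ((e₁ t ⟨ht, ht, h⟩).mono_graph le₂).mono_set (Set.Ico_subset_Ico_right hN₂)
  · have ht' : t.flip.size ≤ n := t.size_flip.trans_le ht
    exact (e₂ t.flip ⟨ht', ht', h⟩).of_flip.mono_set (Set.Ico_subset_Ico_left hN₁)

lemma exists_gen (k : ℕ) : ∀ n < 2 ^ k, ∃ s, 1 + 2 * s ≤ 2 ^ ((3 * k + 4) * k) ∧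
    Gen (fun t : TwoTree V => t.size ≤ n) s := by
  induction k with
  | zero =>
    intro n hn
    obtain rfl : n = 0 := by simpa using hn
    exact ⟨0, by simp, gen_zero⟩
  | succ k ih =>
    intro n hn
    obtain ⟨s, hsk, hs⟩ := ih (n / 2) (by rw [pow_succ] at hn; omega)
    refine ⟨_, ?_, hs.double (n := n) (by omega)⟩
    have hn' : n + 1 ≤ 2 ^ (k + 1) := hn
    calc 1 + 2 * (2 * (n * (1 + n * (1 + 2 * s + n * (1 + 2 * s)))))
        ≤ 2 ^ 4 * (n + 1) ^ 3 * (1 + 2 * s) := by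
          refine Nat.le.intro
            (k := (15 + 44 * n + 44 * n ^ 2 + 12 * n ^ 3) * (1 + 2 * s) + 8 * n * s + 2 * s) ?_
          ring
      _ ≤ 2 ^ 4 * (2 ^ (k + 1)) ^ 3 * 2 ^ ((3 * k + 4) * k) := by gcongr
      _ ≤ 2 ^ ((3 * (k + 1) + 4) * (k + 1)) := by
          rw [← pow_mul, ← pow_add, ← pow_add]
          refine Nat.pow_le_pow_right two_pos (Nat.le.intro (k := 3 * k) ?_)
          ring

end Construction

section Main

lemma exists_host (n : ℕ) : ∃ (N s : ℕ) (G : SimpleGraph ℕ), Host N G ∧ N ≤ 2 + s ∧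
    1 + 2 * s ≤ 2 ^ ((3 * (Nat.log 2 n + 1) + 4) * (Nat.log 2 n + 1)) ∧ G.Adj 0 1 ∧
    ∀ t : TwoTree (Fin n), t.size ≤ n → t.Emb G 0 1 (Set.Ico 2 N) := by
  obtain ⟨s, hs, hgen⟩ := exists_gen (V := Fin n) _ n (Nat.lt_pow_succ_log_self one_lt_two n)
  have h2 : Host 2 (attach (attach ⊥ 0 ∅) 1 {0}) :=
    (Host.empty.attach ∅ (by simp) (by simp) (by simp)).attach {0} (by simp) (by simp) (by simp)
  obtain ⟨N, G, hG, hle, hN, hNs, he⟩ :=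
    hgen h2 (x := 0) (y := 1) (Or.inr ⟨zero_ne_one, Or.inr ⟨rfl, by simp⟩⟩)
  exact ⟨N, s, G, hG, hNs, hs, hle (Or.inr ⟨zero_ne_one, Or.inr ⟨rfl, by simp⟩⟩), he⟩

lemma two_add_le_rpow {n s : ℕ} (hn : 2 ≤ n)
    (hs : 1 + 2 * s ≤ 2 ^ ((3 * (Nat.log 2 n + 1) + 4) * (Nat.log 2 n + 1))) :
    ((2 + s : ℕ) : ℝ) ≤ (n : ℝ) ^ (20 * Real.logb 2 (n : ℝ)) := by
  have hl : 1 ≤ Nat.log 2 n := Nat.log_pos one_lt_two hn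
  have hln : 2 ^ Nat.log 2 n ≤ n := Nat.pow_log_le_self 2 (by omega)
  have hlog : (Nat.log 2 n : ℝ) ≤ Real.logb 2 n := by
    exact_mod_cast Real.natLog_le_logb n 2
  generalize Nat.log 2 n = l at hs hl hln hlog
  have h1 : 2 + s ≤ n ^ (20 * l) :=
    calc 2 + s ≤ 2 ^ ((3 * (l + 1) + 4) * (l + 1)) := by
          rcases s.eq_zero_or_pos with rfl | h
          · exact le_self_pow₀ one_le_two (by positivity)
          · omega
      _ ≤ 2 ^ (l * (20 * l)) := Nat.pow_le_pow_right two_pos (by nlinarith)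
      _ = (2 ^ l) ^ (20 * l) := pow_mul _ _ _
      _ ≤ n ^ (20 * l) := Nat.pow_le_pow_left hln _
  calc ((2 + s : ℕ) : ℝ) ≤ (n : ℝ) ^ (20 * l) := by exact_mod_cast h1
    _ = (n : ℝ) ^ (20 * (l : ℝ)) := by rw [← Real.rpow_natCast]; push_cast; rfl
    _ ≤ (n : ℝ) ^ (20 * Real.logb 2 (n : ℝ)) := by
      apply Real.rpow_le_rpow_of_exponent_le
      · exact_mod_cast (by omega : 1 ≤ n)
      · gcongr

lemma containsSub_of_emb {n N : ℕ} (hn : 2 ≤ n) {G : SimpleGraph ℕ} (hG : Host N G)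
    (h01 : G.Adj 0 1)
    (hemb : ∀ t : TwoTree (Fin n), t.size ≤ n → t.Emb G 0 1 (Set.Ico 2 N))
    {H : SimpleGraph (Fin n)} (hH : NoK4 H) :
    ContainsSub (G.comap (Fin.val : Fin N → ℕ)) H := by
  obtain ⟨t, u, v, hnd, hcov, hadj⟩ := exists_twoTree (n - 2) (Fin n) H (by simp; omega) hH
  have ht : t.size ≤ n := by
    have h1 := Multiset.card_le_card (Multiset.le_iff_subset hnd |>.2
      fun a _ => Finset.mem_univ_val a)
    simp only [Multiset.card_cons, TwoTree.card_verts, Finset.card_val, Finset.card_univ,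
      Fintype.card_fin] at h1
    omega
  obtain ⟨φ, hu, hv, hF, hinj, hφ⟩ := (hemb t ht).exists_map h01 hnd
  have hlt : ∀ a, φ a < N := fun a => by
    rcases hcov a with rfl | rfl | ha
    · exact hu ▸ hG.lt h01
    · exact hv ▸ hG.lt h01.symm
    · exact (hF a ha).2
  have h2 : ∀ a ∈ t.verts, 2 ≤ φ a := fun a ha => (hF a ha).1
  refine ⟨fun a => ⟨φ a, hlt a⟩, fun a b hab => ?_, fun a b hab => ?_⟩
  · have hab : φ a = φ b := congrArg Fin.val hab
    rcases hcov a with rfl | rfl | ha <;> rcases hcov b with rfl | rfl | hb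
    · rfl
    · omega
    · have := h2 b hb; omega
    · omega
    · rfl
    · have := h2 b hb; omega
    · have := h2 a ha; omega
    · have := h2 a ha; omega
    · exact hinj ha hb hab
  · rcases hadj a b hab with h | h
    · exact hφ a b h
    · exact (hφ b a h).symm

end Main

end UniversalGraph

/-- For every `n ≥ 3` there is a graph `U_n` of treewidth at most 3
(in particular `K₅`-minor-free) with at most `n^(20 log₂ n)` vertices containing every
`n`-vertex graph of treewidth at most 2 (equivalently, every `n`-vertex `K₄`-minor-free
graph) as a subgraph. -/
theorem statement12 (n : ℕ) (hn : 3 ≤ n) :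
    ∃ (N : ℕ) (U : SimpleGraph (Fin N)),
      HasTreewidthAtMost U 3 ∧
      ¬ U.HasMinor (⊤ : SimpleGraph (Fin 5)) ∧
      (N : ℝ) ≤ (n : ℝ) ^ (20 * Real.logb 2 (n : ℝ)) ∧
      ∀ H : SimpleGraph (Fin n),
        (HasTreewidthAtMost H 2 ∨ ¬ H.HasMinor (⊤ : SimpleGraph (Fin 4))) →
        ContainsSub U H := by
  obtain ⟨N, s, G, hG, hNs, hs, h01, hemb⟩ := UniversalGraph.exists_host n
  have htw := hG.hasTreewidthAtMost
  refine ⟨N, G.comap Fin.val, htw, UniversalGraph.not_hasMinor_of_hasTreewidthAtMost htw,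
    (Nat.cast_le.2 hNs).trans (UniversalGraph.two_add_le_rpow (by omega) hs), fun H hH => ?_⟩
  exact UniversalGraph.containsSub_of_emb (by omega) hG h01 hemb
    (hH.elim UniversalGraph.not_hasMinor_of_hasTreewidthAtMost id)
end

section
/- Let Δ ≥ 3, d ≥ 1 and n ≥ 1 be integers, and let g_Δ(n) denote the number of isomorphism classes of connected Δ-regular graphs on n vertices. (i) If U is a finite simple graph of maximum degree at most d that contains every connected Δ-regular n-vertex graph as an induced subgraph, then (4d)^n · |V(U)| ≥ g_Δ(n). (ii) If U' is a finite simple graph of maximum degree at most d that contains every connected Δ-regular n-vertex graph as a subgraph, then (4d)^n · 2^{d·n} · |V(U')| ≥ g_Δ(n). -/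
open SimpleGraph

/-- `U` contains `H` as an induced subgraph. -/
def ContainsInd {α β : Type*} (U : SimpleGraph β) (H : SimpleGraph α) : Prop :=
  ∃ f : α → β, Function.Injective f ∧ ∀ a b, H.Adj a b ↔ U.Adj (f a) (f b)

/-- The number of isomorphism classes of connected `Δ`-regular graphs on `n` vertices. -/
noncomputable def numConnRegular (Δ n : ℕ) : ℕ :=
  Nat.card (Quot (fun G H : {G : SimpleGraph (Fin n) //
    G.Connected ∧ ∀ v, (G.neighborSet v).ncard = Δ} => Nonempty (G.val ≃g H.val)))

open Finset in
/-- A graph is determined up to isomorphism by the image of an injection of its vertices and a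
relation that restricts to its adjacency. -/
lemma nonempty_iso_of_image_eq {α β : Type*} [Fintype α] [DecidableEq β]
    {H₁ H₂ : SimpleGraph α} {f₁ f₂ : α → β} (hf₁ : Function.Injective f₁)
    (himage : univ.image f₁ = univ.image f₂) (R : β → β → Prop)
    (h₁ : ∀ a b, H₁.Adj a b ↔ R (f₁ a) (f₁ b)) (h₂ : ∀ a b, H₂.Adj a b ↔ R (f₂ a) (f₂ b)) :
    Nonempty (H₁ ≃g H₂) := by
  have hex : ∀ a, ∃ b, f₂ b = f₁ a := fun a => by
    have : f₁ a ∈ univ.image f₂ := himage ▸ mem_image_of_mem _ (mem_univ a)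
    simpa using this
  choose g hg using hex
  have hg_inj : Function.Injective g := fun a b hab => hf₁ (by rw [← hg a, ← hg b, hab])
  refine ⟨⟨Equiv.ofBijective g (Finite.injective_iff_bijective.mp hg_inj), ?_⟩⟩
  intro a b
  simp [h₁, h₂, hg]

/-- Every proper nonempty part of `S` is joined by an edge to the rest of `S`. -/
def HasCutEdges {V : Type*} (U : SimpleGraph V) (S : Finset V) : Prop :=
  ∀ A ⊆ S, A.Nonempty → A ≠ S → ∃ a ∈ A, ∃ u ∈ S, u ∉ A ∧ U.Adj a u

lemma SimpleGraph.Connected.hasCutEdges_image {α β : Type*} [Fintype α] [DecidableEq β]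
    {H : SimpleGraph α} (hH : H.Connected) {U : SimpleGraph β} {f : α → β}
    (hf : ∀ a b, H.Adj a b → U.Adj (f a) (f b)) : HasCutEdges U (Finset.univ.image f) := by
  intro A hA hne hneq
  obtain ⟨x, hx⟩ := hne
  obtain ⟨y, hy, hyA⟩ := Finset.exists_of_ssubset (hA.ssubset_of_ne hneq)
  obtain ⟨a, -, rfl⟩ := Finset.mem_image.mp (hA hx)
  obtain ⟨b, -, rfl⟩ := Finset.mem_image.mp hy
  obtain ⟨p⟩ := hH.preconnected a b
  obtain ⟨e, -, h₁, h₂⟩ := p.exists_boundary_dart {c | f c ∈ A} hx hyA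
  exact ⟨f e.fst, h₁, f e.snd, Finset.mem_image_of_mem _ (Finset.mem_univ _), h₂, hf _ _ e.adj⟩

open Finset in
open scoped Classical in
/-- The connected `n`-sets that contain `A` and avoid `B`. -/
noncomputable def connectedSets {V : Type*} [Fintype V] (U : SimpleGraph V) (n : ℕ)
    (A B : Finset V) : Finset (Finset V) :=
  univ.filter fun S => #S = n ∧ HasCutEdges U S ∧ A ⊆ S ∧ Disjoint S B

open Finset in
open scoped Classical in
lemma card_connectedSets_le_choose {V : Type*} [Fintype V] {U : SimpleGraph V} {d n : ℕ}
    (hU : ∀ v, U.degree v ≤ d) (v : V) (m k : ℕ) (A B : Finset V) (hv : v ∈ A)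
    (hAB : Disjoint A B) (hsub : A ∪ B ⊆ insert v (A.biUnion fun a => U.neighborFinset a))
    (hk : #A + k = n) (hm : d * (n - 1) + 1 ≤ m + #A + #B) :
    #(connectedSets U n A B) ≤ m.choose k := by
  induction m using Nat.strong_induction_on generalizing k A B with
  | _ m ih =>
  rcases k with _ | k
  · rw [Nat.choose_zero_right]
    refine card_le_one.mpr ?_
    simp only [connectedSets, mem_filter, mem_univ, true_and]
    rintro S ⟨hS, -, hAS, -⟩ T ⟨hT, -, hAT, -⟩
    rw [← eq_of_subset_of_card_le hAS (by omega), ← eq_of_subset_of_card_le hAT (by omega)]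
  by_cases hbd : ∃ a ∈ A, ∃ u, u ∉ A ∧ u ∉ B ∧ U.Adj a u
  · obtain ⟨a, ha, u, huA, huB, hau⟩ := hbd
    have huN : u ∈ A.biUnion fun a => U.neighborFinset a :=
      mem_biUnion.mpr ⟨a, ha, by simpa using hau⟩
    have hpos : 0 < m := by
      have h₁ : #(insert u (A ∪ B)) ≤ #(A.biUnion fun a => U.neighborFinset a) + 1 :=
        (card_le_card (insert_subset (mem_insert_of_mem huN) hsub)).trans (card_insert_le _ _)
      rw [card_insert_of_notMem (by simp [huA, huB]), card_union_of_disjoint hAB] at h₁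
      have h₂ : #(A.biUnion fun a => U.neighborFinset a) ≤ #A * d :=
        card_biUnion_le_card_mul _ _ _ fun a _ => by simpa using hU a
      have h₃ : #A * d ≤ d * (n - 1) := by
        rw [mul_comm]
        exact Nat.mul_le_mul_left _ (by omega)
      omega
    obtain ⟨m, rfl⟩ := Nat.exists_eq_add_of_lt hpos
    have hcover : connectedSets U n A B ⊆
        connectedSets U n (insert u A) B ∪ connectedSets U n A (insert u B) := by
      intro S hS
      simp only [connectedSets, mem_union, mem_filter, mem_univ, true_and, insert_subset_iff,
        disjoint_insert_right] at hS ⊢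
      tauto
    have hcardA := card_insert_of_notMem huA
    have hcardB := card_insert_of_notMem huB
    have h₁ : #(connectedSets U n (insert u A) B) ≤ m.choose k := by
      refine ih m (by omega) k _ _ (mem_insert_of_mem hv)
        (disjoint_insert_left.mpr ⟨huB, hAB⟩) ?_ (by omega) (by omega)
      rw [insert_union]
      have hmono : (A.biUnion fun a => U.neighborFinset a) ⊆
          (insert u A).biUnion fun a => U.neighborFinset a :=
        biUnion_subset_biUnion_of_subset_left _ (subset_insert _ _)
      exact insert_subset (mem_insert_of_mem (hmono huN))
        (hsub.trans (insert_subset_insert _ hmono))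
    have h₂ : #(connectedSets U n A (insert u B)) ≤ m.choose (k + 1) := by
      refine ih m (by omega) (k + 1) _ _ hv (disjoint_insert_right.mpr ⟨huA, hAB⟩) ?_
        (by omega) (by omega)
      rw [union_insert]
      exact insert_subset (mem_insert_of_mem huN) hsub
    rw [zero_add, Nat.choose_succ_succ]
    exact (card_le_card hcover).trans ((card_union_le _ _).trans (add_le_add h₁ h₂))
  · have hempty : connectedSets U n A B = ∅ := by
      refine eq_empty_of_forall_notMem fun S hS => ?_
      simp only [connectedSets, mem_filter, mem_univ, true_and] at hS
      obtain ⟨hcard, hcut, hAS, hSB⟩ := hS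
      obtain ⟨a, ha, u, huS, huA, hau⟩ := hcut A hAS ⟨v, hv⟩ (by rintro rfl; omega)
      exact hbd ⟨a, ha, u, huA, disjoint_left.mp hSB huS, hau⟩
    simp [hempty]

lemma Nat.choose_mul_self_le_four_mul_pow (d j : ℕ) : (d * j).choose j ≤ (4 * d) ^ j := by
  have h₁ : ((d * j).choose j : ℝ) ≤ ((d * j : ℕ) : ℝ) ^ j / (j.factorial : ℝ) :=
    Nat.choose_le_pow_div j (d * j)
  have h₂ : (j : ℝ) ^ j / (j.factorial : ℝ) ≤ Real.exp j :=
    Real.pow_div_factorial_le_exp _ (Nat.cast_nonneg j) j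
  have h₃ : Real.exp j ≤ 4 ^ j := by
    rw [← Real.exp_one_pow]
    exact pow_le_pow_left₀ (Real.exp_pos 1).le (by linarith [Real.exp_one_lt_three]) j
  have h₄ : ((d * j).choose j : ℝ) ≤ ((4 * d : ℕ) : ℝ) ^ j := by
    calc ((d * j).choose j : ℝ) ≤ (d : ℝ) ^ j * ((j : ℝ) ^ j / (j.factorial : ℝ)) := by
          rw [← mul_div_assoc, ← mul_pow]
          exact_mod_cast h₁
      _ ≤ (d : ℝ) ^ j * 4 ^ j := by gcongr; exact h₂.trans h₃
      _ = ((4 * d : ℕ) : ℝ) ^ j := by push_cast; rw [← mul_pow, mul_comm]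
  exact_mod_cast h₄

open Finset in
open scoped Classical in
lemma card_connectedSets_empty_le {V : Type*} [Fintype V] {U : SimpleGraph V} {d n : ℕ}
    (hd : 1 ≤ d) (hn : 1 ≤ n) (hU : ∀ v, U.degree v ≤ d) :
    #(connectedSets U n ∅ ∅) ≤ (4 * d) ^ n * Fintype.card V := by
  have hcover : connectedSets U n ∅ ∅ ⊆ univ.biUnion fun v => connectedSets U n {v} ∅ := by
    intro S hS
    simp only [connectedSets, mem_biUnion, mem_filter, mem_univ, true_and] at hS ⊢
    obtain ⟨v, hv⟩ := card_pos.mp (show 0 < #S by omega)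
    exact ⟨v, hS.1, hS.2.1, singleton_subset_iff.mpr hv, disjoint_empty_right _⟩
  have hroot : ∀ v, #(connectedSets U n {v} ∅) ≤ (4 * d) ^ n := fun v =>
    calc #(connectedSets U n {v} ∅) ≤ (d * (n - 1)).choose (n - 1) :=
          card_connectedSets_le_choose hU v _ _ _ _ (mem_singleton_self v)
            (disjoint_empty_right _) (by simp) (by simp; omega) (by simp)
      _ ≤ (4 * d) ^ (n - 1) := Nat.choose_mul_self_le_four_mul_pow d (n - 1)
      _ ≤ (4 * d) ^ n := Nat.pow_le_pow_right (by omega) (Nat.sub_le n 1)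
  calc #(connectedSets U n ∅ ∅) ≤ #(univ : Finset V) * (4 * d) ^ n :=
        (card_le_card hcover).trans (card_biUnion_le_card_mul _ _ _ fun v _ => hroot v)
    _ = (4 * d) ^ n * Fintype.card V := by rw [mul_comm, card_univ]

/-- A code that determines the isomorphism class takes at least `numConnRegular Δ n` values. -/
lemma numConnRegular_le_card {Δ n : ℕ} {γ : Type*} (T : Finset γ)
    (code : {G : SimpleGraph (Fin n) //
      G.Connected ∧ ∀ v, (G.neighborSet v).ncard = Δ} → γ)
    (hmem : ∀ G, code G ∈ T)
    (hiso : ∀ G H, code G = code H → Nonempty (G.val ≃g H.val)) :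
    numConnRegular Δ n ≤ T.card := by
  rw [numConnRegular, ← Nat.card_eq_finsetCard T]
  refine Nat.card_le_card_of_injective (fun q => (⟨code q.out, hmem q.out⟩ : T)) ?_
  intro p q hpq
  rw [← Quot.out_eq p, ← Quot.out_eq q]
  exact Quot.sound (hiso _ _ (Subtype.mk.inj hpq))

/-- Let `Δ ≥ 3`, `d ≥ 1`, `n ≥ 1` and let `g_Δ(n)` be the number of
isomorphism classes of connected `Δ`-regular graphs on `n` vertices.
(i) If `U` has maximum degree at most `d` and contains every connected `Δ`-regular
`n`-vertex graph as an induced subgraph, then `(4d)^n · |V(U)| ≥ g_Δ(n)`.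
(ii) If `U'` has maximum degree at most `d` and contains every connected `Δ`-regular
`n`-vertex graph as a subgraph, then `(4d)^n · 2^(d·n) · |V(U')| ≥ g_Δ(n)`. -/
theorem statement13 (Δ d n : ℕ) (hΔ : 3 ≤ Δ) (hd : 1 ≤ d) (hn : 1 ≤ n) :
    (∀ (N : ℕ) (U : SimpleGraph (Fin N)),
      (∀ v, (U.neighborSet v).ncard ≤ d) →
      (∀ H : SimpleGraph (Fin n),
        H.Connected → (∀ v, (H.neighborSet v).ncard = Δ) → ContainsInd U H) →
      numConnRegular Δ n ≤ (4 * d) ^ n * N) ∧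
    (∀ (N' : ℕ) (U' : SimpleGraph (Fin N')),
      (∀ v, (U'.neighborSet v).ncard ≤ d) →
      (∀ H : SimpleGraph (Fin n),
        H.Connected → (∀ v, (H.neighborSet v).ncard = Δ) → ContainsSub U' H) →
      numConnRegular Δ n ≤ (4 * d) ^ n * 2 ^ (d * n) * N') := by
  classical
  have hdeg : ∀ (N : ℕ) (U : SimpleGraph (Fin N)), (∀ v, (U.neighborSet v).ncard ≤ d) →
      ∀ v, U.degree v ≤ d := by
    intro N U hU v
    rw [← SimpleGraph.card_neighborSet_eq_degree, ← Nat.card_eq_fintype_card]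
    exact hU v
  have himage : ∀ {N : ℕ} {U : SimpleGraph (Fin N)} {H : SimpleGraph (Fin n)}
      {f : Fin n → Fin N}, H.Connected → Function.Injective f →
      (∀ a b, H.Adj a b → U.Adj (f a) (f b)) →
      Finset.univ.image f ∈ connectedSets U n ∅ ∅ := by
    intro N U H f hH hf hadj
    simp only [connectedSets, Finset.mem_filter, Finset.mem_univ, true_and,
      Finset.card_image_of_injective _ hf, Finset.card_univ, Fintype.card_fin]
    exact ⟨hH.hasCutEdges_image hadj, Finset.empty_subset _, Finset.disjoint_empty_right _⟩
  refine ⟨fun N U hU huniv => ?_, fun N U hU huniv => ?_⟩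
  · choose f hf hadj using fun G : {G : SimpleGraph (Fin n) //
      G.Connected ∧ ∀ v, (G.neighborSet v).ncard = Δ} => huniv G.1 G.2.1 G.2.2
    have hcount := card_connectedSets_empty_le hd hn (hdeg N U hU)
    rw [Fintype.card_fin] at hcount
    refine le_trans (numConnRegular_le_card _ (fun G => Finset.univ.image (f G)) ?_ ?_) hcount
    · exact fun G => himage G.2.1 (hf G) fun a b => (hadj G a b).mp
    · exact fun G H h => nonempty_iso_of_image_eq (hf G) h U.Adj (hadj G) (hadj H)
  · choose f hf hadj using fun G : {G : SimpleGraph (Fin n) //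
      G.Connected ∧ ∀ v, (G.neighborSet v).ncard = Δ} => huniv G.1 G.2.1 G.2.2
    have hcount := card_connectedSets_empty_le hd hn (hdeg N U hU)
    rw [Fintype.card_fin] at hcount
    let D : Finset (Fin N) → Finset (Σ _ : Fin N, Fin N) :=
      fun S => S.sigma fun v => U.neighborFinset v
    let E : {G : SimpleGraph (Fin n) // G.Connected ∧ ∀ v, (G.neighborSet v).ncard = Δ} →
        Finset (Σ _ : Fin N, Fin N) := fun G =>
      (Finset.univ.filter fun p : Fin n × Fin n => G.1.Adj p.1 p.2).image
        fun p => ⟨f G p.1, f G p.2⟩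
    have hE : ∀ G a b, G.1.Adj a b ↔ (⟨f G a, f G b⟩ : Σ _ : Fin N, Fin N) ∈ E G := by
      intro G a b
      simp only [E, Finset.mem_image, Finset.mem_filter, Finset.mem_univ, true_and]
      constructor
      · exact fun h => ⟨(a, b), h, rfl⟩
      · rintro ⟨⟨a', b'⟩, h, heq⟩
        obtain ⟨h₁, h₂⟩ := Sigma.mk.inj heq
        rwa [hf G h₁, hf G (eq_of_heq h₂)] at h
    have hD : ∀ S ∈ connectedSets U n ∅ ∅, (D S).powerset.card ≤ 2 ^ (d * n) := by
      intro S hS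
      simp only [connectedSets, Finset.mem_filter] at hS
      rw [Finset.card_powerset, Finset.card_sigma]
      refine Nat.pow_le_pow_right (by norm_num) ?_
      calc ∑ v ∈ S, (U.neighborFinset v).card ≤ S.card • d :=
            Finset.sum_le_card_nsmul _ _ _ fun v _ => by simpa using hdeg N U hU v
        _ = d * n := by rw [hS.2.1, smul_eq_mul, mul_comm]
    calc numConnRegular Δ n
        ≤ ((connectedSets U n ∅ ∅).sigma fun S => (D S).powerset).card := by
          refine numConnRegular_le_card _ (fun G => ⟨Finset.univ.image (f G), E G⟩) ?_ ?_
          · intro G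
            refine Finset.mem_sigma.mpr ⟨himage G.2.1 (hf G) (hadj G), ?_⟩
            refine Finset.mem_powerset.mpr fun x hx => ?_
            simp only [E, Finset.mem_image, Finset.mem_filter, Finset.mem_univ, true_and] at hx
            obtain ⟨⟨a, b⟩, h, rfl⟩ := hx
            simpa [D] using hadj G a b h
          · intro G H h
            obtain ⟨h₁, h₂⟩ := Sigma.mk.inj h
            refine nonempty_iso_of_image_eq (hf G) h₁ (fun x y => ⟨x, y⟩ ∈ E G) (hE G) ?_
            rw [eq_of_heq h₂]
            exact hE H
      _ ≤ (connectedSets U n ∅ ∅).card * 2 ^ (d * n) := by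
          rw [Finset.card_sigma, ← smul_eq_mul]
          exact Finset.sum_le_card_nsmul _ _ _ hD
      _ ≤ (4 * d) ^ n * N * 2 ^ (d * n) := Nat.mul_le_mul_right _ hcount
      _ = (4 * d) ^ n * 2 ^ (d * n) * N := by ring
end

section
/- Let k ≥ 2 and n ≥ k+4 be integers. Then the number of isomorphism classes of n-vertex simple k-paths is at least k^{n−2k−2}. -/
open SimpleGraph

/-- `G` is a simple `k`-path: it has a path-decomposition of width `k` in which all bags
have size `k + 1` and induce cliques, all adhesions have size `k`, and the adhesions are
pairwise distinct. -/
def IsSimpleKPath (k : ℕ) {V : Type*} [DecidableEq V] (G : SimpleGraph V) : Prop :=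
  ∃ (m : ℕ) (X : Fin (m + 1) → Finset V),
    (∀ u v, G.Adj u v → ∃ i, u ∈ X i ∧ v ∈ X i) ∧
    (∀ v, ∃ i, v ∈ X i) ∧
    (∀ v, ∀ i j l : Fin (m + 1), i ≤ j → j ≤ l → v ∈ X i → v ∈ X l → v ∈ X j) ∧
    (∀ i, (X i).card = k + 1) ∧
    (∀ i : Fin m, (X i.castSucc ∩ X i.succ).card = k) ∧
    (∀ i j : Fin m, i ≠ j → X i.castSucc ∩ X i.succ ≠ X j.castSucc ∩ X j.succ) ∧
    (∀ i, ∀ u ∈ X i, ∀ v ∈ X i, u ≠ v → G.Adj u v)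

/-- The number of isomorphism classes of `n`-vertex simple `k`-paths. -/
noncomputable def numSimpleKPaths (k n : ℕ) : ℕ :=
  Nat.card (Quot (fun G H : {G : SimpleGraph (Fin n) // IsSimpleKPath k G} =>
    Nonempty (G.val ≃g H.val)))

/-- The vertices `u < v` that carry the last occurrence of their letter in the word
`c 0, …, c (v - 1)`. -/
noncomputable def lastOccurrences (c : ℕ → ℕ) (v : ℕ) : Finset ℕ :=
  by classical exact (Finset.range v).filter fun u => ∀ w, u < w → w < v → c w ≠ c u

lemma mem_lastOccurrences {c : ℕ → ℕ} {u v : ℕ} :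
    u ∈ lastOccurrences c v ↔ u < v ∧ ∀ w, u < w → w < v → c w ≠ c u := by
  simp [lastOccurrences]

/-- The graph on `ℕ` of a word: `u < v` are adjacent when the letter of `u` does not occur
strictly between `u` and `v`. -/
def wordGraph (c : ℕ → ℕ) : SimpleGraph ℕ where
  Adj u v := u ∈ lastOccurrences c v ∨ v ∈ lastOccurrences c u
  symm := ⟨fun _ _ h => h.symm⟩
  loopless := ⟨fun u h => by simp [mem_lastOccurrences] at h⟩

lemma wordGraph_adj_of_lt {c : ℕ → ℕ} {u v : ℕ} (h : u < v) :
    (wordGraph c).Adj u v ↔ ∀ w, u < w → w < v → c w ≠ c u := by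
  simp only [wordGraph, mem_lastOccurrences]
  constructor
  · rintro (h' | h')
    · exact h'.2
    · omega
  · exact fun h' => Or.inl ⟨h, h'⟩

/-- A word over `{0, …, k - 1}` that starts with `0, 1, …, k - 1`. -/
structure IsStartingWord (k : ℕ) (c : ℕ → ℕ) : Prop where
  lt : ∀ v, c v < k
  start : ∀ i < k, c i = i

lemma IsStartingWord.exists_mem_lastOccurrences {k : ℕ} {c : ℕ → ℕ} (hc : IsStartingWord k c)
    {v a : ℕ} (hv : k ≤ v) (ha : a < k) : ∃ u ∈ lastOccurrences c v, c u = a := by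
  classical
  have hne : ((Finset.range v).filter fun u => c u = a).Nonempty :=
    ⟨a, by simp [hc.start a ha]; omega⟩
  obtain ⟨u, hu, hmax⟩ := Finset.exists_max_image _ id hne
  simp only [Finset.mem_filter, Finset.mem_range, id] at hu hmax
  refine ⟨u, mem_lastOccurrences.2 ⟨hu.1, fun w h1 h2 h3 => ?_⟩, hu.2⟩
  have := hmax w ⟨h2, h3.trans hu.2⟩
  omega

lemma IsStartingWord.card_lastOccurrences {k : ℕ} {c : ℕ → ℕ} (hc : IsStartingWord k c)
    {v : ℕ} (hv : k ≤ v) : (lastOccurrences c v).card = k := by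
  have hinj : Set.InjOn c (lastOccurrences c v) := by
    intro x hx y hy hxy
    simp only [Finset.mem_coe, mem_lastOccurrences] at hx hy
    rcases lt_trichotomy x y with h | h | h
    · exact absurd hxy.symm (hx.2 y h hy.1)
    · exact h
    · exact absurd hxy (hy.2 x h hx.1)
  rw [← Finset.card_image_of_injOn hinj]
  have : (lastOccurrences c v).image c = Finset.range k := by
    ext a
    simp only [Finset.mem_image, Finset.mem_range]
    constructor
    · rintro ⟨u, -, rfl⟩
      exact hc.lt u
    · exact hc.exists_mem_lastOccurrences hv
  rw [this, Finset.card_range]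

lemma card_filter_val_mem {n : ℕ} (s : Finset ℕ) (hs : ∀ x ∈ s, x < n) :
    ((Finset.univ : Finset (Fin n)).filter fun u : Fin n => (u : ℕ) ∈ s).card = s.card := by
  rw [← Finset.card_map Fin.valEmbedding]
  congr 1
  ext x
  simp only [Finset.mem_map, Finset.mem_filter, Finset.mem_univ, true_and, Fin.valEmbedding_apply]
  exact ⟨fun ⟨_, h, h'⟩ => h' ▸ h, fun h => ⟨⟨x, hs x h⟩, h, rfl⟩⟩

/-- The restriction of `wordGraph c` to the first `n` vertices. -/
def initialWordGraph (c : ℕ → ℕ) (n : ℕ) : SimpleGraph (Fin n) :=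
  (wordGraph c).comap Fin.val

lemma IsStartingWord.isSimpleKPath {k n : ℕ} {c : ℕ → ℕ} (hc : IsStartingWord k c)
    (hn : k + 1 ≤ n) : IsSimpleKPath k (initialWordGraph c n) := by
  classical
  have hmem : ∀ u v, u ∈ insert v (lastOccurrences c v) ↔
      u ≤ v ∧ ∀ w, u < w → w < v → c w ≠ c u := by
    intro u v
    rw [Finset.mem_insert, mem_lastOccurrences]
    constructor
    · rintro (rfl | h)
      · exact ⟨le_rfl, fun w _ _ => by omega⟩
      · exact ⟨h.1.le, h.2⟩
    · rintro ⟨h1, h2⟩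
      rcases h1.eq_or_lt with h | h
      · exact Or.inl h
      · exact Or.inr ⟨h, h2⟩
  have hstart : ∀ u ≤ k, u ∈ insert k (lastOccurrences c k) := by
    intro u hu
    refine (hmem u k).2 ⟨hu, fun w h1 h2 => ?_⟩
    rw [hc.start w h2, hc.start u (by omega)]
    omega
  have hadj : ∀ u v, (wordGraph c).Adj u v → u < n → v < n →
      ∃ i, k + i < n ∧ u ∈ insert (k + i) (lastOccurrences c (k + i)) ∧
        v ∈ insert (k + i) (lastOccurrences c (k + i)) := by
    intro u v h hu hv
    wlog huv : u < v generalizing u v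
    · obtain ⟨i, h1, h2, h3⟩ := this v u h.symm hv hu
        (lt_of_le_of_ne (not_lt.1 huv) h.ne')
      exact ⟨i, h1, h3, h2⟩
    rcases le_or_gt k v with hkv | hkv
    · refine ⟨v - k, by omega, ?_⟩
      rw [Nat.add_sub_cancel' hkv]
      exact ⟨(hmem u v).2 ⟨huv.le, (wordGraph_adj_of_lt huv).1 h⟩, Finset.mem_insert_self _ _⟩
    · exact ⟨0, by omega, hstart u (by omega), hstart v (by omega)⟩
  have hinter : ∀ v, insert v (lastOccurrences c v) ∩
      insert (v + 1) (lastOccurrences c (v + 1)) = lastOccurrences c (v + 1) := by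
    intro v
    ext u
    rw [Finset.mem_inter, hmem, hmem, mem_lastOccurrences]
    constructor
    · rintro ⟨h1, h2⟩
      exact ⟨by omega, h2.2⟩
    · rintro ⟨h1, h2⟩
      exact ⟨⟨by omega, fun w h3 h4 => h2 w h3 (by omega)⟩, by omega, h2⟩
  let X : Fin (n - k - 1 + 1) → Finset (Fin n) := fun i =>
    Finset.univ.filter fun u => (u : ℕ) ∈ insert (k + i : ℕ) (lastOccurrences c (k + i))
  have hX : ∀ i u, u ∈ X i ↔ (u : ℕ) ∈ insert (k + i : ℕ) (lastOccurrences c (k + i)) := by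
    simp [X]
  have hXX : ∀ i : Fin (n - k - 1), X i.castSucc ∩ X i.succ =
      Finset.univ.filter fun u : Fin n => (u : ℕ) ∈ lastOccurrences c (k + i + 1) := by
    intro i
    ext u
    rw [Finset.mem_inter, hX, hX, Finset.mem_filter, ← hinter, Finset.mem_inter]
    simp [add_assoc]
  refine ⟨n - k - 1, X, ?_, ?_, ?_, ?_, ?_, ?_, ?_⟩
  · intro u v h
    obtain ⟨i, h1, h2, h3⟩ := hadj u v h u.2 v.2
    exact ⟨⟨i, by omega⟩, (hX _ _).2 h2, (hX _ _).2 h3⟩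
  · intro v
    rcases le_or_gt k v with hkv | hkv
    · refine ⟨⟨v - k, by omega⟩, (hX _ _).2 ?_⟩
      simp only
      rw [Nat.add_sub_cancel' hkv]
      exact Finset.mem_insert_self _ _
    · exact ⟨0, (hX _ _).2 (hstart v hkv.le)⟩
  · intro v i j l hij hjl hi hl
    rw [hX, hmem] at *
    have h1 : (i : ℕ) ≤ j := hij
    have h2 : (j : ℕ) ≤ l := hjl
    exact ⟨by omega, fun w h3 h4 => hl.2 w h3 (by omega)⟩
  · intro i
    rw [card_filter_val_mem, Finset.card_insert_of_notMem, hc.card_lastOccurrences (by omega)]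
    · simp [mem_lastOccurrences]
    · intro x hx
      have := ((hmem _ _).1 hx).1
      omega
  · intro i
    rw [hXX, card_filter_val_mem, hc.card_lastOccurrences (by omega)]
    intro x hx
    have := (mem_lastOccurrences.1 hx).1
    omega
  · have key : ∀ i j : Fin (n - k - 1), i < j →
        X i.castSucc ∩ X i.succ ≠ X j.castSucc ∩ X j.succ := by
      intro i j hij h
      rw [hXX, hXX] at h
      have hij' : (i : ℕ) < j := hij
      have hj : (⟨k + j, by omega⟩ : Fin n) ∈ Finset.univ.filter fun u : Fin n =>
          (u : ℕ) ∈ lastOccurrences c (k + j + 1) := by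
        simp only [Finset.mem_filter, Finset.mem_univ, true_and, mem_lastOccurrences]
        exact ⟨by omega, fun w _ _ => by omega⟩
      rw [← h] at hj
      simp only [Finset.mem_filter, Finset.mem_univ, true_and, mem_lastOccurrences] at hj
      omega
    intro i j hij
    rcases lt_or_gt_of_ne hij with h | h
    · exact key i j h
    · exact (key j i h).symm
  · intro i u hu v hv huv
    rw [hX, hmem] at hu hv
    change (wordGraph c).Adj u v
    rcases lt_or_gt_of_ne (fun h => huv (Fin.ext h) : (u : ℕ) ≠ v) with h | h
    · exact (wordGraph_adj_of_lt h).2 fun w h1 h2 => hu.2 w h1 (by omega)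
    · exact ((wordGraph_adj_of_lt h).2 fun w h1 h2 => hv.2 w h1 (by omega)).symm

/-- A word over `{0, …, k - 1}` that starts with `0, 1, …, k - 1, 0, 1, …, k - 1`. -/
structure IsDoubleStartingWord (k : ℕ) (c : ℕ → ℕ) : Prop extends IsStartingWord k c where
  repeats : ∀ i < k, c (k + i) = i

/-- The number of neighbours of `v` in `{0, …, j}`. -/
noncomputable def boundedDegree (c : ℕ → ℕ) (j v : ℕ) : ℕ :=
  by classical exact ((Finset.range (j + 1)).filter ((wordGraph c).Adj v)).card

lemma IsStartingWord.boundedDegree_self {k : ℕ} {c : ℕ → ℕ} (hc : IsStartingWord k c)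
    {j : ℕ} (hj : k ≤ j) : boundedDegree c j j = k := by
  classical
  rw [← hc.card_lastOccurrences hj, boundedDegree]
  congr 1
  ext u
  simp only [Finset.mem_filter, Finset.mem_range, wordGraph, mem_lastOccurrences]
  constructor
  · rintro ⟨h1, h2 | h2⟩
    · omega
    · exact h2
  · intro h
    exact ⟨by omega, Or.inr h⟩

lemma IsDoubleStartingWord.lt_boundedDegree {k : ℕ} {c : ℕ → ℕ}
    (hc : IsDoubleStartingWord k c) {j v : ℕ} (hkj : k + 1 ≤ j) (hv : 0 < v) (hvj : v < j) :
    k < boundedDegree c j v := by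
  classical
  rw [boundedDegree]
  rcases le_or_gt k v with hkv | hkv
  · have hsub : insert (v + 1) (lastOccurrences c v) ⊆
        (Finset.range (j + 1)).filter ((wordGraph c).Adj v) := by
      intro u hu
      rw [Finset.mem_insert] at hu
      rw [Finset.mem_filter, Finset.mem_range]
      rcases hu with rfl | hu
      · exact ⟨by omega, (wordGraph_adj_of_lt (by omega)).2 fun w _ _ => by omega⟩
      · exact ⟨by have := (mem_lastOccurrences.1 hu).1; omega, Or.inr hu⟩
    have := Finset.card_le_card hsub
    rw [Finset.card_insert_of_notMem (by simp [mem_lastOccurrences]),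
      hc.card_lastOccurrences hkv] at this
    omega
  · have hsub : (Finset.range (k + 2)).erase v ⊆
        (Finset.range (j + 1)).filter ((wordGraph c).Adj v) := by
      intro u hu
      rw [Finset.mem_erase, Finset.mem_range] at hu
      rw [Finset.mem_filter, Finset.mem_range]
      refine ⟨by omega, ?_⟩
      rcases lt_or_gt_of_ne hu.1 with h | h
      · refine ((wordGraph_adj_of_lt h).2 fun w h1 h2 => ?_).symm
        rw [hc.start w (by omega), hc.start u (by omega)]
        omega
      · refine (wordGraph_adj_of_lt h).2 fun w h1 h2 => ?_
        rw [hc.start v (by omega)]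
        rcases lt_or_ge w k with h3 | h3
        · rw [hc.start w h3]
          omega
        · have : w = k + 0 := by omega
          rw [this, hc.repeats 0 (by omega)]
          omega
    have := Finset.card_le_card hsub
    rw [Finset.card_erase_of_mem (by rw [Finset.mem_range]; omega), Finset.card_range] at this
    omega

lemma IsDoubleStartingWord.boundedDegree_zero {k : ℕ} {c : ℕ → ℕ}
    (hc : IsDoubleStartingWord k c) (hk : 0 < k) {j : ℕ} (hkj : k ≤ j) :
    boundedDegree c j 0 = k := by
  classical
  rw [boundedDegree]
  have : (Finset.range (j + 1)).filter ((wordGraph c).Adj 0) = Finset.Icc 1 k := by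
    ext u
    rw [Finset.mem_filter, Finset.mem_range, Finset.mem_Icc]
    rcases Nat.eq_zero_or_pos u with rfl | hu
    · simp
    rw [wordGraph_adj_of_lt hu, hc.start 0 hk]
    constructor
    · rintro ⟨h1, h2⟩
      refine ⟨hu, not_lt.1 fun h => h2 k hk h ?_⟩
      exact hc.repeats 0 hk
    · rintro ⟨h1, h2⟩
      refine ⟨by omega, fun w h3 h4 => ?_⟩
      rw [hc.start w (by omega)]
      omega
  rw [this, Nat.card_Icc]
  omega

section Rigidity

variable {n : ℕ} {c d : ℕ → ℕ} {σ : Equiv.Perm ℕ}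

lemma perm_le_iff_of_fixes_above {j : ℕ} (hσ : ∀ i, j < i → σ i = i) (x : ℕ) :
    σ x ≤ j ↔ x ≤ j := by
  rw [← not_lt, ← not_lt, not_iff_not]
  constructor
  · intro h
    have := σ.injective (hσ _ h)
    omega
  · intro h
    rwa [hσ x h]

lemma boundedDegree_perm (hadj : ∀ u < n, ∀ v < n,
      (wordGraph c).Adj u v ↔ (wordGraph d).Adj (σ u) (σ v))
    {j : ℕ} (hj : j < n) (hσ : ∀ i, j < i → σ i = i) {v : ℕ} (hv : v < n) :
    boundedDegree d j (σ v) = boundedDegree c j v := by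
  classical
  rw [boundedDegree, boundedDegree]
  refine Eq.trans ?_ (Finset.card_map σ.toEmbedding)
  congr 1
  ext x
  obtain ⟨y, rfl⟩ := σ.surjective x
  have := perm_le_iff_of_fixes_above hσ y
  rw [Finset.mem_map_equiv, Equiv.symm_apply_apply]
  simp only [Finset.mem_filter, Finset.mem_range, Nat.lt_succ_iff, this]
  exact and_congr_right fun h => (hadj v hv y (by omega)).symm

lemma perm_zero_eq {k : ℕ} (hk : 0 < k) (hc : IsDoubleStartingWord k c)
    (hd : IsDoubleStartingWord k d)
    (hadj : ∀ u < n, ∀ v < n, (wordGraph c).Adj u v ↔ (wordGraph d).Adj (σ u) (σ v))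
    (hσ : ∀ i, n ≤ i → σ i = i)
    (hn : k + 2 ≤ n) : σ 0 = 0 ∨ σ 0 = n - 1 := by
  have hσ' : ∀ i, n - 1 < i → σ i = i := fun i hi => hσ i (by omega)
  have h1 := boundedDegree_perm hadj (j := n - 1) (by omega) hσ' (v := 0) (by omega)
  rw [hc.boundedDegree_zero hk (by omega)] at h1
  have h2 := (perm_le_iff_of_fixes_above hσ' 0).2 (by omega)
  by_contra! h
  have := hd.lt_boundedDegree (j := n - 1) (v := σ 0) (by omega) (by omega) (by omega)
  omega

lemma perm_eq_of_lt {k : ℕ} (hc : IsDoubleStartingWord k c)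
    (hd : IsDoubleStartingWord k d)
    (hadj : ∀ u < n, ∀ v < n, (wordGraph c).Adj u v ↔ (wordGraph d).Adj (σ u) (σ v))
    (hσ : ∀ i, n ≤ i → σ i = i)
    (h0 : σ 0 = 0) : ∀ v, k < v → σ v = v := by
  have main : ∀ t, ∀ v, k < v → n ≤ v + t → σ v = v := by
    intro t
    induction t with
    | zero => exact fun v _ h => hσ v h
    | succ t ih =>
      intro v hkv hv
      rcases le_or_gt n v with h | hvn
      · exact hσ v h
      have hσ' : ∀ i, v < i → σ i = i := fun i hi => ih i (by omega) (by omega)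
      have h1 := boundedDegree_perm hadj hvn hσ' hvn
      rw [hc.boundedDegree_self hkv.le] at h1
      have h2 := (perm_le_iff_of_fixes_above hσ' v).2 le_rfl
      have h3 : σ v ≠ 0 := by
        rw [← h0, Ne, EmbeddingLike.apply_eq_iff_eq]
        omega
      by_contra h
      have := hd.lt_boundedDegree (j := v) (v := σ v) hkv (by omega) (by omega)
      omega
  exact fun v hv => main n v hv (by omega)

lemma perm_eq_self {k : ℕ} (hk : 0 < k) (hc : IsDoubleStartingWord k c)
    (hd : IsDoubleStartingWord k d)
    (hadj : ∀ u < n, ∀ v < n, (wordGraph c).Adj u v ↔ (wordGraph d).Adj (σ u) (σ v))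
    (hσ : ∀ i, n ≤ i → σ i = i)
    (hn : 2 * k + 1 ≤ n) (h0 : σ 0 = 0) : ∀ v, σ v = v := by
  have habove := perm_eq_of_lt hc hd hadj hσ h0
  have hbelow : ∀ v < k, σ v = v := by
    intro v hv
    rcases Nat.eq_zero_or_pos v with rfl | hv0
    · exact h0
    have hle := (perm_le_iff_of_fixes_above habove v).2 hv.le
    have hne : σ v ≠ 0 := by
      rw [← h0, Ne, EmbeddingLike.apply_eq_iff_eq]
      omega
    have h1 : (wordGraph d).Adj (σ v) (k + v) := by
      rw [← habove (k + v) (by omega), ← hadj v (by omega) (k + v) (by omega),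
        wordGraph_adj_of_lt (by omega)]
      intro w h1 h2
      rw [hc.start v hv]
      rcases lt_or_ge w k with h3 | h3
      · rw [hc.start w h3]
        omega
      · obtain ⟨i, rfl⟩ := Nat.exists_eq_add_of_le h3
        rw [hc.repeats i (by omega)]
        omega
    have h2 : ¬ (wordGraph d).Adj (σ v) (k + v + 1) := by
      rw [← habove (k + v + 1) (by omega), ← hadj v (by omega) (k + v + 1) (by omega),
        wordGraph_adj_of_lt (by omega)]
      intro h
      refine h (k + v) (by omega) (by omega) ?_
      rw [hc.repeats v hv, hc.start v hv]
    rw [wordGraph_adj_of_lt (by omega)] at h1 h2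
    push Not at h2
    obtain ⟨w, h3, h4, h5⟩ := h2
    have hw : w = k + v := by
      by_contra hw
      exact h1 w h3 (by omega) h5
    rw [hw, hd.repeats v hv] at h5
    rcases hle.eq_or_lt with h6 | h6
    · have := hd.repeats 0 hk
      rw [add_zero] at this
      rw [h6, this] at h5
      omega
    · rw [hd.start _ h6] at h5
      exact h5.symm
  intro v
  rcases lt_trichotomy v k with h | rfl | h
  · exact hbelow v h
  · have h1 := (perm_le_iff_of_fixes_above habove v).2 le_rfl
    by_contra h2
    exact h2 (σ.injective (hbelow (σ v) (by omega)))
  · exact habove v h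

lemma word_eq_of_perm_zero {k : ℕ} (hk : 0 < k) (hc : IsDoubleStartingWord k c)
    (hd : IsDoubleStartingWord k d)
    (hadj : ∀ u < n, ∀ v < n, (wordGraph c).Adj u v ↔ (wordGraph d).Adj (σ u) (σ v))
    (hσ : ∀ i, n ≤ i → σ i = i)
    (hn : 2 * k + 1 ≤ n) (h0 : σ 0 = 0) :
    ∀ v, v + 1 < n → c v = d v := by
  have hid := perm_eq_self hk hc hd hadj hσ hn h0
  simp only [hid] at hadj
  intro v
  induction v using Nat.strong_induction_on with
  | _ v ih =>
    intro hv
    rcases lt_or_ge v k with hvk | hvk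
    · rw [hc.start v hvk, hd.start v hvk]
    by_contra hne
    obtain ⟨u, hu, huv⟩ := hc.exists_mem_lastOccurrences hvk (hc.lt v)
    rw [mem_lastOccurrences] at hu
    have h1 : ¬ (wordGraph c).Adj u (v + 1) := by
      rw [wordGraph_adj_of_lt (by omega)]
      exact fun h => h v hu.1 (by omega) huv.symm
    rw [hadj u (by omega) _ hv, wordGraph_adj_of_lt (by omega)] at h1
    refine h1 fun w h2 h3 => ?_
    rw [← ih u hu.1 (by omega)]
    rcases Nat.lt_succ_iff_lt_or_eq.1 h3 with h4 | rfl
    · rw [← ih w h4 (by omega)]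
      exact hu.2 w h2 h4
    · rw [huv]
      exact Ne.symm hne

end Rigidity

lemma exists_perm_of_iso {n : ℕ} {c d : ℕ → ℕ}
    (φ : initialWordGraph c n ≃g initialWordGraph d n) :
    ∃ σ : Equiv.Perm ℕ, (∀ u : Fin n, σ u = φ u) ∧ (∀ i, n ≤ i → σ i = i) ∧
      ∀ u < n, ∀ v < n, (wordGraph c).Adj u v ↔ (wordGraph d).Adj (σ u) (σ v) := by
  let σ : Equiv.Perm ℕ := Equiv.Perm.extendDomain φ.toEquiv (Fin.equivSubtype (n := n))
  have h : ∀ u : Fin n, σ u = φ u := fun u =>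
    Equiv.Perm.extendDomain_apply_image φ.toEquiv (Fin.equivSubtype (n := n)) u
  refine ⟨σ, h, fun i hi => Equiv.Perm.extendDomain_apply_not_subtype _ _ (by omega), ?_⟩
  intro u hu v hv
  have h1 := h ⟨u, hu⟩
  have h2 := h ⟨v, hv⟩
  simp only at h1 h2
  rw [h1, h2]
  exact (φ.map_adj_iff (v := ⟨u, hu⟩) (w := ⟨v, hv⟩)).symm

lemma word_eq_of_iso {k n : ℕ} (hk : 0 < k) (hn : 2 * k + 1 ≤ n) {c d : ℕ → ℕ}
    (hc : IsDoubleStartingWord k c) (hd : IsDoubleStartingWord k d)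
    (φ : initialWordGraph c n ≃g initialWordGraph d n)
    (h0 : (φ ⟨0, by omega⟩ : ℕ) = 0) (v : ℕ) (hv : v + 1 < n) : c v = d v := by
  obtain ⟨σ, h1, h2, h3⟩ := exists_perm_of_iso φ
  exact word_eq_of_perm_zero hk hc hd h3 h2 hn ((h1 ⟨0, by omega⟩).trans h0) v hv

lemma iso_zero_eq {k n : ℕ} (hk : 0 < k) (hn : k + 2 ≤ n) {c d : ℕ → ℕ}
    (hc : IsDoubleStartingWord k c) (hd : IsDoubleStartingWord k d)
    (φ : initialWordGraph c n ≃g initialWordGraph d n) :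
    (φ ⟨0, by omega⟩ : ℕ) = 0 ∨ (φ ⟨0, by omega⟩ : ℕ) = n - 1 := by
  obtain ⟨σ, h1, h2, h3⟩ := exists_perm_of_iso φ
  rw [← h1 ⟨0, by omega⟩]
  exact perm_zero_eq hk hc hd h3 h2 hn

/-- The word `0, …, k - 1, 0, …, k - 1` followed by the letters of `x` and then by zeros. -/
def extendWord {k m : ℕ} (x : Fin m → Fin k) (v : ℕ) : ℕ :=
  if v < 2 * k then v % k else if h : v - 2 * k < m then x ⟨v - 2 * k, h⟩ else 0

lemma isDoubleStartingWord_extendWord {k m : ℕ} (hk : 0 < k) (x : Fin m → Fin k) :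
    IsDoubleStartingWord k (extendWord x) where
  lt v := by
    unfold extendWord
    split_ifs
    · exact Nat.mod_lt _ hk
    · exact Fin.is_lt _
    · exact hk
  start i hi := by
    rw [extendWord, if_pos (by omega), Nat.mod_eq_of_lt hi]
  repeats i hi := by
    rw [extendWord, if_pos (by omega), Nat.add_mod_left, Nat.mod_eq_of_lt hi]

lemma extendWord_apply {k m : ℕ} (x : Fin m → Fin k) (i : Fin m) :
    extendWord x (2 * k + i) = x i := by
  rw [extendWord, if_neg (by omega), dif_pos (by omega)]
  congr 2
  ext
  simp

lemma eq_of_extendWord_eq {k m n : ℕ} (hm : 2 * k + m + 1 ≤ n) {x y : Fin m → Fin k}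
    (h : ∀ v, v + 1 < n → extendWord x v = extendWord y v) : x = y := by
  funext i
  apply Fin.ext
  rw [← extendWord_apply x i, ← extendWord_apply y i]
  exact h _ (by omega)

lemma exists_eq_of_three_iso {k m n : ℕ} (hk : 0 < k) (hn : k + 2 ≤ n) (hm : 2 * k + m + 1 ≤ n)
    {x y z : Fin m → Fin k}
    (φ : initialWordGraph (extendWord x) n ≃g initialWordGraph (extendWord y) n)
    (ψ : initialWordGraph (extendWord x) n ≃g initialWordGraph (extendWord z) n) :
    x = y ∨ x = z ∨ y = z := by
  have hx := isDoubleStartingWord_extendWord hk x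
  have hy := isDoubleStartingWord_extendWord hk y
  have hz := isDoubleStartingWord_extendWord hk z
  rcases iso_zero_eq hk hn hx hy φ with h1 | h1
  · exact Or.inl (eq_of_extendWord_eq hm (word_eq_of_iso hk (by omega) hx hy φ h1))
  rcases iso_zero_eq hk hn hx hz ψ with h2 | h2
  · exact Or.inr (Or.inl (eq_of_extendWord_eq hm (word_eq_of_iso hk (by omega) hx hz ψ h2)))
  have h3 : (φ.symm.trans ψ) (φ ⟨0, by omega⟩) = φ ⟨0, by omega⟩ := by
    apply Fin.ext
    simp [h1, h2]
  rcases iso_zero_eq hk hn hy hz (φ.symm.trans ψ) with h4 | h4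
  · exact Or.inr (Or.inr (eq_of_extendWord_eq hm
      (word_eq_of_iso hk (by omega) hy hz (φ.symm.trans ψ) h4)))
  · have h5 : (φ.symm.trans ψ) ⟨0, by omega⟩ = (φ.symm.trans ψ) (φ ⟨0, by omega⟩) := by
      apply Fin.ext
      rw [h3, h4, h1]
    have h6 := congrArg Fin.val ((φ.symm.trans ψ).injective h5)
    rw [h1] at h6
    simp only at h6
    omega

/-- For `k ≥ 2` and `n ≥ k + 4`, the number of isomorphism classes of
`n`-vertex simple `k`-paths is at least `k^(n − 2k − 2)`. -/
theorem statement14 (k n : ℕ) (hk : 2 ≤ k) (hn : k + 4 ≤ n) :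
    k ^ (n - 2 * k - 2) ≤ numSimpleKPaths k n := by
  classical
  have hpath {m : ℕ} (x : Fin m → Fin k) :
      IsSimpleKPath k (initialWordGraph (extendWord x) n) :=
    (isDoubleStartingWord_extendWord (by omega) x).isSimpleKPath (by omega)
  let r : {G : SimpleGraph (Fin n) // IsSimpleKPath k G} →
      {G : SimpleGraph (Fin n) // IsSimpleKPath k G} → Prop :=
    fun G H => Nonempty (G.val ≃g H.val)
  have hr : Equivalence r :=
    ⟨fun _ => ⟨Iso.refl⟩, fun ⟨φ⟩ => ⟨φ.symm⟩, fun ⟨φ⟩ ⟨ψ⟩ => ⟨φ.trans ψ⟩⟩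
  change _ ≤ Nat.card (Quot r)
  let f (m : ℕ) (x : Fin m → Fin k) : Quot r := Quot.mk r ⟨_, hpath x⟩
  have hf {m : ℕ} {x y : Fin m → Fin k} (h : f m x = f m y) :
      Nonempty (initialWordGraph (extendWord x) n ≃g initialWordGraph (extendWord y) n) :=
    hr.eqvGen_iff.1 (Quot.eqvGen_exact h)
  have : Fintype (Quot r) := Fintype.ofFinite _
  rcases le_or_gt n (2 * k + 2) with hn' | hn'
  · rw [show n - 2 * k - 2 = 0 by omega, pow_zero]
    have : Nonempty (Quot r) := ⟨f 0 Fin.elim0⟩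
    exact Nat.card_pos
  obtain ⟨m, rfl⟩ : ∃ m, n = 2 * k + 2 + m := ⟨n - (2 * k + 2), by omega⟩
  rw [show 2 * k + 2 + m - 2 * k - 2 = m by omega, Nat.card_eq_fintype_card]
  have hfib : ∀ q ∈ (Finset.univ : Finset (Quot r)),
      ((Finset.univ : Finset (Fin (m + 1) → Fin k)).filter fun x => f (m + 1) x = q).card ≤ 2 := by
    intro q _
    by_contra! h
    obtain ⟨x, y, z, hx, hy, hz, hxy, hxz, hyz⟩ := Finset.two_lt_card_iff.1 h
    simp only [Finset.mem_filter, Finset.mem_univ, true_and] at hx hy hz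
    obtain ⟨φ⟩ := hf (hx.trans hy.symm)
    obtain ⟨ψ⟩ := hf (hx.trans hz.symm)
    rcases exists_eq_of_three_iso (by omega) (by omega) (by omega) φ ψ with h | h | h
    exacts [hxy h, hxz h, hyz h]
  have hcard := Finset.card_le_mul_card_image_of_maps_to
    (fun x _ => Finset.mem_univ (f (m + 1) x)) 2 hfib
  rw [Finset.card_univ, Finset.card_univ, Fintype.card_fun, Fintype.card_fin,
    Fintype.card_fin, pow_succ] at hcard
  have := Nat.mul_le_mul_left (k ^ m) hk
  omega
end

section
/- Let k ≥ 2 and n ≥ k+4 be integers, and let 𝒮 be a set of pairwise non-isomorphic n-vertex simple k-paths. If U is a finite simple graph of treewidth at most k that contains every graph of 𝒮 as a subgraph, then |V(U)|² ≥ |𝒮|. -/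
open SimpleGraph

namespace SimpleGraph

variable {V W : Type*}

/-- In a tree, the path from `r` to a point of a connected set enters the set at its point closest
to `r` and stays inside afterwards. -/
lemma Connected.exists_isPath_append_of_dist_le {T : SimpleGraph V} (hT : T.Connected) {F : Set V}
    (hF : (T.induce F).Connected) (r : V) {c z : V} (hc : c ∈ F)
    (hmin : ∀ w ∈ F, T.dist r c ≤ T.dist r w) (hz : z ∈ F) :
    ∃ (p : T.Walk r c) (q : T.Walk c z), p.length = T.dist r c ∧ (∀ w ∈ q.support, w ∈ F) ∧
      (p.append q).IsPath := by
  classical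
  obtain ⟨p, hp, hpl⟩ := hT.exists_path_of_dist r c
  obtain ⟨q', hq'⟩ := (hF.preconnected ⟨c, hc⟩ ⟨z, hz⟩).exists_isPath
  let q : T.Walk c z := q'.map (Embedding.induce F).toHom
  have hq : q.IsPath := hq'.map (Embedding.induce (G := T) F).injective
  have hqF : ∀ w ∈ q.support, w ∈ F := by
    intro w hw
    have hw' : w ∈ q'.support.map (Embedding.induce (G := T) F).toHom := by
      rw [← Walk.support_map]; exact hw
    obtain ⟨x, -, rfl⟩ := List.mem_map.1 hw'
    exact x.2
  refine ⟨p, q, hpl, hqF, ?_⟩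
  rw [Walk.isPath_def, Walk.support_append, List.nodup_append']
  refine ⟨hp.support_nodup, hq.support_nodup.tail, ?_⟩
  intro w hwp hwq
  have hwc : w = c := by
    by_contra hne
    have h1 := Walk.length_takeUntil_lt_length hwp hne
    have h2 := dist_le (p.takeUntil w hwp)
    have h3 := hmin w (hqF w (List.mem_of_mem_tail hwq))
    omega
  subst hwc
  have := hq.support_nodup
  rw [← Walk.cons_tail_support] at this
  exact (List.nodup_cons.1 this).1 hwq

/-- The Helly property of subtrees of a tree. -/
lemma IsTree.exists_mem_of_pairwise_inter {T : SimpleGraph V} (hT : T.IsTree) {J : Type*}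
    [Finite J] [Nonempty J] {F : J → Set V} (hF : ∀ j, (T.induce (F j)).Connected)
    (hp : ∀ i j, (F i ∩ F j).Nonempty) : ∃ t, ∀ j, t ∈ F j := by
  classical
  obtain ⟨r⟩ := hT.connected.nonempty
  have hmin : ∀ j, ∃ c ∈ F j, ∀ w ∈ F j, T.dist r c ≤ T.dist r w := by
    intro j
    obtain ⟨⟨x, hx⟩⟩ := (hF j).nonempty
    have hne : (F j).Nonempty := ⟨x, hx⟩
    exact ⟨Function.argminOn (T.dist r) (F j) hne, Function.argminOn_mem _ _ _,
      fun w hw => Function.argminOn_le _ _ hw⟩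
  choose c hcF hcmin using hmin
  obtain ⟨i, hi⟩ := Finite.exists_max (fun j => T.dist r (c j))
  refine ⟨c i, fun j => ?_⟩
  obtain ⟨z, hzi, hzj⟩ := hp i j
  obtain ⟨p, q, -, -, hpq⟩ :=
    hT.connected.exists_isPath_append_of_dist_le (hF i) r (hcF i) (hcmin i) hzi
  obtain ⟨p', q', hpl', hqF', hpq'⟩ :=
    hT.connected.exists_isPath_append_of_dist_le (hF j) r (hcF j) (hcmin j) hzj
  have heq := (hT.existsUnique_path r z).unique hpq hpq'
  have hmem : c i ∈ (p'.append q').support := by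
    rw [← heq, Walk.mem_support_append_iff]
    exact Or.inl p.end_mem_support
  rw [Walk.mem_support_append_iff] at hmem
  rcases hmem with h | h
  · by_cases hij : c i = c j
    · rw [hij]; exact hcF j
    · have h1 := Walk.length_takeUntil_lt_length h hij
      have h2 := dist_le (p'.takeUntil _ h)
      have h3 := hi j
      omega
  · exact hqF' _ h

/-- In a tree-decomposition, the nodes whose bags meet a walk form a subtree. -/
lemma Walk.connected_induce_iUnion_bags {U : SimpleGraph V} {T : SimpleGraph W} {B : W → Set V}
    (hadj : ∀ u v, U.Adj u v → ∃ t, u ∈ B t ∧ v ∈ B t)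
    (hconn : ∀ v, (T.induce {t | v ∈ B t}).Connected) {u v : V} (p : U.Walk u v) :
    (T.induce {t | ∃ w ∈ p.support, w ∈ B t}).Connected := by
  induction p with
  | @nil u =>
    have : {t | ∃ x ∈ (Walk.nil : U.Walk u u).support, x ∈ B t} = {t | u ∈ B t} := by
      ext t; simp
    rw [this]
    exact hconn u
  | @cons u v w h p ih =>
    have : {t | ∃ x ∈ (Walk.cons h p).support, x ∈ B t} =
        {t | u ∈ B t} ∪ {t | ∃ x ∈ p.support, x ∈ B t} := by
      ext t; simp
    rw [this]
    refine induce_union_connected (hconn u).preconnected ih.preconnected ?_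
    obtain ⟨t, ht1, ht2⟩ := hadj _ _ h
    exact ⟨t, ht1, v, p.start_mem_support, ht2⟩

/-- In a graph of treewidth at most `k`, two vertices `x`, `y` that each form a `(k + 1)`-clique
with a common `k`-clique `A` are separated by `A`. -/
lemma exists_mem_support_of_hasTreewidthAtMost [Finite V] {U : SimpleGraph V} {k : ℕ}
    (hU : HasTreewidthAtMost U k) {A : Finset V} (hA : A.card = k) (hcl : U.IsClique (A : Set V))
    {x y : V} (hxy : x ≠ y) (hx : ∀ a ∈ A, U.Adj x a) (hy : ∀ a ∈ A, U.Adj y a)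
    (p : U.Walk x y) : ∃ a ∈ A, a ∈ p.support := by
  classical
  by_contra! hav
  obtain ⟨ι, -, T, B, hT, hcov, hadj, hconn, hcard⟩ := hU
  have hav' : ∀ a ∈ A, a ∉ p.toPath.1.support := fun a ha h =>
    hav a ha (p.support_toPath_subset_support h)
  obtain ⟨⟨q, hq⟩, hqA⟩ : ∃ q : U.Path x y, ∀ a ∈ A, a ∉ q.1.support := ⟨p.toPath, hav'⟩
  cases q with
  | nil => exact hxy rfl
  | @cons _ c _ h q =>
  rw [Walk.cons_isPath_iff] at hq
  let F : Option {a // a ∈ insert x A} → Set ι := fun o =>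
    o.elim {t | ∃ w ∈ q.support, w ∈ B t} (fun a => {t | a.1 ∈ B t})
  have hF : ∀ o, (T.induce (F o)).Connected := by
    rintro (_ | a)
    · exact q.connected_induce_iUnion_bags hadj hconn
    · exact hconn _
  have hsn : ∀ a ∈ insert x A, (F none ∩ {t | a ∈ B t}).Nonempty := by
    intro a ha
    rcases Finset.mem_insert.1 ha with rfl | ha
    · obtain ⟨t, h1, h2⟩ := hadj _ _ h
      exact ⟨t, ⟨c, q.start_mem_support, h2⟩, h1⟩
    · obtain ⟨t, h1, h2⟩ := hadj _ _ (hy a ha)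
      exact ⟨t, ⟨y, q.end_mem_support, h1⟩, h2⟩
  have hss : ∀ a ∈ insert x A, ∀ b ∈ insert x A, ({t | a ∈ B t} ∩ {t | b ∈ B t}).Nonempty := by
    intro a ha b hb
    by_cases hab : a = b
    · subst hab
      obtain ⟨t, ht⟩ := hcov a
      exact ⟨t, ht, ht⟩
    · refine hadj a b ?_
      rcases Finset.mem_insert.1 ha with hax | ha' <;>
        rcases Finset.mem_insert.1 hb with hbx | hb'
      · exact absurd (hax.trans hbx.symm) hab
      · exact hax ▸ hx _ hb'
      · exact hbx ▸ (hx _ ha').symm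
      · exact hcl ha' hb' hab
  obtain ⟨t, ht⟩ := hT.exists_mem_of_pairwise_inter hF (by
    rintro (_ | a) (_ | b)
    · obtain ⟨t, h1, -⟩ := hsn x (Finset.mem_insert_self _ _)
      exact ⟨t, h1, h1⟩
    · exact hsn b b.2
    · rw [Set.inter_comm]; exact hsn a a.2
    · exact hss a a.2 b b.2)
  obtain ⟨w, hwq, hwB⟩ := ht none
  have hxA : x ∉ A := fun hxA => (hx x hxA).ne rfl
  have hwA : w ∉ insert x A := by
    intro hw
    rcases Finset.mem_insert.1 hw with rfl | hw
    · exact hq.2 hwq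
    · exact hqA w hw (by simp [hwq])
  have hsub : ((insert w (insert x A) : Finset V) : Set V) ⊆ B t := by
    intro a ha
    rcases Finset.mem_insert.1 (Finset.mem_coe.1 ha) with rfl | ha
    · exact hwB
    · exact ht (some ⟨a, ha⟩)
  have h1 := Set.ncard_le_ncard hsub (Set.toFinite _)
  rw [Set.ncard_coe_finset, Finset.card_insert_of_notMem hwA, Finset.card_insert_of_notMem hxA]
    at h1
  have := hcard t
  omega

/-- `(L, R)` is a separation of `U` whose two sides overlap only in `A`. -/
structure IsSeparation (U : SimpleGraph V) (A L R : Set V) : Prop where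
  cover : ∀ v, v ∈ L ∨ v ∈ R
  inter : L ∩ R ⊆ A
  not_adj : ∀ u v, u ∉ R → v ∉ L → ¬ U.Adj u v

lemma IsSeparation.symm {U : SimpleGraph V} {A L R : Set V} (h : U.IsSeparation A L R) :
    U.IsSeparation A R L where
  cover v := (h.cover v).symm
  inter := by rw [Set.inter_comm]; exact h.inter
  not_adj u v hu hv huv := h.not_adj v u hv hu huv.symm

lemma IsSeparation.clique_subset {U : SimpleGraph V} {A L R K : Set V}
    (h : U.IsSeparation A L R) (hK : U.IsClique K) {w : V} (hw : w ∈ K) (hwR : w ∉ R) :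
    K ⊆ L := by
  intro v hv
  by_contra hvL
  have hne : w ≠ v := by
    rintro rfl
    exact (h.cover w).elim hvL hwR
  exact h.not_adj w v hwR hvL (hK hw hv hne)

/-- Two `(k + 1)`-cliques sharing `k` vertices in a graph of treewidth at most `k` are separated by
their intersection. -/
lemma exists_isSeparation [Finite V] [DecidableEq V] {U : SimpleGraph V} {k : ℕ}
    (hU : HasTreewidthAtMost U k) {X Y : Finset V} (hX : U.IsClique (X : Set V))
    (hY : U.IsClique (Y : Set V)) (hXc : X.card = k + 1) (hYc : Y.card = k + 1)
    (hXY : (X ∩ Y).card = k) :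
    ∃ L R : Set V, U.IsSeparation ↑(X ∩ Y) L R ∧ (X : Set V) ⊆ L ∧ (Y : Set V) ⊆ R := by
  obtain ⟨x, hxX, hxA⟩ := Finset.exists_mem_notMem_of_card_lt_card (s := X ∩ Y) (t := X) (by omega)
  obtain ⟨y, hyY, hyA⟩ := Finset.exists_mem_notMem_of_card_lt_card (s := X ∩ Y) (t := Y) (by omega)
  set A := X ∩ Y with hA
  have hAX : A ⊆ X := Finset.inter_subset_left
  have hAY : A ⊆ Y := Finset.inter_subset_right
  have adj : ∀ {K : Finset V}, U.IsClique (K : Set V) → A ⊆ K → ∀ {z}, z ∈ K → z ∉ A →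
      ∀ a ∈ A, U.Adj z a := by
    intro K hK hAK z hz hzA a ha
    exact hK hz (hAK ha) (by rintro rfl; exact hzA ha)
  have hxy : x ≠ y := by
    rintro rfl
    exact hxA (Finset.mem_inter.2 ⟨hxX, hyY⟩)
  let C : Set V := {v | ∃ p : U.Walk x v, ∀ a ∈ A, a ∉ p.support}
  have hxC : x ∈ C := ⟨Walk.nil, fun a ha => by
    rw [Walk.support_nil, List.mem_singleton]
    rintro rfl
    exact hxA ha⟩
  have hyC : y ∉ C := by
    rintro ⟨p, hp⟩
    obtain ⟨a, ha, hap⟩ := exists_mem_support_of_hasTreewidthAtMost hU hXY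
      (hX.subset (Finset.coe_subset.2 hAX)) hxy (adj hX hAX hxX hxA) (adj hY hAY hyY hyA) p
    exact hp a ha hap
  have hCA : ∀ v ∈ C, v ∉ A := by
    rintro v ⟨p, hp⟩ hv
    exact hp v hv p.end_mem_support
  have hsep : U.IsSeparation (A : Set V) (A ∪ C) Cᶜ := by
    refine ⟨fun v => ?_, ?_, ?_⟩
    · by_cases hv : v ∈ C
      · exact Or.inl (Or.inr hv)
      · exact Or.inr hv
    · rintro v ⟨hv | hv, hv'⟩
      · exact hv
      · exact absurd hv hv'
    · intro u v hu hv huv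
      rw [Set.mem_compl_iff, not_not] at hu
      obtain ⟨p, hp⟩ := hu
      refine hv (Or.inr ⟨p.concat huv, fun a ha => ?_⟩)
      rw [Walk.support_concat, List.mem_append, List.mem_singleton]
      rintro (h | rfl)
      · exact hp a ha h
      · exact hv (Or.inl ha)
  exact ⟨_, _, hsep, hsep.clique_subset hX hxX (fun h => h hxC),
    hsep.symm.clique_subset hY hyY
      (fun h => h.elim (fun h => hyA h) hyC)⟩

/-- The bags `X 0, …, X m` form the clique path of a simple `k`-path with end vertices `a` and `b`
contained in `U`. -/
structure IsSimpleCliquePath [DecidableEq V] (U : SimpleGraph V) (k m : ℕ) (X : ℕ → Finset V)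
    (a b : V) : Prop where
  pos : 0 < m
  card : ∀ i ≤ m, (X i).card = k + 1
  clique : ∀ i ≤ m, U.IsClique (X i : Set V)
  card_inter : ∀ i < m, (X i ∩ X (i + 1)).card = k
  inter_ne : ∀ i < m, ∀ j < m, i ≠ j → X i ∩ X (i + 1) ≠ X j ∩ X (j + 1)
  left_mem : a ∈ X 0
  left_notMem : ∀ i, 0 < i → i ≤ m → a ∉ X i
  right_mem : b ∈ X m
  right_notMem : ∀ i < m, b ∉ X i

namespace IsSimpleCliquePath

variable [DecidableEq V] {U : SimpleGraph V} {k m m' : ℕ} {X X' : ℕ → Finset V} {a b : V}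

lemma exists_isSeparation [Finite V] (h : U.IsSimpleCliquePath k m X a b)
    (hU : HasTreewidthAtMost U k) {i : ℕ} (hi : i < m) :
    ∃ L R : Set V, U.IsSeparation ↑(X i ∩ X (i + 1)) L R ∧ (∀ j ≤ i, (X j : Set V) ⊆ L) ∧
      ∀ j, i < j → j ≤ m → (X j : Set V) ⊆ R := by
  obtain ⟨L, R, hs, hL, hR⟩ := SimpleGraph.exists_isSeparation hU (h.clique i hi.le)
    (h.clique (i + 1) hi) (h.card i hi.le) (h.card (i + 1) hi) (h.card_inter i hi)
  have key : ∀ j < m, j ≠ i → ∃ w ∈ X j, w ∈ X (j + 1) ∧ w ∉ (X i ∩ X (i + 1)) := by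
    intro j hj hji
    by_contra! hc
    refine h.inter_ne j hj i hi hji (Finset.eq_of_subset_of_card_le ?_ ?_)
    · intro w hw
      rw [Finset.mem_inter] at hw
      exact hc w hw.1 hw.2
    · rw [h.card_inter j hj, h.card_inter i hi]
  refine ⟨L, R, hs, ?_, ?_⟩
  · suffices H : ∀ d j, j + d = i → (X j : Set V) ⊆ L from fun j hj => H (i - j) j (by omega)
    intro d
    induction d with
    | zero => rintro j rfl; exact hL
    | succ d ih =>
      intro j hj
      obtain ⟨w, hw, hw', hwA⟩ := key j (by omega) (by omega)
      exact hs.clique_subset (h.clique j (by omega)) hw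
        fun hwR => hwA (hs.inter ⟨ih (j + 1) (by omega) hw', hwR⟩)
  · intro j hj
    induction j, hj using Nat.le_induction with
    | base => exact fun _ => hR
    | succ j hj ih =>
      intro hjm
      obtain ⟨w, hw, hw', hwA⟩ := key j (by omega) (by omega)
      exact hs.symm.clique_subset (h.clique (j + 1) hjm) hw'
        fun hwL => hwA (hs.inter ⟨hwL, ih (by omega) hw⟩)

lemma exists_inter_eq [Finite V] (h : U.IsSimpleCliquePath k m X a b)
    (h' : U.IsSimpleCliquePath k m' X' a b) (hU : HasTreewidthAtMost U k) {i : ℕ} (hi : i < m) :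
    ∃ j < m', X' j ∩ X' (j + 1) = X i ∩ X (i + 1) := by
  obtain ⟨L, R, hs, hL, hR⟩ := h.exists_isSeparation hU hi
  have haR : a ∉ R := fun haR => h.left_notMem (i + 1) (by omega) hi
    (Finset.mem_inter.1 (hs.inter ⟨hL 0 (by omega) h.left_mem, haR⟩)).2
  have hbL : b ∉ L := fun hbL => h.right_notMem i hi
    (Finset.mem_inter.1 (hs.inter ⟨hbL, hR m hi le_rfl h.right_mem⟩)).1
  obtain ⟨j, hj, hjL, hjR⟩ : ∃ j < m', (X' j : Set V) ⊆ L ∧ ¬ (X' (j + 1) : Set V) ⊆ L := by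
    by_contra! hc
    have : ∀ j ≤ m', (X' j : Set V) ⊆ L := by
      intro j
      induction j with
      | zero => exact fun _ => hs.clique_subset (h'.clique 0 (by omega)) h'.left_mem haR
      | succ j ih => exact fun hj => hc j hj (ih (by omega))
    exact hbL (this m' le_rfl h'.right_mem)
  obtain ⟨w, hw, hwL⟩ := Set.not_subset.1 hjR
  have hjR' := hs.symm.clique_subset (h'.clique (j + 1) hj) hw hwL
  refine ⟨j, hj, Finset.eq_of_subset_of_card_le ?_ ?_⟩
  · intro v hv
    rw [Finset.mem_inter] at hv
    exact hs.inter ⟨hjL hv.1, hjR' hv.2⟩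
  · rw [h.card_inter i hi, h'.card_inter j hj]

lemma eq_end_or_mem_inter (h : U.IsSimpleCliquePath k m X a b) {i : ℕ} (hi : i ≤ m) {v : V}
    (hv : v ∈ X i) : v = a ∨ v = b ∨ ∃ j < m, v ∈ X j ∩ X (j + 1) := by
  by_contra! ⟨hva, hvb, hc⟩
  have key : ∀ j < m, X j ∩ X (j + 1) ⊆ X i → X j ∩ X (j + 1) = (X i).erase v := by
    intro j hj hsub
    refine Finset.eq_of_subset_of_card_le (Finset.subset_erase.2 ⟨hsub, hc j hj⟩) ?_
    rw [Finset.card_erase_of_mem hv, h.card i hi, h.card_inter j hj, Nat.add_sub_cancel]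
  rcases Nat.eq_zero_or_pos i with rfl | hi0
  · have : a ∈ (X 0).erase v := Finset.mem_erase.2 ⟨hva.symm, h.left_mem⟩
    rw [← key 0 h.pos Finset.inter_subset_left] at this
    exact h.left_notMem 1 (by omega) h.pos (Finset.mem_inter.1 this).2
  obtain ⟨j, rfl⟩ : ∃ j, i = j + 1 := ⟨i - 1, by omega⟩
  have h1 := key j hi Finset.inter_subset_right
  rcases hi.eq_or_lt with rfl | hi
  · have : b ∈ (X (j + 1)).erase v := Finset.mem_erase.2 ⟨hvb.symm, h.right_mem⟩
    rw [← h1] at this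
    exact h.right_notMem j (by omega) (Finset.mem_inter.1 this).1
  · exact h.inter_ne j (by omega) (j + 1) hi (by omega)
      (h1.trans (key (j + 1) hi Finset.inter_subset_left).symm)

lemma exists_mem_of_mem [Finite V] (h : U.IsSimpleCliquePath k m X a b)
    (h' : U.IsSimpleCliquePath k m' X' a b) (hU : HasTreewidthAtMost U k) {v : V}
    (hv : ∃ i ≤ m, v ∈ X i) : ∃ i ≤ m', v ∈ X' i := by
  obtain ⟨i, hi, hv⟩ := hv
  obtain rfl | rfl | ⟨j, hj, hvj⟩ := h.eq_end_or_mem_inter hi hv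
  · exact ⟨0, by omega, h'.left_mem⟩
  · exact ⟨m', le_rfl, h'.right_mem⟩
  · obtain ⟨l, hl, heq⟩ := h.exists_inter_eq h' hU hj
    rw [← heq] at hvj
    exact ⟨l, hl.le, (Finset.mem_inter.1 hvj).1⟩

lemma exists_mem_mem_of_adj [Finite V] (h : U.IsSimpleCliquePath k m X a b)
    (hU : HasTreewidthAtMost U k) {u v : V} (hu : ∃ i ≤ m, u ∈ X i) (hv : ∃ i ≤ m, v ∈ X i)
    (huv : U.Adj u v) : ∃ i ≤ m, u ∈ X i ∧ v ∈ X i := by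
  obtain ⟨p, hp, hup⟩ := hu
  obtain ⟨q, hq, hvq⟩ := hv
  wlog hpq : p ≤ q generalizing u v p q
  · obtain ⟨i, hi, h1, h2⟩ := this huv.symm q hq hvq p hp hup (by omega)
    exact ⟨i, hi, h2, h1⟩
  by_contra! hc
  obtain ⟨i, hi, hui, hui'⟩ : ∃ i < q, u ∈ X i ∧ u ∉ X (i + 1) := by
    by_contra! hc'
    have : ∀ j, p ≤ j → j ≤ q → u ∈ X j := by
      intro j hj
      induction j, hj using Nat.le_induction with
      | base => exact fun _ => hup
      | succ j hj ih => exact fun hjq => hc' j hjq (ih (by omega))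
    exact hc q hq (this q hpq le_rfl) hvq
  obtain ⟨L, R, hs, hL, hR⟩ := h.exists_isSeparation hU (i := i) (by omega)
  refine hs.not_adj u v (fun huR => hui' ?_) (fun hvL => hc i (by omega) hui ?_) huv
  · exact (Finset.mem_inter.1 (hs.inter ⟨hL i le_rfl hui, huR⟩)).2
  · exact (Finset.mem_inter.1 (hs.inter ⟨hvL, hR q hi hq hvq⟩)).1

end IsSimpleCliquePath

/-- The bags of a simple `k`-path with at least two bags, as seen inside a graph containing it. -/
lemma IsSimpleKPath.exists_isSimpleCliquePath [Fintype V] [DecidableEq V] [DecidableEq W]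
    {k : ℕ} {G : SimpleGraph V} (hG : IsSimpleKPath k G) (hcard : k + 2 ≤ Fintype.card V)
    {U : SimpleGraph W} {f : V → W} (hf : Function.Injective f)
    (hfU : ∀ u v, G.Adj u v → U.Adj (f u) (f v)) :
    ∃ (m : ℕ) (X : ℕ → Finset W) (a b : W), U.IsSimpleCliquePath k m X a b ∧
      (∀ w, (∃ i ≤ m, w ∈ X i) ↔ w ∈ Set.range f) ∧
      ∀ i ≤ m, ∀ u v, f u ∈ X i → f v ∈ X i → u ≠ v → G.Adj u v := by
  obtain ⟨m, X, -, hcov, hint, hXc, hXi, hXne, hXcl⟩ := hG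
  let Z : ℕ → Finset V := fun i => X ⟨min i m, by omega⟩
  have hZ : ∀ i (hi : i ≤ m), Z i = X ⟨i, by omega⟩ := fun i hi => by simp [Z, hi]
  have hZi : ∀ i (hi : i < m), Z i ∩ Z (i + 1) =
      X (Fin.castSucc ⟨i, hi⟩) ∩ X (Fin.succ ⟨i, hi⟩) := by
    intro i hi
    rw [hZ i hi.le, hZ (i + 1) hi]
    rfl
  have hZint : ∀ v i j l, i ≤ j → j ≤ l → l ≤ m → v ∈ Z i → v ∈ Z l → v ∈ Z j := by
    intro v i j l hij hjl hl hvi hvl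
    rw [hZ _ (by omega)] at hvi hvl ⊢
    exact hint v ⟨i, by omega⟩ ⟨j, by omega⟩ ⟨l, by omega⟩ hij hjl hvi hvl
  have hm : 0 < m := by
    by_contra! hm
    obtain rfl : m = 0 := by omega
    have : (Finset.univ : Finset V) ⊆ X 0 := by
      intro v _
      obtain ⟨i, hi⟩ := hcov v
      rwa [show i = 0 from Fin.ext (by simp)] at hi
    have := Finset.card_le_card this
    rw [hXc, Finset.card_univ] at this
    omega
  have hZc : ∀ i, (Z i).card = k + 1 := fun i => hXc _
  have hZic : ∀ i < m, (Z i ∩ Z (i + 1)).card = k := fun i hi => by rw [hZi i hi]; exact hXi _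
  obtain ⟨a, ha, ha'⟩ := Finset.exists_mem_notMem_of_card_lt_card (s := Z 0 ∩ Z 1) (t := Z 0)
    (by rw [hZc, hZic 0 hm]; omega)
  obtain ⟨b, hb, hb'⟩ := Finset.exists_mem_notMem_of_card_lt_card (s := Z (m - 1) ∩ Z m)
    (t := Z m) (by
      have := hZic (m - 1) (by omega)
      rw [Nat.sub_add_cancel hm] at this
      rw [hZc, this]; omega)
  have hmem : ∀ i v, f v ∈ (Z i).map ⟨f, hf⟩ ↔ v ∈ Z i := fun i v =>
    Finset.mem_map' (⟨f, hf⟩ : V ↪ W)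
  refine ⟨m, fun i => (Z i).map ⟨f, hf⟩, f a, f b, ?_, ?_, ?_⟩
  · refine ⟨hm, fun i _ => by rw [Finset.card_map, hZc], ?_, ?_, ?_, (hmem _ _).2 ha, ?_,
      (hmem _ _).2 hb, ?_⟩
    · intro i _ x hx y hy hxy
      obtain ⟨u, hu, rfl⟩ := Finset.mem_map.1 (Finset.mem_coe.1 hx)
      obtain ⟨v, hv, rfl⟩ := Finset.mem_map.1 (Finset.mem_coe.1 hy)
      exact hfU _ _ (hXcl _ u hu v hv (by rintro rfl; exact hxy rfl))
    · intro i hi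
      rw [← Finset.map_inter, Finset.card_map, hZic i hi]
    · intro i hi j hj hij
      rw [← Finset.map_inter, ← Finset.map_inter, Ne, Finset.map_inj, hZi i hi, hZi j hj]
      exact hXne _ _ (by simpa using hij)
    · intro i hi0 hi hai
      exact ha' (Finset.mem_inter.2 ⟨ha, hZint a 0 1 i (by omega) hi0 hi ha ((hmem _ _).1 hai)⟩)
    · intro i hi hbi
      exact hb' (Finset.mem_inter.2
        ⟨hZint b i (m - 1) m (by omega) (by omega) le_rfl ((hmem _ _).1 hbi) hb, hb⟩)
  · intro w
    constructor
    · rintro ⟨i, -, hw⟩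
      obtain ⟨v, -, rfl⟩ := Finset.mem_map.1 hw
      exact ⟨v, rfl⟩
    · rintro ⟨v, rfl⟩
      obtain ⟨i, hi⟩ := hcov v
      exact ⟨i, by omega, (hmem _ _).2 (by rw [hZ i (by omega)]; exact hi)⟩
  · intro i _ u v hu hv huv
    exact hXcl _ u ((hmem _ _).1 hu) v ((hmem _ _).1 hv) huv

end SimpleGraph

/-- Let `k ≥ 2`, `n ≥ k + 4`, and let `𝒮` be a set of pairwise
non-isomorphic `n`-vertex simple `k`-paths. If `U` has treewidth at most `k` and contains
every graph of `𝒮` as a subgraph, then `|V(U)|² ≥ |𝒮|`. -/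
theorem statement15 (k n : ℕ) (hk : 2 ≤ k) (hn : k + 4 ≤ n)
    (S : Finset (SimpleGraph (Fin n)))
    (hS : ∀ G ∈ S, IsSimpleKPath k G)
    (hiso : ∀ G ∈ S, ∀ H ∈ S, G ≠ H → IsEmpty (G ≃g H))
    (N : ℕ) (U : SimpleGraph (Fin N))
    (hU : HasTreewidthAtMost U k)
    (hcont : ∀ G ∈ S, ContainsSub U G) :
    S.card ≤ N ^ 2 := by
  have key : ∀ G : S, ∃ (f : Fin n → Fin N) (m : ℕ) (X : ℕ → Finset (Fin N)) (e : Fin N × Fin N),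
      Function.Injective f ∧ U.IsSimpleCliquePath k m X e.1 e.2 ∧
      (∀ w, (∃ i ≤ m, w ∈ X i) ↔ w ∈ Set.range f) ∧
      ∀ u v, G.1.Adj u v ↔ U.Adj (f u) (f v) := by
    rintro ⟨G, hG⟩
    obtain ⟨f, hf, hfU⟩ := hcont G hG
    obtain ⟨m, X, a, b, hX, hr, hcl⟩ := SimpleGraph.IsSimpleKPath.exists_isSimpleCliquePath
      (hS G hG) (by rw [Fintype.card_fin]; omega) hf hfU
    refine ⟨f, m, X, (a, b), hf, hX, hr, fun u v => ⟨hfU u v, fun huv => ?_⟩⟩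
    obtain ⟨i, hi, hu, hv⟩ :=
      hX.exists_mem_mem_of_adj hU ((hr _).2 ⟨u, rfl⟩) ((hr _).2 ⟨v, rfl⟩) huv
    exact hcl i hi u v hu hv (by rintro rfl; exact huv.ne rfl)
  choose f m X e hf hX hr hadj using key
  have hinj : Function.Injective e := by
    intro G H hGH
    by_contra hne
    have hXH : U.IsSimpleCliquePath k (m H) (X H) (e G).1 (e G).2 := hGH ▸ hX H
    have hrange : Set.range (f G) = Set.range (f H) := by
      ext w
      rw [← hr G, ← hr H]
      exact ⟨(hX G).exists_mem_of_mem hXH hU, hXH.exists_mem_of_mem (hX G) hU⟩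
    let φ : Fin n ≃ Fin n := (Equiv.ofInjective _ (hf G)).trans
      ((Equiv.setCongr hrange).trans (Equiv.ofInjective _ (hf H)).symm)
    have hφ : ∀ v, f H (φ v) = f G v := by
      intro v
      simp [φ, Equiv.apply_ofInjective_symm]
    refine (hiso G G.2 H H.2 (fun h => hne (Subtype.ext h))).false ⟨φ, ?_⟩
    intro u v
    rw [hadj, hadj, hφ, hφ]
  have := Fintype.card_le_of_injective e hinj
  rwa [Fintype.card_coe, Fintype.card_prod, Fintype.card_fin, ← sq] at this
end

section
/- Let k ≥ 2 and n ≥ k+4 be integers. If U is a finite simple graph of treewidth at most k that contains every n-vertex graph of pathwidth at most k as a subgraph, then U has at least k^{(n−2k−2)/2} vertices. -/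
open SimpleGraph

/-- `G` has a path-decomposition of width at most `k`. -/
def HasPathwidthAtMost {V : Type*} (G : SimpleGraph V) (k : ℕ) : Prop :=
  ∃ (m : ℕ) (B : Fin (m + 1) → Set V),
    (∀ v, ∃ i, v ∈ B i) ∧
    (∀ u v, G.Adj u v → ∃ i, u ∈ B i ∧ v ∈ B i) ∧
    (∀ v, ∀ i j l : Fin (m + 1), i ≤ j → j ≤ l → v ∈ B i → v ∈ B l → v ∈ B j) ∧
    (∀ i, (B i).ncard ≤ k + 1)
/-- If `t` is a vertex of the subtree `A` closest to the root `r`, then every subtree `B` that meets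
`A` and has a vertex at most as far from `r` as `t` contains `t`. -/
lemma mem_of_subtree_inter {ι : Type*} {T : SimpleGraph ι} (hT : T.IsTree) (r : ι) {A B : Set ι}
    (hA : (T.induce A).Connected) (hB : (T.induce B).Connected) (hAB : (A ∩ B).Nonempty)
    {t : ι} (htA : t ∈ A) (ht : ∀ x ∈ A, T.dist r t ≤ T.dist r x)
    {s : ι} (hsB : s ∈ B) (hs : T.dist r s ≤ T.dist r t) : t ∈ B := by
  obtain ⟨z, hzA, hzB⟩ := hAB
  -- a vertex of `D` with a neighbour outside `D` is `t`, and that neighbour is closer to `r`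
  let D : Set ι := {x | T.dist r x = T.dist r t + T.dist t x}
  have htD : t ∈ D := by simp [D]
  have leave : ∀ x y, T.Adj x y → x ∈ D → y ∉ D → x = t ∧ T.dist r y < T.dist r t := by
    intro x y hxy hx hy
    simp only [D, Set.mem_ofPred_eq] at hx hy
    have tri := hT.connected.dist_triangle (u := r) (v := t) (w := y)
    have h1 := hT.dist_eq_dist_add_one_of_adj r hxy
    have h2 := hT.dist_eq_dist_add_one_of_adj t hxy
    have hd : T.dist r x = T.dist r y + 1 := by omega
    have hxt : x = t := by
      by_contra hne
      have hpos := hT.connected.pos_dist_of_ne (Ne.symm hne)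
      obtain ⟨p, hp, hpl⟩ := hT.connected.exists_path_of_dist t x
      have hnn : ¬ p.Nil := SimpleGraph.Walk.not_nil_of_ne (Ne.symm hne)
      have hadj := p.adj_penultimate hnn
      have hlen : T.dist t p.penultimate + 1 ≤ T.dist t x := by
        have := SimpleGraph.dist_le p.dropLast
        have h3 := p.length_dropLast_add_one hnn
        omega
      have tri' := hT.connected.dist_triangle (u := r) (v := t) (w := p.penultimate)
      have hd' : T.dist r x = T.dist r p.penultimate + 1 := by
        have := hT.dist_eq_dist_add_one_of_adj r hadj
        omega
      obtain ⟨q, hq, hql⟩ := hT.connected.exists_path_of_dist r x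
      have mem : ∀ y, T.Adj x y → T.dist r x = T.dist r y + 1 → y = q.penultimate := by
        intro y hxy hd
        refine hT.isAcyclic.eq_penultimate_of_adj_end hq hxy ?_
        obtain ⟨q', hq', hql'⟩ := hT.connected.exists_path_of_dist r y
        refine hT.isAcyclic.mem_support_of_ne_mem_support_of_adj_of_isPath hq hq' hxy ?_
        classical
        intro hmem
        have h4 := SimpleGraph.dist_le (q'.takeUntil x hmem)
        have h5 := q'.length_takeUntil_le_length hmem
        omega
      have e : y = p.penultimate := (mem y hxy hd).trans (mem _ hadj.symm hd').symm
      subst e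
      omega
    subst hxt
    exact ⟨rfl, by omega⟩
  have cross : ∀ C : Set ι, (T.induce C).Connected → ∀ x ∈ C, ∀ y ∈ C, x ∈ D → y ∉ D →
      ∃ u ∈ C, ∃ v ∈ C, T.Adj u v ∧ u ∈ D ∧ v ∉ D := by
    intro C hC x hx y hy hxD hyD
    obtain ⟨p⟩ := hC.preconnected ⟨x, hx⟩ ⟨y, hy⟩
    obtain ⟨d, -, h1, h2⟩ := p.exists_boundary_dart {u | (u : ι) ∈ D} hxD hyD
    exact ⟨_, d.fst.2, _, d.snd.2, d.adj, h1, h2⟩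
  have hzD : z ∈ D := by
    by_contra hzD
    obtain ⟨u, hu, v, hv, huv, huD, hvD⟩ := cross A hA t htA z hzA htD hzD
    have := ht v hv
    have := (leave u v huv huD hvD).2
    omega
  by_cases hsD : s ∈ D
  · have h0 : T.dist t s = 0 := by
      simp only [D, Set.mem_ofPred_eq] at hsD
      omega
    rwa [hT.connected.dist_eq_zero_iff.1 h0]
  · obtain ⟨u, hu, v, hv, huv, huD, hvD⟩ := cross B hB z hzB s hsB hzD hsD
    rwa [← (leave u v huv huD hvD).1]

/-- The Helly property of subtrees of a tree, with a common vertex that depends only on one member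
of the family. -/
lemma exists_subtree_top {ι : Type*} [Finite ι] {T : SimpleGraph ι} (hT : T.IsTree) :
    ∃ top : Set ι → ι, ∀ F : Set (Set ι), F.Nonempty → (∀ A ∈ F, (T.induce A).Connected) →
      (∀ A ∈ F, ∀ B ∈ F, (A ∩ B).Nonempty) → ∃ A ∈ F, ∀ B ∈ F, top A ∈ B := by
  obtain ⟨r⟩ := hT.connected.nonempty
  have hmin : ∀ A : Set ι, ∃ t, A.Nonempty → t ∈ A ∧ ∀ x ∈ A, T.dist r t ≤ T.dist r x := by
    intro A
    by_cases hA : A.Nonempty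
    · obtain ⟨t, ht, h⟩ := A.toFinite.exists_minimalFor (T.dist r) A hA
      exact ⟨t, fun _ => ⟨ht, fun x hx => (le_total _ _).elim id (h hx)⟩⟩
    · exact ⟨r, fun h => (hA h).elim⟩
  choose top htop using hmin
  refine ⟨top, fun F hF hconn hint => ?_⟩
  have hne : ∀ A ∈ F, A.Nonempty := fun A hA => (hint A hA A hA).left
  obtain ⟨A, hA, hmax⟩ := F.toFinite.exists_maximalFor (fun A => T.dist r (top A)) F hF
  refine ⟨A, hA, fun B hB => ?_⟩
  have h := htop A (hne A hA)
  exact mem_of_subtree_inter hT r (hconn A hA) (hconn B hB) (hint A hA B hB) h.1 h.2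
    (htop B (hne B hB)).1 ((le_total _ _).elim id (hmax hB))

/-- In a graph of treewidth at most `k`, every clique is contained in a set of size at most `k + 1`
that depends only on one of its vertices. -/
lemma HasTreewidthAtMost.exists_clique_cover {V : Type*} {U : SimpleGraph V} {k : ℕ}
    (hU : HasTreewidthAtMost U k) :
    ∃ β : V → Set V, (∀ v, (β v).ncard ≤ k + 1) ∧
      ∀ C : Set V, C.Nonempty → U.IsClique C → ∃ v ∈ C, C ⊆ β v := by
  obtain ⟨ι, _, T, B, hT, hcov, hadj, hconn, hcard⟩ := hU
  obtain ⟨top, htop⟩ := exists_subtree_top hT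
  refine ⟨fun v => B (top {t | v ∈ B t}), fun v => hcard _, fun C hC hcl => ?_⟩
  obtain ⟨_, ⟨v, hv, rfl⟩, h⟩ := htop ((fun v => {t | v ∈ B t}) '' C) (hC.image _)
    (by rintro _ ⟨v, -, rfl⟩; exact hconn v)
    (by
      rintro _ ⟨v, hv, rfl⟩ _ ⟨w, hw, rfl⟩
      by_cases hvw : v = w
      · subst hvw
        obtain ⟨t, ht⟩ := hcov v
        exact ⟨t, ht, ht⟩
      · exact hadj v w (hcl hv hw hvw))
  exact ⟨v, hv, fun w hw => h _ ⟨w, hw, rfl⟩⟩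

/-- In a graph of treewidth at most `k`, two distinct vertices complete to a `k`-clique lie in
different components of the complement of that clique. -/
lemma HasTreewidthAtMost.not_connected_of_complete_to_clique {V : Type*} [Finite V]
    {U : SimpleGraph V} {k : ℕ} (hU : HasTreewidthAtMost U k) {s : Fin k → V}
    (hs : Function.Injective s) (hcl : ∀ i j, i ≠ j → U.Adj (s i) (s j)) {a b : V} (hab : a ≠ b)
    (ha : ∀ i, U.Adj a (s i)) (hb : ∀ i, U.Adj b (s i)) {X : Set V}
    (hX : (U.induce X).Connected) (haX : a ∈ X) (hbX : b ∈ X) (hsX : ∀ i, s i ∉ X) : False := by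
  classical
  obtain ⟨ι, _, T, B, hT, hcov, hadj, hconn, hcard⟩ := hU
  let sub : V → Set ι := fun v => {t | v ∈ B t}
  have meet : ∀ v w, v = w ∨ U.Adj v w → (sub v ∩ sub w).Nonempty := by
    rintro v w (rfl | h)
    · obtain ⟨t, ht⟩ := hcov v
      exact ⟨t, ht, ht⟩
    · exact hadj v w h
  have walk_conn : ∀ {u v : V} (p : U.Walk u v),
      (T.induce {t | ∃ x ∈ p.support, x ∈ B t}).Connected := by
    intro u v p
    induction p with
    | @nil u =>
      have e : {t | ∃ x ∈ (SimpleGraph.Walk.nil : U.Walk u u).support, x ∈ B t} = sub u := by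
        ext t
        simp [sub]
      rw [e]
      exact hconn u
    | @cons u v w h p ih =>
      have e : {t | ∃ x ∈ (SimpleGraph.Walk.cons h p).support, x ∈ B t}
          = sub u ∪ {t | ∃ x ∈ p.support, x ∈ B t} := by
        ext t
        simp [sub]
      rw [e]
      obtain ⟨t, ht, ht'⟩ := meet u v (Or.inr h)
      exact SimpleGraph.induce_union_connected (hconn u).preconnected ih.preconnected
        ⟨t, ht, v, p.start_mem_support, ht'⟩
  obtain ⟨p, hp, hpX⟩ : ∃ p : U.Walk a b, p.IsPath ∧ ∀ x ∈ p.support, x ∈ X := by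
    obtain ⟨q⟩ := hX.preconnected ⟨a, haX⟩ ⟨b, hbX⟩
    let q' : U.Walk a b := q.map (SimpleGraph.Embedding.induce X).toHom
    refine ⟨q'.bypass, q'.bypass_isPath, fun x hx => ?_⟩
    have := q'.support_bypass_subset_support hx
    have hsupp : q'.support = q.support.map Subtype.val := SimpleGraph.Walk.support_map _ q
    rw [hsupp, List.mem_map] at this
    obtain ⟨y, -, hy⟩ := this
    exact hy ▸ y.2
  cases p with
  | nil => exact hab rfl
  | @cons _ c _ hac q =>
    rw [SimpleGraph.Walk.cons_isPath_iff] at hp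
    let Q : Set ι := {t | ∃ x ∈ q.support, x ∈ B t}
    have subQ : ∀ x ∈ q.support, sub x ⊆ Q := fun x hx t ht => ⟨x, hx, ht⟩
    have haQ : (sub a ∩ Q).Nonempty :=
      (meet a c (Or.inr hac)).mono (Set.inter_subset_inter_right _ (subQ c q.start_mem_support))
    have hsQ : ∀ i, (sub (s i) ∩ Q).Nonempty := fun i =>
      (meet _ b (Or.inr (hb i).symm)).mono
        (Set.inter_subset_inter_right _ (subQ b q.end_mem_support))
    have hQQ : (Q ∩ Q).Nonempty := by
      rw [Set.inter_self]
      exact haQ.right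
    obtain ⟨top, htop⟩ := exists_subtree_top hT
    obtain ⟨A, -, hA⟩ := htop (insert Q (insert (sub a) (Set.range fun i => sub (s i))))
      (Set.insert_nonempty _ _)
      (by
        rintro A (rfl | rfl | ⟨i, rfl⟩)
        · exact walk_conn q
        · exact hconn _
        · exact hconn _)
      (by
        rintro A (rfl | rfl | ⟨i, rfl⟩) C (rfl | rfl | ⟨j, rfl⟩)
        · exact hQQ
        · rwa [Set.inter_comm]
        · rw [Set.inter_comm]
          exact hsQ j
        · exact haQ
        · exact meet a a (Or.inl rfl)
        · exact meet _ _ (Or.inr (ha j))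
        · exact hsQ i
        · exact meet _ _ (Or.inr (ha i).symm)
        · refine meet _ _ ?_
          by_cases hij : i = j
          · exact Or.inl (congrArg s hij)
          · exact Or.inr (hcl i j hij))
    obtain ⟨x, hxq, hx⟩ : top A ∈ Q := hA _ (Or.inl rfl)
    have hat : a ∈ B (top A) := hA _ (Or.inr (Or.inl rfl))
    have hst : ∀ i, s i ∈ B (top A) := fun i => hA _ (Or.inr (Or.inr ⟨i, rfl⟩))
    have hqX : ∀ y ∈ q.support, y ∈ X := fun y hy => hpX y (by simp [hy])
    have hsub : insert x (insert a (Set.range s)) ⊆ B (top A) := by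
      rintro y (rfl | rfl | ⟨i, rfl⟩)
      exacts [hx, hat, hst i]
    have hxa : x ≠ a := fun h => hp.2 (h ▸ hxq)
    have h1 : a ∉ Set.range s := by
      rintro ⟨i, hi⟩
      exact hsX i (hi ▸ haX)
    have h2 : x ∉ insert a (Set.range s) := by
      rintro (h | ⟨i, hi⟩)
      · exact hxa h
      · exact hsX i (hi ▸ hqX x hxq)
    have hle := (Set.ncard_le_ncard hsub (Set.toFinite _)).trans (hcard (top A))
    rw [Set.ncard_insert_of_notMem h2, Set.ncard_insert_of_notMem h1, Set.ncard_range_of_injective hs,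
      Nat.card_fin] at hle
    omega

/-- The `k`-tuples of vertices to which the vertices `k, k + 1, …` of a `k`-path are attached: each
new vertex takes the place, prescribed by the word `w`, of one vertex of the current tuple. -/
def kPathAttach {k : ℕ} (w : ℕ → Fin k) : ℕ → Fin k → ℕ
  | 0 => fun j => j
  | i + 1 => Function.update (kPathAttach w i) (w i) (k + i)

/-- The bags of the `k`-path with word `w`. -/
def kPathBag {k : ℕ} (w : ℕ → Fin k) (i : ℕ) : Set ℕ :=
  insert (k + i) (Set.range (kPathAttach w i))

/-- The `k`-path on `n` vertices with word `w`. -/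
def kPath {k : ℕ} (w : ℕ → Fin k) (n : ℕ) : SimpleGraph (Fin n) where
  Adj u v := u ≠ v ∧ ∃ i, k + i < n ∧ (u : ℕ) ∈ kPathBag w i ∧ (v : ℕ) ∈ kPathBag w i
  symm := ⟨fun _ _ ⟨h, i, hi, hu, hv⟩ => ⟨h.symm, i, hi, hv, hu⟩⟩
  loopless := ⟨fun _ h => h.1 rfl⟩

lemma kPathAttach_lt {k : ℕ} (w : ℕ → Fin k) (i : ℕ) (j : Fin k) : kPathAttach w i j < k + i := by
  induction i with
  | zero => simp [kPathAttach]
  | succ i ih =>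
    rw [kPathAttach, Function.update_apply]
    split_ifs <;> omega

lemma kPathAttach_injective {k : ℕ} (w : ℕ → Fin k) (i : ℕ) :
    Function.Injective (kPathAttach w i) := by
  induction i with
  | zero => exact Fin.val_injective
  | succ i ih =>
    intro a b hab
    have ha := kPathAttach_lt w i a
    have hb := kPathAttach_lt w i b
    simp only [kPathAttach, Function.update_apply] at hab
    split_ifs at hab with h1 h2 h2
    · rw [h1, h2]
    · omega
    · omega
    · exact ih hab

lemma kPathAttach_congr {k : ℕ} {w w' : ℕ → Fin k} {i : ℕ} (h : ∀ l < i, w l = w' l) :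
    kPathAttach w i = kPathAttach w' i := by
  induction i with
  | zero => rfl
  | succ i ih => rw [kPathAttach, kPathAttach, ih fun l hl => h l (by omega), h i (by omega)]

lemma le_of_mem_kPathBag {k : ℕ} {w : ℕ → Fin k} {i x : ℕ} (hx : x ∈ kPathBag w i) :
    x ≤ k + i := by
  rcases hx with rfl | ⟨j, rfl⟩
  · exact le_rfl
  · exact (kPathAttach_lt w i j).le

lemma kPathAttach_succ_mem_kPathBag {k : ℕ} (w : ℕ → Fin k) (i : ℕ) (j : Fin k) :
    kPathAttach w (i + 1) j ∈ kPathBag w i := by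
  rw [kPathAttach, Function.update_apply]
  split_ifs
  · exact Or.inl rfl
  · exact Or.inr ⟨j, rfl⟩

lemma mem_kPathBag_of_mem_succ {k : ℕ} {w : ℕ → Fin k} {i x : ℕ} (hx : x ∈ kPathBag w (i + 1))
    (hle : x ≤ k + i) : x ∈ kPathBag w i := by
  rcases hx with rfl | ⟨j, rfl⟩
  · omega
  · exact kPathAttach_succ_mem_kPathBag w i j

lemma mem_kPathBag_of_le {k : ℕ} {w : ℕ → Fin k} {i l x : ℕ} (hil : i ≤ l)
    (hx : x ∈ kPathBag w l) (hle : x ≤ k + i) : x ∈ kPathBag w i := by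
  induction l, hil using Nat.le_induction with
  | base => exact hx
  | succ l hl ih => exact ih (mem_kPathBag_of_mem_succ hx (by omega))

lemma mem_kPathBag_zero {k : ℕ} (w : ℕ → Fin k) {x : ℕ} (hx : x ≤ k) : x ∈ kPathBag w 0 := by
  rcases hx.eq_or_lt with rfl | h
  · exact Or.inl rfl
  · exact Or.inr ⟨⟨x, h⟩, rfl⟩

lemma ncard_kPathBag_le {k : ℕ} (w : ℕ → Fin k) (i : ℕ) : (kPathBag w i).ncard ≤ k + 1 := by
  refine (Set.ncard_insert_le _ _).trans ?_
  rw [Set.ncard_range_of_injective (kPathAttach_injective w i), Nat.card_fin]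

lemma kPath_hasPathwidthAtMost {k : ℕ} (w : ℕ → Fin k) (M : ℕ) :
    HasPathwidthAtMost (kPath w (k + M + 1)) k := by
  refine ⟨M, fun i => {v | (v : ℕ) ∈ kPathBag w i}, fun v => ?_, ?_, ?_, fun i => ?_⟩
  · by_cases hv : (v : ℕ) ≤ k
    · exact ⟨0, mem_kPathBag_zero w hv⟩
    · refine ⟨⟨v - k, by omega⟩, Or.inl ?_⟩
      simp only
      omega
  · rintro u v ⟨-, i, hi, hu, hv⟩
    exact ⟨⟨i, by omega⟩, hu, hv⟩
  · intro v i j l hij hjl hi hl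
    have h1 : (i : ℕ) ≤ j := hij
    have h2 := le_of_mem_kPathBag (show (v : ℕ) ∈ kPathBag w i from hi)
    exact mem_kPathBag_of_le (show (j : ℕ) ≤ l from hjl) hl (by omega)
  · refine (Set.ncard_le_ncard_of_injOn Fin.val (fun v hv => hv) Fin.val_injective.injOn
      ((Set.finite_range _).insert _)).trans (ncard_kPathBag_le w i)

/-- `f` embeds the `k`-path on the vertices `0, …, k + M` with word `w` into `U`. -/
def EmbedsKPath {V : Type*} (U : SimpleGraph V) {k : ℕ} (M : ℕ) (w : ℕ → Fin k) (f : ℕ → V) :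
    Prop :=
  (∀ x ≤ k + M, ∀ y ≤ k + M, f x = f y → x = y) ∧
    ∀ i ≤ M, ∀ x ∈ kPathBag w i, ∀ y ∈ kPathBag w i, x ≠ y → U.Adj (f x) (f y)

lemma exists_embedsKPath {V : Type*} {U : SimpleGraph V} {k M : ℕ} {w : ℕ → Fin k}
    (h : ContainsSub U (kPath w (k + M + 1))) : ∃ f, EmbedsKPath U M w f := by
  obtain ⟨g, hg, hadj⟩ := h
  have hval : ∀ x ≤ k + M, (Fin.ofNat (k + M + 1) x : ℕ) = x := fun x hx =>
    Nat.mod_eq_of_lt (by omega)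
  refine ⟨fun x => g (Fin.ofNat _ x), fun x hx y hy hxy => ?_, fun i hi x hx y hy hxy => ?_⟩
  · rw [← hval x hx, ← hval y hy, hg hxy]
  · have h1 := hval x (by have := le_of_mem_kPathBag hx; omega)
    have h2 := hval y (by have := le_of_mem_kPathBag hy; omega)
    refine hadj _ _ ⟨fun h => hxy ?_, i, by omega, ?_, ?_⟩
    · rw [← h1, ← h2, h]
    · rwa [h1]
    · rwa [h2]

lemma EmbedsKPath.adj_attach {V : Type*} {U : SimpleGraph V} {k M : ℕ} {w : ℕ → Fin k} {f : ℕ → V}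
    (hf : EmbedsKPath U M w f) {i : ℕ} (hi : i ≤ M) (j : Fin k) :
    U.Adj (f (k + i)) (f (kPathAttach w i j)) :=
  hf.2 i hi _ (Or.inl rfl) _ (Or.inr ⟨j, rfl⟩) (kPathAttach_lt w i j).ne'

lemma EmbedsKPath.connected_image {V : Type*} {U : SimpleGraph V} {k M : ℕ} {w : ℕ → Fin k}
    {f : ℕ → V} (hf : EmbedsKPath U M w f) {i : ℕ} (hi : i ≤ M) :
    (U.induce (f '' Set.Icc (k + i) (k + M))).Connected := by
  induction hi using Nat.decreasingInduction with
  | self =>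
    rw [Set.Icc_self, Set.image_singleton]
    exact SimpleGraph.Connected.mk SimpleGraph.Preconnected.of_subsingleton
  | of_succ i hi ih =>
    have hadj : U.Adj (f (k + (i + 1))) (f (k + i)) := by
      have := hf.adj_attach (Nat.succ_le_of_lt hi) (w i)
      simpa [kPathAttach] using this
    have e : f '' Set.Icc (k + i) (k + M)
        = {f (k + (i + 1)), f (k + i)} ∪ f '' Set.Icc (k + (i + 1)) (k + M) := by
      rw [← Set.insert_Icc_add_one_left_eq_Icc (show k + i ≤ k + M by omega), Set.image_insert_eq,
        Set.insert_union, Set.singleton_union, Set.insert_comm, ← add_assoc,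
        Set.insert_eq_of_mem (s := f '' _) ⟨k + i + 1, by simp; omega, rfl⟩]
    rw [e]
    exact SimpleGraph.induce_union_connected
      (SimpleGraph.induce_pair_connected_of_adj hadj).preconnected ih.preconnected
      ⟨_, Or.inl rfl, _, ⟨le_rfl, by omega⟩, rfl⟩

/-- In a graph of treewidth at most `k`, an embedded `k`-path is determined, together with its word,
by the images of its first bag and of its last vertex. -/
lemma EmbedsKPath.eq_of_agree {V : Type*} [Finite V] {U : SimpleGraph V} {k : ℕ}
    (hU : HasTreewidthAtMost U k) {M : ℕ} {w w' : ℕ → Fin k} {f f' : ℕ → V}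
    (hf : EmbedsKPath U M w f) (hf' : EmbedsKPath U M w' f') (hinit : ∀ x ≤ k, f x = f' x)
    (hlast : f (k + M) = f' (k + M)) {i : ℕ} (hi : i ≤ M) :
    (∀ x ≤ k + i, f x = f' x) ∧ ∀ l < i, w l = w' l := by
  induction i with
  | zero => exact ⟨hinit, by simp⟩
  | succ i ih =>
    obtain ⟨hff, hww⟩ := ih (by omega)
    have hatt := kPathAttach_congr hww
    set s : Fin k → V := fun j => f (kPathAttach w (i + 1) j) with hs
    have hlt : ∀ j, kPathAttach w (i + 1) j ≤ k + i := fun j =>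
      le_of_mem_kPathBag (kPathAttach_succ_mem_kPathBag w i j)
    have hs_inj : Function.Injective s := fun a b hab =>
      kPathAttach_injective w (i + 1)
        (hf.1 _ (by have := hlt a; omega) _ (by have := hlt b; omega) hab)
    have hs_cl : ∀ a b, a ≠ b → U.Adj (s a) (s b) := fun a b hab =>
      hf.2 (i + 1) hi _ (Or.inr ⟨a, rfl⟩) _ (Or.inr ⟨b, rfl⟩)
        fun h => hab (kPathAttach_injective w (i + 1) h)
    let Y : Set V := f '' Set.Icc (k + (i + 1)) (k + M) ∪ f' '' Set.Icc (k + (i + 1)) (k + M)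
    have hY : (U.induce Y).Connected :=
      SimpleGraph.induce_union_connected (hf.connected_image hi).preconnected
        (hf'.connected_image hi).preconnected
        ⟨f (k + M), ⟨_, ⟨by omega, le_rfl⟩, rfl⟩, ⟨_, ⟨by omega, le_rfl⟩, hlast.symm⟩⟩
    have hyY : f (k + (i + 1)) ∈ Y := Or.inl ⟨_, ⟨le_rfl, by omega⟩, rfl⟩
    have hyY' : f' (k + (i + 1)) ∈ Y := Or.inr ⟨_, ⟨le_rfl, by omega⟩, rfl⟩
    have hdisj : ∀ x ≤ k + i, f x ∉ Y := by
      rintro x hx (⟨y, ⟨hy1, hy2⟩, hy⟩ | ⟨y, ⟨hy1, hy2⟩, hy⟩)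
      · have := hf.1 y hy2 x (by omega) hy
        omega
      · have := hf'.1 y hy2 x (by omega) (hy.trans (hff x hx))
        omega
    have hw : w i = w' i := by
      by_contra hne
      set x := kPathAttach w i (w i) with hx
      have hxlt : x < k + i := kPathAttach_lt w i _
      have hxs : ∀ j, kPathAttach w (i + 1) j ≠ x := by
        intro j hj
        rw [kPathAttach, Function.update_apply] at hj
        split_ifs at hj with h
        · omega
        · exact h (kPathAttach_injective w i hj)
      have hadj : U.Adj (f' (k + (i + 1))) (f x) := by
        have h1 := hf'.adj_attach hi (w i)
        rwa [kPathAttach, Function.update_of_ne hne, ← hatt, ← hx, ← hff x hxlt.le] at h1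
      refine hU.not_connected_of_complete_to_clique hs_inj hs_cl (a := f x) (b := f (k + (i + 1)))
        (X := {f' (k + (i + 1)), f x} ∪ Y)
        (fun h => hdisj x hxlt.le (h ▸ hyY))
        (fun j => hf.2 i (by omega) _ (Or.inr ⟨_, rfl⟩) _ (kPathAttach_succ_mem_kPathBag w i j)
          (hxs j).symm)
        (fun j => hf.adj_attach hi j)
        (SimpleGraph.induce_union_connected
          (SimpleGraph.induce_pair_connected_of_adj hadj).preconnected hY.preconnected
          ⟨_, Or.inl rfl, hyY'⟩)
        (Or.inl (Or.inr rfl)) (Or.inr hyY) ?_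
      rintro j ((h | h) | h)
      · exact hdisj _ (hlt j) (show s j ∈ Y from h ▸ hyY')
      · exact hxs j (hf.1 _ (by have := hlt j; omega) _ (by omega) h)
      · exact hdisj _ (hlt j) h
    have hww' : ∀ l < i + 1, w l = w' l := by
      intro l hl
      rcases (Nat.lt_succ_iff.1 hl).eq_or_lt with rfl | h
      · exact hw
      · exact hww l h
    have hatt' := kPathAttach_congr hww'
    refine ⟨fun x hx => ?_, hww'⟩
    rcases hx.eq_or_lt with rfl | hx
    · by_contra hne
      refine hU.not_connected_of_complete_to_clique hs_inj hs_cl hne (fun j => hf.adj_attach hi j)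
        (fun j => ?_) hY hyY hyY' (fun j => hdisj _ (hlt j))
      have := hf'.adj_attach hi j
      rwa [← hatt', ← hff _ (hlt j)] at this
    · exact hff x (by omega)

lemma factorial_succ_le_pow_succ {k : ℕ} (hk : 2 ≤ k) : (k + 1).factorial ≤ k ^ (k + 1) := by
  obtain ⟨m, rfl⟩ := Nat.exists_eq_add_of_le' hk
  have h1 : m.factorial ≤ (m + 2) ^ m :=
    (Nat.factorial_le_pow m).trans (Nat.pow_le_pow_left (by omega) m)
  have h2 : (m + 3) * (m + 1) ≤ (m + 2) ^ 2 := by nlinarith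
  calc (m + 2 + 1).factorial = (m + 2) * ((m + 3) * (m + 1)) * m.factorial := by
        simp only [Nat.factorial, Nat.succ_eq_add_one]
        ring
    _ ≤ (m + 2) * (m + 2) ^ 2 * (m + 2) ^ m := by gcongr
    _ = (m + 2) ^ (m + 2 + 1) := by ring

/-- A graph of treewidth at most `k` that contains all `k`-paths on `k + M + 1` vertices has many
vertices. -/
lemma pow_le_card_sq_mul_factorial {k M : ℕ} (hk : 0 < k) {V : Type*} [Fintype V]
    {U : SimpleGraph V} (hU : HasTreewidthAtMost U k)
    (hcont : ∀ w : ℕ → Fin k, ContainsSub U (kPath w (k + M + 1))) :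
    k ^ M ≤ Fintype.card V ^ 2 * (k + 1).factorial := by
  classical
  let ext : (Fin M → Fin k) → ℕ → Fin k := fun w i => if h : i < M then w ⟨i, h⟩ else ⟨0, hk⟩
  choose f hf using fun w : Fin M → Fin k => exists_embedsKPath (hcont (ext w))
  obtain ⟨β, hβ, hcl⟩ := hU.exists_clique_cover
  have henc : ∀ v, ∃ e : V → Fin (k + 1), Set.InjOn e (β v) := by
    intro v
    obtain ⟨e, -, he⟩ := (β v).toFinite.exists_injOn_of_encard_le
      (t := (Set.univ : Set (Fin (k + 1)))) (by
        rw [← (β v).toFinite.cast_ncard_eq, Set.encard_univ]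
        simpa using (Nat.cast_le (α := ℕ∞)).2 (hβ v))
    exact ⟨e, he⟩
  choose e he using henc
  have hfirst : ∀ w, ∃ v, ∀ x ≤ k, f w x ∈ β v := by
    intro w
    obtain ⟨v, -, hv⟩ := hcl (f w '' kPathBag (ext w) 0) ⟨_, _, Or.inl rfl, rfl⟩ (by
      rintro _ ⟨x, hx, rfl⟩ _ ⟨y, hy, rfl⟩ hxy
      exact (hf w).2 0 (Nat.zero_le _) x hx y hy fun h => hxy (congrArg _ h))
    exact ⟨v, fun x hx => hv ⟨x, mem_kPathBag_zero _ hx, rfl⟩⟩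
  choose b hb using hfirst
  have hmem : ∀ w (x : Fin (k + 1)), f w x ∈ β (b w) := fun w x => hb w x (by omega)
  let code : (Fin M → Fin k) → (V × V) × (Fin (k + 1) ↪ Fin (k + 1)) := fun w =>
    ((b w, f w (k + M)), ⟨fun x => e (b w) (f w x), fun x y hxy =>
      Fin.ext ((hf w).1 _ (by omega) _ (by omega) (he (b w) (hmem w x) (hmem w y) hxy))⟩)
  have hcode : Function.Injective code := by
    intro w w' h
    simp only [code, Prod.mk.injEq] at h
    obtain ⟨⟨h1, h2⟩, h3⟩ := h
    have hinit : ∀ x ≤ k, f w x = f w' x := by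
      intro x hx
      have h4 : e (b w) (f w x) = e (b w') (f w' x) :=
        DFunLike.congr_fun h3 (⟨x, by omega⟩ : Fin (k + 1))
      rw [h1] at h4
      exact he (b w') (h1 ▸ hb w x hx) (hb w' x hx) h4
    have h5 := ((hf w).eq_of_agree hU (hf w') hinit h2 le_rfl).2
    funext i
    simpa [ext] using h5 i i.2
  have := Fintype.card_le_of_injective code hcode
  rwa [Fintype.card_prod, Fintype.card_prod, Fintype.card_embedding_eq, Fintype.card_fin,
    Nat.descFactorial_self, ← sq, Fintype.card_pi_const, Fintype.card_fin] at this

/-- Let `k ≥ 2` and `n ≥ k + 4`. If `U` has treewidth at most `k` and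
contains every `n`-vertex graph of pathwidth at most `k` as a subgraph, then `U` has at
least `k^((n − 2k − 2)/2)` vertices. -/
theorem statement16 (k n : ℕ) (hk : 2 ≤ k) (hn : k + 4 ≤ n)
    (N : ℕ) (U : SimpleGraph (Fin N))
    (hU : HasTreewidthAtMost U k)
    (hcont : ∀ H : SimpleGraph (Fin n), HasPathwidthAtMost H k → ContainsSub U H) :
    (k : ℝ) ^ (((n : ℝ) - 2 * k - 2) / 2) ≤ (N : ℝ) := by
  obtain ⟨M, rfl⟩ : ∃ M, n = k + M + 1 := ⟨n - k - 1, by omega⟩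
  have h := pow_le_card_sq_mul_factorial (M := M) (by omega) hU
    fun w => hcont _ (kPath_hasPathwidthAtMost w M)
  rw [Fintype.card_fin] at h
  have h' : k ^ M ≤ N ^ 2 * k ^ (k + 1) :=
    h.trans (Nat.mul_le_mul_left _ (factorial_succ_le_pow_succ hk))
  have hk0 : (0 : ℝ) < k := by positivity
  have hreal : (k : ℝ) ^ M ≤ (N : ℝ) ^ 2 * (k : ℝ) ^ (k + 1) := mod_cast h'
  refine le_of_sq_le_sq ?_ (Nat.cast_nonneg N)
  rw [← Real.rpow_natCast, ← Real.rpow_mul hk0.le]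
  have e : (((k + M + 1 : ℕ) : ℝ) - 2 * k - 2) / 2 * ((2 : ℕ) : ℝ) = (M : ℝ) - ((k + 1 : ℕ) : ℝ) := by
    push_cast
    ring
  rw [e, Real.rpow_sub hk0, Real.rpow_natCast, Real.rpow_natCast, div_le_iff₀ (by positivity)]
  exact hreal
end
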